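/- Suppose A is a separable unital homogeneous C*-algebra, i.e., A is *-isomorphic to a finite direct sum ⊕_{k=1}^{t} M_{n_k}(C(X_k)) where each X_k is a compact metric space, and M is a von Neumann algebra on a complex Hilbert space. Then for every π ∈ Rep(A,M), the closure U_M(π)⁻ of the unitary orbit of π is path-connected, and for every ρ ∈ U_M(π)⁻ there is a strong internal path from π to ρ. -/

import Mathlib

open Filter

/-- The unitary orbit of a representation `π : A → B(H)` under conjugation by unitaries of a
von Neumann algebra `M`, as a set of functions `A → B(H)` (with the topology of pointwise
norm convergence, i.e. the product topology). -/
def unitaryOrbitVN {A H : Type*} [CStarAlgebra A] [NormedAddCommGroup H]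
    [InnerProductSpace ℂ H] [CompleteSpace H] (M : VonNeumannAlgebra H)
    (π : A →⋆ₐ[ℂ] (H →L[ℂ] H)) : Set (A → (H →L[ℂ] H)) :=
  {f | ∃ u : H →L[ℂ] H, u ∈ M ∧ u ∈ unitary (H →L[ℂ] H) ∧ f = fun a => star u * π a * u}

/-- A strong internal path from `π` to `ρ`: a norm-continuous family `γ : [0,1) → U_M` of
unitaries of `M` such that `γ(t)* π(a) γ(t) → ρ(a)` in norm as `t → 1⁻`, for every `a`. -/
def StrongInternalPathVN {A H : Type*} [CStarAlgebra A] [NormedAddCommGroup H]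
    [InnerProductSpace ℂ H] [CompleteSpace H] (M : VonNeumannAlgebra H)
    (π ρ : A →⋆ₐ[ℂ] (H →L[ℂ] H)) : Prop :=
  ∃ γ : ℝ → (H →L[ℂ] H),
    ContinuousOn γ (Set.Ico 0 1) ∧
    (∀ t ∈ Set.Ico (0 : ℝ) 1, γ t ∈ M ∧ γ t ∈ unitary (H →L[ℂ] H)) ∧
    ∀ a : A, Tendsto (fun t => star (γ t) * π a * γ t)
      (nhdsWithin 1 (Set.Ico 0 1)) (nhds (ρ a))

open Topology TopologicalSpace

set_option linter.unusedSimpArgs false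
set_option linter.unusedSectionVars false

namespace VNPath

section Basic

variable {H : Type*} [NormedAddCommGroup H] [InnerProductSpace ℂ H] [CompleteSpace H]

theorem mem_of_commute {N : VonNeumannAlgebra H} {T : H →L[ℂ] H}
    (h : ∀ c ∈ N.commutant, c * T = T * c) : T ∈ N := by
  rw [← N.commutant_commutant, VonNeumannAlgebra.mem_commutant_iff]
  exact h

theorem commute_of_mem {N : VonNeumannAlgebra H} {T c : H →L[ℂ] H}
    (hT : T ∈ N) (hc : c ∈ N.commutant) : c * T = T * c :=
  (VonNeumannAlgebra.mem_commutant_iff.1 hc T hT).symm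

/-- The projection onto the closed span of the ranges of a family of operators. -/
noncomputable def supProj {ι : Type*} (x : ι → H →L[ℂ] H) : H →L[ℂ] H :=
  (⨆ i, (x i).range).topologicalClosure.starProjection

theorem isStarProjection_supProj {ι : Type*} (x : ι → H →L[ℂ] H) :
    IsStarProjection (supProj x) :=
  isStarProjection_starProjection

theorem supProj_mul {ι : Type*} (x : ι → H →L[ℂ] H) (i : ι) : supProj x * x i = x i := by
  ext h
  refine Submodule.starProjection_eq_self_iff.2 (Submodule.le_topologicalClosure _ ?_)
  exact Submodule.mem_iSup_of_mem i ⟨h, rfl⟩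

theorem mul_supProj_eq_zero {ι : Type*} {x : ι → H →L[ℂ] H} {T : H →L[ℂ] H}
    (hT : ∀ i, T * x i = 0) : T * supProj x = 0 := by
  have key : (⨆ i, (x i).range).topologicalClosure ≤ LinearMap.ker (T : H →ₗ[ℂ] H) := by
    refine Submodule.topologicalClosure_minimal _ (iSup_le fun i => ?_) T.isClosed_ker
    rintro _ ⟨h, rfl⟩
    exact DFunLike.congr_fun (hT i) h
  ext h
  exact key (Submodule.starProjection_apply_mem _ _)

theorem mul_supProj_congr {ι : Type*} {x : ι → H →L[ℂ] H} {S T : H →L[ℂ] H}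
    (hT : ∀ i, S * x i = T * x i) : S * supProj x = T * supProj x := by
  rw [← sub_eq_zero, ← sub_mul]
  exact mul_supProj_eq_zero fun i => by rw [sub_mul, hT i, sub_self]

theorem supProj_commute {ι : Type*} {x : ι → H →L[ℂ] H} {c : H →L[ℂ] H}
    (h1 : ∀ i, c * x i = supProj x * (c * x i))
    (h2 : ∀ i, star c * x i = supProj x * (star c * x i)) :
    c * supProj x = supProj x * c := by
  have e1 : c * supProj x = supProj x * c * supProj x :=
    mul_supProj_congr fun i => by rw [mul_assoc]; exact h1 i
  have e2 : star c * supProj x = supProj x * star c * supProj x :=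
    mul_supProj_congr fun i => by rw [mul_assoc]; exact h2 i
  have hE := (isStarProjection_supProj x).isSelfAdjoint.star_eq
  have e3 := congrArg star e2
  rw [star_mul, star_mul, star_mul, star_star, hE] at e3
  rw [e1, mul_assoc, ← e3]

theorem supProj_commute' {ι : Type*} {x : ι → H →L[ℂ] H} {c : H →L[ℂ] H}
    (h1 : ∀ i, c * x i = x i * c) (h2 : ∀ i, star c * x i = x i * star c) :
    c * supProj x = supProj x * c :=
  supProj_commute (fun i => by rw [h1, ← mul_assoc, supProj_mul])
    (fun i => by rw [h2, ← mul_assoc, supProj_mul])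

theorem supProj_mem {N : VonNeumannAlgebra H} {ι : Type*} {x : ι → H →L[ℂ] H}
    (h : ∀ i, x i ∈ N) : supProj x ∈ N :=
  mem_of_commute fun _ hc => supProj_commute' (fun i => commute_of_mem (h i) hc)
    (fun i => commute_of_mem (h i) (star_mem hc))

/-- The projection onto the closure of the range of an operator. -/
noncomputable def rangeProj (T : H →L[ℂ] H) : H →L[ℂ] H := supProj fun _ : Unit => T

theorem isStarProjection_rangeProj (T : H →L[ℂ] H) : IsStarProjection (rangeProj T) :=
  isStarProjection_supProj _

theorem rangeProj_mul (T : H →L[ℂ] H) : rangeProj T * T = T := supProj_mul (fun _ : Unit => T) ()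

theorem mul_rangeProj_eq_zero {S T : H →L[ℂ] H} (h : S * T = 0) : S * rangeProj T = 0 :=
  mul_supProj_eq_zero fun _ => h

theorem mul_rangeProj_congr {R S T : H →L[ℂ] H} (h : R * T = S * T) :
    R * rangeProj T = S * rangeProj T :=
  mul_supProj_congr fun _ => h

theorem rangeProj_mem {N : VonNeumannAlgebra H} {T : H →L[ℂ] H} (h : T ∈ N) : rangeProj T ∈ N :=
  supProj_mem fun _ => h

theorem mul_rangeProj_star (T : H →L[ℂ] H) : T * rangeProj (star T) = T := by
  have := congrArg star (rangeProj_mul (star T))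
  rwa [star_mul, star_star, (isStarProjection_rangeProj _).isSelfAdjoint.star_eq] at this

theorem star_mul_self_eq_zero {T : H →L[ℂ] H} (h : star T * T = 0) : T = 0 :=
  CStarRing.star_mul_self_eq_zero_iff T |>.1 h

theorem mul_of_star_mul_self_eq {v e : H →L[ℂ] H} (he : IsStarProjection e)
    (h : star v * v = e) : v * e = v := by
  have h1 := he.isSelfAdjoint.star_eq
  have h2 : e * e = e := he.isIdempotentElem
  rw [← sub_eq_zero]
  apply star_mul_self_eq_zero
  have h3 : star v * v * e = e * e := by rw [h]
  simp only [star_sub, star_mul, h1, sub_mul, mul_sub]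
  simp only [mul_assoc] at *
  simp only [h, h2, h3, sub_self]

theorem norm_apply_eq_of_star_mul_self_eq {S T : H →L[ℂ] H} (h : star S * S = star T * T) (x : H) :
    ‖S x‖ = ‖T x‖ := by
  have key : ∀ R : H →L[ℂ] H, ‖R x‖ ^ 2 = RCLike.re (inner ℂ ((star R * R) x) x) := by
    intro R
    rw [ContinuousLinearMap.star_eq_adjoint, mul_apply_eq_comp,
      ContinuousLinearMap.adjoint_inner_left, inner_self_eq_norm_sq]
  have := key S
  rw [h, ← key T] at this
  exact (sq_eq_sq₀ (norm_nonneg _) (norm_nonneg _)).1 this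

theorem star_mul_self_eq_of_norm_apply_eq {S T : H →L[ℂ] H} (h : ∀ x, ‖S x‖ = ‖T x‖) :
    star S * S = star T * T := by
  have key : ∀ (R : H →L[ℂ] H) x, inner ℂ ((star R * R) x) x = ((‖R x‖ ^ 2 : ℝ) : ℂ) := by
    intro R x
    rw [ContinuousLinearMap.star_eq_adjoint, mul_apply_eq_comp,
      ContinuousLinearMap.adjoint_inner_left, inner_self_eq_norm_sq_to_K]
    simp
  apply ContinuousLinearMap.coe_injective
  rw [← ext_inner_map]
  intro x
  have := key S x
  rw [h x, ← key T x] at this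
  exact this

open ContinuousLinearMap in
/-- Polar decomposition. -/
theorem exists_polar (T : H →L[ℂ] H) : ∃ v : H →L[ℂ] H,
    v * CFC.abs T = T ∧ star v * v = rangeProj (star T) ∧ v * star v = rangeProj T ∧
    ∀ c, c * T = T * c → c * star T = star T * c → c * v = v * c := by
  set A := CFC.abs T with hA
  have hAsa : star A = A := (CFC.abs_nonneg T).isSelfAdjoint.star_eq
  have hAA : star A * A = star T * T := by rw [hAsa]; exact CFC.abs_mul_abs T
  have hn : ∀ x, ‖A x‖ = ‖T x‖ := norm_apply_eq_of_star_mul_self_eq hAA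
  set K := (A.range).topologicalClosure with hK
  set P := rangeProj A with hP
  have hPK : P = K.starProjection := by
    simp only [hP, rangeProj, supProj, hK, iSup_const]
  let e : H →ₗ[ℂ] K := LinearMap.codRestrict K (A : H →ₗ[ℂ] H)
    fun x => Submodule.le_topologicalClosure _ ⟨x, rfl⟩
  have hd : DenseRange e := by
    intro y
    have hy : (y : H) ∈ closure (A.range : Set H) := y.2
    rw [Metric.mem_closure_iff] at hy ⊢
    intro ε hε
    obtain ⟨_, ⟨x, rfl⟩, hx⟩ := hy ε hε
    exact ⟨e x, ⟨x, rfl⟩, hx⟩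
  have hne : ∀ x, ‖(T : H →ₗ[ℂ] H) x‖ ≤ 1 * ‖e x‖ := fun x => by
    rw [one_mul]; exact (hn x).ge
  let V := (T : H →ₗ[ℂ] H).extendOfNorm e
  have hV : ∀ x, V (e x) = T x := LinearMap.extendOfNorm_eq hd ⟨1, hne⟩
  have hVn : ∀ y : K, ‖V y‖ = ‖y‖ := by
    intro y
    refine hd.induction_on (p := fun y => ‖V y‖ = ‖y‖) y ?_ ?_
    · exact isClosed_eq (by fun_prop) (by fun_prop)
    · intro x; rw [hV]; exact (hn x).symm
  let v : H →L[ℂ] H := V ∘L K.orthogonalProjectionOnto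
  have hvA : v * A = T := by
    ext x
    have h1 : K.orthogonalProjectionOnto (A x) = e x := by
      have := K.orthogonalProjectionOnto_mem_subspace_eq_self (e x)
      exact this
    change V (K.orthogonalProjectionOnto (A x)) = T x
    rw [h1, hV]
  have hPp : IsStarProjection P := isStarProjection_rangeProj _
  have hvP : star v * v = P := by
    have : star v * v = star P * P := by
      refine star_mul_self_eq_of_norm_apply_eq fun x => ?_
      change ‖V (K.orthogonalProjectionOnto x)‖ = _
      rw [hVn, hPK]
      rfl
    rw [this, hPp.isSelfAdjoint.star_eq, hPp.isIdempotentElem]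
  have hvP' : v * P = v := mul_of_star_mul_self_eq hPp hvP
  have hker : ∀ S : H →L[ℂ] H, S * A = 0 ↔ S * star T = 0 := by
    intro S
    have k1 : S * A = 0 ↔ S * (A * A) = 0 := by
      constructor
      · intro h; rw [← mul_assoc, h, zero_mul]
      · intro h
        have : star (A * star S) * (A * star S) = 0 := by
          rw [star_mul, star_star, hAsa, mul_assoc, ← mul_assoc A A, ← mul_assoc, h, zero_mul]
        have := congrArg star (star_mul_self_eq_zero this)
        rwa [star_mul, star_star, hAsa, star_zero] at this
    have k2 : S * star T = 0 ↔ S * (star T * T) = 0 := by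
      constructor
      · intro h; rw [← mul_assoc, h, zero_mul]
      · intro h
        have : star (T * star S) * (T * star S) = 0 := by
          rw [star_mul, star_star, mul_assoc, ← mul_assoc (star T), ← mul_assoc, h, zero_mul]
        have := congrArg star (star_mul_self_eq_zero this)
        rwa [star_mul, star_star, star_zero] at this
    rw [k1, k2, ← hAA, hAsa]
  have hPT : P = rangeProj (star T) := by
    have hQ := isStarProjection_rangeProj (star T)
    set Q := rangeProj (star T)
    have h1 : (1 - P) * Q = 0 := by
      refine mul_rangeProj_eq_zero ((hker _).1 ?_)
      rw [sub_mul, one_mul, rangeProj_mul, sub_self]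
    have h2 : (1 - Q) * P = 0 := by
      refine mul_rangeProj_eq_zero ((hker _).2 ?_)
      rw [sub_mul, one_mul, rangeProj_mul, sub_self]
    rw [sub_mul, one_mul, sub_eq_zero] at h1 h2
    have h3 := congrArg star h1
    rw [star_mul, hQ.isSelfAdjoint.star_eq, hPp.isSelfAdjoint.star_eq] at h3
    rw [h2, ← h3]
  have hvv : v * star v = rangeProj T := by
    have hQ := isStarProjection_rangeProj T
    set Q := rangeProj T
    have hQv : Q * v = v := by
      have : (Q * v) * P = v * P := by
        refine mul_rangeProj_congr ?_
        rw [mul_assoc, hvA]; exact rangeProj_mul T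
      rwa [mul_assoc, hvP'] at this
    have h1 : v * star v * Q = 1 * Q := by
      refine mul_rangeProj_congr ?_
      rw [one_mul]
      nth_rw 1 [← hvA]
      rw [mul_assoc, ← mul_assoc (star v), hvP, hP, rangeProj_mul, hvA]
    have h2 : star v * Q = star v := by
      have := congrArg star hQv
      rwa [star_mul, hQ.isSelfAdjoint.star_eq] at this
    rwa [mul_assoc, h2, one_mul] at h1
  refine ⟨v, hvA, hvP.trans hPT, hvv, fun c hc hc' => ?_⟩
  have hcA : c * A = A * c := by
    have h1 : Commute c (star T * T) := by
      change c * (star T * T) = star T * T * c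
      rw [← mul_assoc, hc', mul_assoc, hc, mul_assoc]
    have h2 : Commute (CFC.sqrt (star T * T)) c :=
      (h1.symm.cfcₙ_nnreal NNReal.sqrt)
    exact h2.symm
  have hcA' : star c * A = A * star c := by
    have := congrArg star hcA
    simpa [star_mul, hAsa] using this.symm
  have hcP : c * P = P * c := supProj_commute' (fun _ => hcA) (fun _ => hcA')
  have h3 : c * v * P = v * c * P := by
    refine mul_rangeProj_congr ?_
    rw [mul_assoc, hvA, mul_assoc, hcA, ← mul_assoc, hvA, hc]
  calc c * v = c * v * P := by rw [mul_assoc, hvP']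
    _ = v * (c * P) := by rw [h3, mul_assoc]
    _ = v * c := by rw [hcP, ← mul_assoc, hvP']

end Basic

section Compare

variable {H : Type*} [NormedAddCommGroup H] [InnerProductSpace ℂ H] [CompleteSpace H]

theorem mul_mul_of_eq {R : Type*} [Semigroup R] {a b c : R} (h : a * b = c) (x : R) :
    a * (b * x) = c * x := by
  rw [← mul_assoc, h]

/-- `e` is a projection of the von Neumann algebra `N`. -/
structure IsPr (N : VonNeumannAlgebra H) (e : H →L[ℂ] H) : Prop where
  mem : e ∈ N
  idem : e * e = e
  sa : star e = e

/-- `z` is a central projection of `N`. -/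
structure Cen (N : VonNeumannAlgebra H) (z : H →L[ℂ] H) : Prop extends IsPr N z where
  comm : ∀ T ∈ N, z * T = T * z

/-- `v` is a partial isometry of `N` with initial projection `e` and final projection `f`. -/
structure Via (N : VonNeumannAlgebra H) (v e f : H →L[ℂ] H) : Prop where
  mem : v ∈ N
  init : star v * v = e
  fin : v * star v = f
  left : IsPr N e

/-- Murray-von Neumann equivalence of projections. -/
def Eqv (N : VonNeumannAlgebra H) (e f : H →L[ℂ] H) : Prop := ∃ v, Via N v e f

/-- Murray-von Neumann subequivalence of projections. -/
def Sub (N : VonNeumannAlgebra H) (e f : H →L[ℂ] H) : Prop :=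
  ∃ g, Eqv N e g ∧ g * f = g ∧ IsPr N f

variable {N : VonNeumannAlgebra H} {e f g e' f' g' z v w : H →L[ℂ] H}

theorem le_symm (he : star e = e) (hf : star f = f) (h : e * f = e) : f * e = e := by
  have := congrArg star h
  rwa [star_mul, he, hf] at this

theorem le_symm' (he : star e = e) (hf : star f = f) (h : f * e = e) : e * f = e := by
  have := congrArg star h
  rwa [star_mul, he, hf] at this

theorem orth_symm (he : star e = e) (hf : star f = f) (h : e * f = 0) : f * e = 0 := by
  have := congrArg star h
  rwa [star_mul, he, hf, star_zero] at this

namespace IsPr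

theorem isStarProjection (he : IsPr N e) : IsStarProjection e := ⟨he.idem, he.sa⟩

theorem of_isStarProjection (he : IsStarProjection e) (h : e ∈ N) : IsPr N e :=
  ⟨h, he.isIdempotentElem, he.isSelfAdjoint.star_eq⟩

theorem sup {ι : Type*} {x : ι → H →L[ℂ] H} (h : ∀ i, x i ∈ N) :
    IsPr N (supProj x) :=
  of_isStarProjection (isStarProjection_supProj x) (supProj_mem h)

theorem range {T : H →L[ℂ] H} (h : T ∈ N) : IsPr N (rangeProj T) :=
  of_isStarProjection (isStarProjection_rangeProj T) (rangeProj_mem h)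

theorem zero : IsPr N 0 := ⟨zero_mem _, by simp, by simp⟩

theorem one : IsPr N 1 := ⟨one_mem _, by simp, by simp⟩

theorem sub (he : IsPr N e) (hf : IsPr N f) (h : f * e = f) : IsPr N (e - f) where
  mem := sub_mem he.mem hf.mem
  idem := by
    have := le_symm hf.sa he.sa h
    simp [mul_sub, sub_mul, he.idem, hf.idem, h, this]
  sa := by rw [star_sub, he.sa, hf.sa]

theorem add (he : IsPr N e) (hf : IsPr N f) (h : e * f = 0) : IsPr N (e + f) where
  mem := add_mem he.mem hf.mem
  idem := by
    have := orth_symm he.sa hf.sa h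
    simp [mul_add, add_mul, he.idem, hf.idem, h, this]
  sa := by rw [star_add, he.sa, hf.sa]

theorem mul (he : IsPr N e) (hf : IsPr N f) (h : e * f = f * e) : IsPr N (e * f) where
  mem := mul_mem he.mem hf.mem
  idem := by
    rw [mul_assoc, ← mul_assoc f e f, ← h, mul_assoc, hf.idem, ← mul_assoc, he.idem]
  sa := by rw [star_mul, he.sa, hf.sa, h]

theorem compl (he : IsPr N e) : IsPr N (1 - e) := one.sub he (mul_one e)

end IsPr

namespace Cen

theorem zero : Cen N 0 := ⟨IsPr.zero, fun _ _ => by simp⟩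

theorem compl (hz : Cen N z) : Cen N (1 - z) :=
  ⟨hz.toIsPr.compl, fun T hT => by rw [sub_mul, mul_sub, hz.comm T hT, one_mul, mul_one]⟩

theorem mul (hz : Cen N z) (hw : Cen N w) : Cen N (z * w) :=
  ⟨hz.toIsPr.mul hw.toIsPr (hz.comm _ hw.mem), fun T hT => by
    rw [mul_assoc, hw.comm T hT, ← mul_assoc, hz.comm T hT, mul_assoc]⟩

theorem pr_mul (hz : Cen N z) (he : IsPr N e) : IsPr N (z * e) :=
  hz.toIsPr.mul he (hz.comm _ he.mem)

theorem le (he : IsPr N e) : (z * e) * e = z * e := by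
  rw [mul_assoc, he.idem]

theorem mul_mul_mul (hz : Cen N z) (he : e ∈ N) : (z * e) * (z * f) = z * (e * f) := by
  rw [mul_assoc, ← mul_assoc e z, ← hz.comm e he, mul_assoc, ← mul_assoc, hz.idem]

theorem mul_add_compl (z e : H →L[ℂ] H) : z * e + (1 - z) * e = e := by
  rw [← add_mul, add_sub_cancel, one_mul]

theorem compl_mul (hz : Cen N z) (he : e ∈ N) : (z * e) * ((1 - z) * f) = 0 := by
  rw [hz.comm e he, mul_assoc, ← mul_assoc z, mul_sub, mul_one, hz.idem, sub_self, zero_mul,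
    mul_zero]

theorem sup {ι : Type*} {x : ι → H →L[ℂ] H} (h : ∀ i, Cen N (x i)) :
    Cen N (supProj x) :=
  ⟨IsPr.sup fun i => (h i).mem, fun T hT => (supProj_commute' (fun i => ((h i).comm T hT).symm)
    (fun i => ((h i).comm _ (star_mem hT)).symm)).symm⟩

end Cen

namespace Via

theorem mul_init (h : Via N v e f) : v * e = v :=
  mul_of_star_mul_self_eq h.left.isStarProjection h.init

theorem init_mul (h : Via N v e f) : e * star v = star v := by
  have := congrArg star h.mul_init
  rwa [star_mul, h.left.sa] at this

theorem right (h : Via N v e f) : IsPr N f where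
  mem := by rw [← h.fin]; exact mul_mem h.mem (star_mem h.mem)
  idem := by
    rw [← h.fin, mul_assoc, ← mul_assoc (star v), h.init, h.init_mul]
  sa := by rw [← h.fin, star_mul, star_star]

theorem fin_mul (h : Via N v e f) : f * v = v := by
  rw [← h.fin, mul_assoc, h.init, h.mul_init]

theorem mul_fin (h : Via N v e f) : star v * f = star v := by
  rw [← h.fin, ← mul_assoc, h.init, h.init_mul]

theorem refl (h : IsPr N e) : Via N e e e := ⟨h.mem, by rw [h.sa, h.idem], by rw [h.sa, h.idem], h⟩

theorem symm (h : Via N v e f) : Via N (star v) f e :=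
  ⟨star_mem h.mem, by rw [star_star, h.fin], by rw [star_star, h.init], h.right⟩

theorem trans (h : Via N v e f) (h' : Via N w f g) : Via N (w * v) e g where
  mem := mul_mem h'.mem h.mem
  init := by rw [star_mul, mul_assoc, ← mul_assoc (star w), h'.init, h.fin_mul, h.init]
  fin := by rw [star_mul, mul_assoc, ← mul_assoc v, h.fin, h'.init_mul, h'.fin]
  left := h.left

theorem restrict (h : Via N v e f) (hg : IsPr N g) (hge : g * e = g) :
    Via N (v * g) g (v * g * star v) where
  mem := mul_mem h.mem hg.mem
  init := by rw [star_mul, hg.sa, mul_assoc, ← mul_assoc (star v), h.init, ← mul_assoc, hge, hg.idem]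
  fin := by rw [star_mul, hg.sa, mul_assoc, ← mul_assoc g, hg.idem, mul_assoc]
  left := hg

theorem restrict_le (h : Via N v e f) : v * g * star v * f = v * g * star v := by
  rw [mul_assoc, h.mul_fin]

theorem cut (h : Via N v e f) (hz : Cen N z) : Via N (z * v) (z * e) (z * f) where
  mem := mul_mem hz.mem h.mem
  init := by
    rw [star_mul, hz.sa, ← hz.comm _ (star_mem h.mem), hz.mul_mul_mul (star_mem h.mem), h.init]
  fin := by
    rw [star_mul, hz.sa, ← hz.comm _ (star_mem h.mem), hz.mul_mul_mul h.mem, h.fin]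
  left := hz.pr_mul h.left

theorem orth_init (h : Via N v e f) (h' : Via N w e' f') (he : e * e' = 0) : v * star w = 0 := by
  rw [← h.mul_init, ← h'.init_mul, mul_assoc, ← mul_assoc e, he, zero_mul, mul_zero]

theorem orth_fin (h : Via N v e f) (h' : Via N w e' f') (he : f * f' = 0) : star v * w = 0 :=
  by simpa using h.symm.orth_init h'.symm he

theorem add (h : Via N v e f) (h' : Via N w e' f') (he : e * e' = 0) (hf : f * f' = 0) :
    Via N (v + w) (e + e') (f + f') where
  mem := add_mem h.mem h'.mem
  init := by
    have h1 := h.orth_fin h' hf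
    have h2 := h'.orth_fin h (orth_symm h.right.sa h'.right.sa hf)
    simp [star_add, mul_add, add_mul, h1, h2, h.init, h'.init]
  fin := by
    have h1 := h.orth_init h' he
    have h2 := h'.orth_init h (orth_symm h.left.sa h'.left.sa he)
    simp [star_add, mul_add, add_mul, h1, h2, h.fin, h'.fin]
  left := h.left.add h'.left he

end Via

namespace Eqv

theorem left (h : Eqv N e f) : IsPr N e := h.choose_spec.left

theorem right (h : Eqv N e f) : IsPr N f := h.choose_spec.right

theorem refl (h : IsPr N e) : Eqv N e e := ⟨e, Via.refl h⟩

theorem symm (h : Eqv N e f) : Eqv N f e := by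
  obtain ⟨v, hv⟩ := h
  exact ⟨_, hv.symm⟩

theorem trans (h : Eqv N e f) (h' : Eqv N f g) : Eqv N e g := by
  obtain ⟨v, hv⟩ := h
  obtain ⟨w, hw⟩ := h'
  exact ⟨_, hv.trans hw⟩

theorem cut (h : Eqv N e f) (hz : Cen N z) : Eqv N (z * e) (z * f) := by
  obtain ⟨v, hv⟩ := h
  exact ⟨_, hv.cut hz⟩

theorem add (h : Eqv N e f) (h' : Eqv N e' f') (he : e * e' = 0) (hf : f * f' = 0) :
    Eqv N (e + e') (f + f') := by
  obtain ⟨v, hv⟩ := h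
  obtain ⟨w, hw⟩ := h'
  exact ⟨_, hv.add hw he hf⟩

theorem restrict (h : Eqv N e f) (hg : IsPr N g) (hge : g * e = g) :
    ∃ g', Eqv N g g' ∧ g' * f = g' := by
  obtain ⟨v, hv⟩ := h
  exact ⟨_, ⟨_, hv.restrict hg hge⟩, hv.restrict_le⟩

theorem eq_zero (h : Eqv N e 0) : e = 0 := by
  obtain ⟨v, hv⟩ := h
  rw [← hv.init, ← hv.fin_mul, zero_mul, mul_zero]

end Eqv

namespace Sub

theorem left (h : Sub N e f) : IsPr N e := h.choose_spec.1.left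

theorem right (h : Sub N e f) : IsPr N f := h.choose_spec.2.2

theorem of_eqv (h : Eqv N e f) : Sub N e f := ⟨f, h, h.right.idem, h.right⟩

theorem of_le (he : IsPr N e) (hf : IsPr N f) (h : e * f = e) : Sub N e f :=
  ⟨e, Eqv.refl he, h, hf⟩

theorem refl (he : IsPr N e) : Sub N e e := of_le he he he.idem

theorem trans (h : Sub N e f) (h' : Sub N f g) : Sub N e g := by
  obtain ⟨e1, h1, h2, _⟩ := h
  obtain ⟨f1, h3, h4, h5⟩ := h'
  obtain ⟨e2, h6, h7⟩ := h3.restrict h1.right h2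
  exact ⟨e2, h1.trans h6, by rw [← h7, mul_assoc, h4], h5⟩

theorem cut (h : Sub N e f) (hz : Cen N z) : Sub N (z * e) (z * f) := by
  obtain ⟨e1, h1, h2, h3⟩ := h
  exact ⟨z * e1, h1.cut hz, by rw [hz.mul_mul_mul h1.right.mem, h2], hz.pr_mul h3⟩

theorem add (h : Sub N e f) (h' : Sub N e' f') (he : e * e' = 0) (hf : f * f' = 0) :
    Sub N (e + e') (f + f') := by
  obtain ⟨e1, h1, h2, h3⟩ := h
  obtain ⟨e2, h4, h5, h6⟩ := h'
  have hf' := orth_symm h3.sa h6.sa hf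
  have k1 : e1 * f' = 0 := by rw [← h2, mul_assoc, hf, mul_zero]
  have k2 : e2 * f = 0 := by rw [← h5, mul_assoc, hf', mul_zero]
  have k3 : e1 * e2 = 0 := by
    rw [← le_symm h4.right.sa h6.sa h5, ← mul_assoc, k1, zero_mul]
  refine ⟨e1 + e2, h1.add h4 he k3, ?_, h3.add h6 hf⟩
  simp [mul_add, add_mul, k1, k2, h2, h5]

theorem zero (he : IsPr N e) : Sub N 0 e := of_le IsPr.zero he (zero_mul e)

theorem eq_zero (h : Sub N e 0) : e = 0 := by
  obtain ⟨e1, h1, h2, h3⟩ := h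
  rw [mul_zero] at h2
  subst h2
  exact h1.eq_zero

theorem le_right (h : Sub N e f) (hg : IsPr N g) (hfg : f * g = f) : Sub N e g :=
  h.trans (of_le h.right hg hfg)

end Sub

/-- The Schroeder-Bernstein argument for a projection lying between two equivalent ones. -/
theorem eqv_of_between (h : Eqv N e g) (hgf : g * f = g) (hfe : f * e = f) (hf : IsPr N f) :
    Eqv N e f := by
  obtain ⟨v, hv⟩ := h
  have he := hv.left
  have hg := hv.right
  set d := e - f with hd
  have hdp : IsPr N d := he.sub hf hfe
  have hfv : f * v = v := by
    rw [← hv.fin_mul, ← mul_assoc, le_symm hg.sa hf.sa hgf]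
  have hev : e * v = v := by rw [← hfv, ← mul_assoc, le_symm hf.sa he.sa hfe]
  have hdv : d * v = 0 := by rw [hd, sub_mul, hfv, hev, sub_self]
  have hvd : star v * d = 0 := by
    have := congrArg star hdv
    rwa [star_mul, hdp.sa, star_zero] at this
  have hed : e * d = d := by rw [hd, mul_sub, he.idem, le_symm hf.sa he.sa hfe]
  set x : ℕ → H →L[ℂ] H := fun n => v ^ n * d with hx
  have hxN : ∀ n, x n ∈ N := fun n => mul_mem (pow_mem hv.mem n) hdp.mem
  set D := supProj x with hD
  have hDp : IsPr N D := IsPr.sup hxN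
  have hDx : ∀ n, D * x n = x n := supProj_mul x
  have hDd : D * d = d := by simpa [hx] using hDx 0
  have hvx : ∀ n, v * x n = x (n + 1) := fun n => by simp [hx, pow_succ', mul_assoc]
  have hex : ∀ n, e * x n = x n := by
    intro n
    cases n with
    | zero => simpa [hx] using hed
    | succ n => rw [← hvx, ← mul_assoc, hev]
  have heD : e * D = D := by
    have := mul_supProj_congr (S := e) (T := 1) (x := x) (fun i => by rw [hex, one_mul])
    rwa [one_mul] at this
  have hDe : D * e = D := by
    have := congrArg star heD
    rwa [star_mul, he.sa, hDp.sa] at this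
  have hDvD : D * v * D = v * D :=
    mul_supProj_congr (fun i => by rw [mul_assoc, hvx, hDx])
  have hDvD' : D * star v * D = D * star v := by
    have := congrArg star hDvD
    simpa [star_mul, hDp.sa, mul_assoc] using this
  have hdD : D = v * D * star v + d := by
    have h1 : (v * D * star v + d) * D = 1 * D := by
      refine mul_supProj_congr fun n => ?_
      cases n with
      | zero =>
        have hx0 : x 0 = d := by simp [hx]
        rw [hx0, add_mul, mul_assoc, hvd, mul_zero, hdp.idem, one_mul, zero_add]
      | succ n =>
        rw [← hvx, add_mul, ← mul_assoc d, hdv, zero_mul, add_zero, mul_assoc, ← mul_assoc (star v),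
          hv.init, hex, mul_assoc, hDx, one_mul]
    have h2 : D * (v * D * star v + d) = v * D * star v + d := by
      rw [mul_add, hDd, ← mul_assoc, ← mul_assoc, hDvD]
    have h3 := congrArg star h2
    have h4 : star (v * D * star v + d) = v * D * star v + d := by
      simp [star_mul, hDp.sa, hdp.sa, mul_assoc]
    rw [star_mul, h4, hDp.sa, h1, one_mul] at h3
    exact h3
  have a1 := hv.init
  have a2 := hDp.idem
  have a3 := he.idem
  have a4 := hv.init_mul
  have a5 : star v * e = star v := by
    have := congrArg star hev
    rwa [star_mul, he.sa] at this
  have a6 : v * D * star v = D - d := eq_sub_of_add_eq hdD.symm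
  have a7 : e - d = f := sub_sub_cancel e f
  have hsa : star (v * D + (e - D)) = D * star v + (e - D) := by
    rw [star_add, star_sub, star_mul, hDp.sa, he.sa]
  refine ⟨v * D + (e - D), add_mem (mul_mem hv.mem hDp.mem) (sub_mem he.mem hDp.mem), ?_, ?_, he⟩
  · rw [hsa]
    rw [mul_assoc] at hDvD hDvD'
    simp only [mul_add, add_mul, mul_sub, sub_mul, mul_assoc, mul_mul_of_eq a1, heD, hDe, a2, a3,
      a5, hDvD, hDvD', mul_mul_of_eq hev, sub_self, add_zero]
    abel
  · rw [hsa]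
    rw [mul_assoc] at hDvD hDvD' a6
    simp only [mul_add, add_mul, mul_sub, sub_mul, mul_assoc, mul_mul_of_eq a2, heD, hDe, a2, a3,
      a6, mul_mul_of_eq heD, sub_self, add_zero, ← a7]
    abel

theorem Sub.antisymm (h : Sub N e f) (h' : Sub N f e) : Eqv N e f := by
  obtain ⟨e1, h1, h2, h3⟩ := h
  obtain ⟨f1, h4, h5, h6⟩ := h'
  obtain ⟨e2, h7, h8⟩ := h4.restrict h1.right h2
  exact (eqv_of_between (h1.trans h7) h8 h5 h4.right).trans h4.symm

end Compare

section Sums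

variable {H : Type*} [NormedAddCommGroup H] [InnerProductSpace ℂ H] [CompleteSpace H]
variable {N : VonNeumannAlgebra H}

theorem Via.zero : Via N 0 0 0 := ⟨zero_mem _, by simp, by simp, IsPr.zero⟩

theorem Via.sum {ι : Type*} {v e f : ι → H →L[ℂ] H} (s : Finset ι)
    (hv : ∀ i ∈ s, Via N (v i) (e i) (f i))
    (he : ∀ i ∈ s, ∀ j ∈ s, i ≠ j → e i * e j = 0)
    (hf : ∀ i ∈ s, ∀ j ∈ s, i ≠ j → f i * f j = 0) :
    Via N (∑ i ∈ s, v i) (∑ i ∈ s, e i) (∑ i ∈ s, f i) := by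
  classical
  induction s using Finset.induction_on with
  | empty => simpa using Via.zero
  | insert a s ha ih =>
    rw [Finset.sum_insert ha, Finset.sum_insert ha, Finset.sum_insert ha]
    have hne : ∀ i ∈ s, a ≠ i := fun i hi h => ha (h ▸ hi)
    refine (hv a (by simp)).add (ih (fun i hi => hv i (by simp [hi])) ?_ ?_) ?_ ?_
    · exact fun i hi j hj => he i (by simp [hi]) j (by simp [hj])
    · exact fun i hi j hj => hf i (by simp [hi]) j (by simp [hj])
    · rw [Finset.mul_sum]
      exact Finset.sum_eq_zero fun i hi => he a (by simp) i (by simp [hi]) (hne i hi)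
    · rw [Finset.mul_sum]
      exact Finset.sum_eq_zero fun i hi => hf a (by simp) i (by simp [hi]) (hne i hi)

theorem IsPr.sum {ι : Type*} {e : ι → H →L[ℂ] H} (s : Finset ι) (hp : ∀ i ∈ s, IsPr N (e i))
    (he : ∀ i ∈ s, ∀ j ∈ s, i ≠ j → e i * e j = 0) : IsPr N (∑ i ∈ s, e i) :=
  (Via.sum s (fun i hi => Via.refl (hp i hi)) he he).left

theorem IsPr.norm_apply_le {e : H →L[ℂ] H} (he : IsPr N e) (h : H) : ‖e h‖ ≤ ‖h‖ := by
  have h1 : ‖e h‖ ^ 2 = RCLike.re (inner ℂ (e h) h) := by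
    rw [← inner_self_eq_norm_sq (𝕜 := ℂ), ← ContinuousLinearMap.adjoint_inner_left,
      ← ContinuousLinearMap.star_eq_adjoint, he.sa, ← mul_apply_eq_comp, he.idem]
  have h2 : RCLike.re (inner ℂ (e h) h) ≤ ‖e h‖ * ‖h‖ :=
    (RCLike.re_le_norm _).trans (norm_inner_le_norm _ _)
  by_contra hlt
  push Not at hlt
  nlinarith [norm_nonneg h, norm_nonneg (e h)]

theorem Via.norm_apply_le {v e f : H →L[ℂ] H} (hv : Via N v e f) (h : H) : ‖v h‖ ≤ ‖h‖ := by
  rw [norm_apply_eq_of_star_mul_self_eq (S := v) (T := e)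
    (by rw [hv.init, hv.left.sa, hv.left.idem])]
  exact hv.left.norm_apply_le h

theorem IsPr.le_supProj {ι : Type*} {x : ι → H →L[ℂ] H} (hx : ∀ i, IsPr N (x i)) (i : ι) :
    x i * supProj x = x i :=
  le_symm' (hx i).sa (IsPr.sup fun i => (hx i).mem).sa (supProj_mul x i)

theorem supProj_le {ι : Type*} {x : ι → H →L[ℂ] H} {p : H →L[ℂ] H} (hp : IsPr N p)
    (h : ∀ i, p * x i = x i) : supProj x * p = supProj x := by
  have h1 := mul_supProj_congr (S := p) (T := 1) (x := x) (fun i => by rw [h, one_mul])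
  rw [one_mul] at h1
  exact le_symm' (isStarProjection_supProj x).isSelfAdjoint.star_eq hp.sa h1

/-- An orthogonal family of partial isometries has a sum. -/
theorem exists_via_supProj {ι : Type*} {v e f : ι → H →L[ℂ] H}
    (hv : ∀ i, Via N (v i) (e i) (f i)) (he : ∀ i j, i ≠ j → e i * e j = 0)
    (hf : ∀ i j, i ≠ j → f i * f j = 0) :
    ∃ V, Via N V (supProj e) (supProj f) ∧ (∀ i, V * e i = v i) ∧ ∀ i, f i * V = v i := by
  have hfin : ∀ s : Finset ι, Via N (∑ i ∈ s, v i) (∑ i ∈ s, e i) (∑ i ∈ s, f i) := fun s =>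
    Via.sum s (fun i _ => hv i) (fun i _ j _ => he i j) (fun i _ j _ => hf i j)
  let K : ι → Submodule ℂ H := fun i => (v i).range
  have hK : OrthogonalFamily ℂ (fun i => K i) fun i => (K i).subtypeₗᵢ := by
    rintro i j hij ⟨_, x, rfl⟩ ⟨_, y, rfl⟩
    have := (hv i).orth_fin (hv j) (hf i j hij)
    change inner ℂ (v i x) (v j y) = 0
    rw [← ContinuousLinearMap.adjoint_inner_right, ← ContinuousLinearMap.star_eq_adjoint,
      ← mul_apply_eq_comp, this]
    simp
  have hsum : ∀ h, Summable fun i => v i h := by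
    intro h
    have h1 := hK.summable_iff_norm_sq_summable (fun i => ⟨v i h, h, rfl⟩)
    refine h1.2 (summable_of_sum_le (c := ‖h‖ ^ 2) (fun i => sq_nonneg _) fun s => ?_)
    have h2 := hK.norm_sum (fun i => ⟨v i h, h, rfl⟩) s
    rw [← h2]
    have h3 : ∑ i ∈ s, (K i).subtypeₗᵢ ⟨v i h, h, rfl⟩ = (∑ i ∈ s, v i) h := by
      rw [sum_apply]; rfl
    rw [h3]
    gcongr
    exact (hfin s).norm_apply_le h
  let V0 : H →ₗ[ℂ] H :=
    { toFun := fun h => ∑' i, v i h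
      map_add' := fun x y => by
        simp only [map_add]
        exact (hsum x).tsum_add (hsum y)
      map_smul' := fun c x => by
        simp only [map_smul, RingHom.id_apply]
        exact (hsum x).tsum_const_smul c }
  let V : H →L[ℂ] H := V0.mkContinuous 1 fun h => by
    rw [one_mul]
    refine le_of_tendsto ((hsum h).hasSum.norm) (Filter.Eventually.of_forall fun s => ?_)
    have := (hfin s).norm_apply_le h
    rwa [sum_apply] at this
  have hV : ∀ h, HasSum (fun i => v i h) (V h) := fun h => (hsum h).hasSum
  have hTV : ∀ T U : H →L[ℂ] H, (∀ i, T * v i = U * v i) → T * V = U * V := by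
    intro T U h
    ext x
    refine ((hV x).mapL T).unique ?_
    have : (fun i => T (v i x)) = fun i => U (v i x) := by
      ext i; exact DFunLike.congr_fun (h i) x
    rw [this]
    exact (hV x).mapL U
  have hve : ∀ i j, i ≠ j → v i * e j = 0 := fun i j hij => by
    rw [← (hv i).mul_init, mul_assoc, he i j hij, mul_zero]
  have hfv : ∀ i j, i ≠ j → f i * v j = 0 := fun i j hij => by
    rw [← (hv j).fin_mul, ← mul_assoc, hf i j hij, zero_mul]
  have hVe : ∀ i, V * e i = v i := by
    intro i
    ext x
    have h1 := hasSum_single (f := fun j => v j (e i x)) i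
      (fun j hj => DFunLike.congr_fun (hve j i hj) x)
    have h2 : v i (e i x) = v i x := DFunLike.congr_fun ((hv i).mul_init) x
    rw [h2] at h1
    exact (hV (e i x)).unique h1
  have hfV : ∀ i, f i * V = v i := by
    intro i
    ext x
    have h1 := hasSum_single (f := fun j => f i (v j x)) i
      (fun j hj => DFunLike.congr_fun (hfv i j hj.symm) x)
    have h2 : f i (v i x) = v i x := DFunLike.congr_fun ((hv i).fin_mul) x
    rw [h2] at h1
    exact ((hV x).mapL (f i)).unique h1
  have heP : ∀ i, IsPr N (e i) := fun i => (hv i).left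
  have hfP : ∀ i, IsPr N (f i) := fun i => (hv i).right
  have hEp : IsPr N (supProj e) := IsPr.sup fun i => (heP i).mem
  have hFp : IsPr N (supProj f) := IsPr.sup fun i => (hfP i).mem
  have hVmem : V ∈ N := by
    refine mem_of_commute fun c hc => ?_
    ext x
    have h1 := (hV x).mapL c
    have : (fun i => c (v i x)) = fun i => v i (c x) := by
      ext i; exact DFunLike.congr_fun (commute_of_mem (hv i).mem hc) x
    rw [this] at h1
    exact h1.unique (hV (c x))
  have hVE : V * supProj e = V := by
    ext x
    have : (fun i => v i (supProj e x)) = fun i => v i x := by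
      ext i
      have h1 : v i * supProj e = v i := by
        rw [← (hv i).mul_init, mul_assoc, IsPr.le_supProj heP]
      exact DFunLike.congr_fun h1 x
    have h2 := hV (supProj e x)
    rw [this] at h2
    exact h2.unique (hV x)
  have hFV : supProj f * V = 1 * V := by
    refine hTV _ _ fun i => ?_
    rw [one_mul, ← (hv i).fin_mul, ← mul_assoc, supProj_mul]
  rw [one_mul] at hFV
  refine ⟨V, ⟨hVmem, ?_, ?_, hEp⟩, hVe, hfV⟩
  · have h1 : star V * V * supProj e = 1 * supProj e := by
      refine mul_supProj_congr fun i => ?_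
      have h2 := congrArg star (hfV i)
      rw [star_mul, (hfP i).sa] at h2
      rw [mul_assoc, hVe, ← (hv i).fin_mul, ← mul_assoc, h2, (hv i).init, one_mul]
    rwa [mul_assoc, hVE, one_mul] at h1
  · have h1 : V * star V * supProj f = 1 * supProj f := by
      refine mul_supProj_congr fun i => ?_
      have h2 := congrArg star (hfV i)
      rw [star_mul, (hfP i).sa] at h2
      rw [mul_assoc, h2, ← (hv i).init_mul, ← mul_assoc, hVe, (hv i).fin, one_mul]
    have h2 := congrArg star hFV
    rw [star_mul, hFp.sa] at h2
    rwa [mul_assoc, h2, one_mul] at h1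

theorem exists_eqv_supProj {ι : Type*} {e f : ι → H →L[ℂ] H}
    (hv : ∀ i, Eqv N (e i) (f i)) (he : ∀ i j, i ≠ j → e i * e j = 0)
    (hf : ∀ i j, i ≠ j → f i * f j = 0) : Eqv N (supProj e) (supProj f) := by
  choose v hv using hv
  obtain ⟨V, hV, -⟩ := exists_via_supProj hv he hf
  exact ⟨V, hV⟩

theorem orth_supProj {ι κ : Type*} {x : ι → H →L[ℂ] H} {y : κ → H →L[ℂ] H}
    (h : ∀ i j, x i * y j = 0) (hx : ∀ i, IsPr N (x i)) (hy : ∀ i, IsPr N (y i)) :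
    supProj x * supProj y = 0 := by
  have hX : IsPr N (supProj x) := IsPr.sup fun i => (hx i).mem
  have hY : IsPr N (supProj y) := IsPr.sup fun i => (hy i).mem
  refine mul_supProj_eq_zero fun j => orth_symm (hy j).sa hX.sa ?_
  exact mul_supProj_eq_zero fun i => orth_symm (hx i).sa (hy j).sa (h i j)

/-- A maximal set of elements satisfying `P` which are pairwise related by `R`. -/
theorem exists_maximal_pairwise {α : Type*} (P : α → Prop) (R : α → α → Prop)
    (hR : ∀ x y, R x y → R y x) (S₀ : Set α) (h0 : ∀ x ∈ S₀, P x) (h1 : S₀.Pairwise R) :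
    ∃ S : Set α, S₀ ⊆ S ∧ (∀ x ∈ S, P x) ∧ S.Pairwise R ∧
      ∀ x, P x → (∀ y ∈ S, R x y) → x ∈ S := by
  obtain ⟨S, hS0, hS⟩ := zorn_subset_nonempty {S : Set α | (∀ x ∈ S, P x) ∧ S.Pairwise R} (by
    intro c hc hchain hne
    refine ⟨⋃₀ c, ⟨fun x ⟨s, hs, hx⟩ => (hc hs).1 x hx, ?_⟩, fun s hs => Set.subset_sUnion_of_mem hs⟩
    rintro x ⟨s, hs, hx⟩ y ⟨t, ht, hy⟩ hxy
    obtain h | h := hchain.total hs ht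
    · exact (hc ht).2 (h hx) hy hxy
    · exact (hc hs).2 hx (h hy) hxy) S₀ ⟨h0, h1⟩
  refine ⟨S, hS0, hS.prop.1, hS.prop.2, fun x hx hxS => ?_⟩
  have : insert x S ⊆ S := hS.le_of_ge ⟨?_, ?_⟩ (Set.subset_insert _ _)
  · exact this (Set.mem_insert _ _)
  · rintro y (rfl | hy)
    exacts [hx, hS.prop.1 y hy]
  · exact hS.prop.2.insert fun y hy _ => ⟨hxS y hy, hR _ _ (hxS y hy)⟩

/-- The comparison theorem. -/
theorem exists_comparison {e f : H →L[ℂ] H} (he : IsPr N e) (hf : IsPr N f) :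
    ∃ z, Cen N z ∧ Sub N (z * e) (z * f) ∧ Sub N ((1 - z) * f) ((1 - z) * e) := by
  obtain ⟨S, -, hSP, hSR, hSmax⟩ := exists_maximal_pairwise
    (fun v => v ∈ N ∧ IsPr N (star v * v) ∧ v * e = v ∧ f * v = v)
    (fun v w => v * star w = 0 ∧ star v * w = 0)
    (fun v w ⟨h1, h2⟩ => ⟨by simpa using congrArg star h1, by simpa using congrArg star h2⟩)
    ∅ (by simp) (by simp)
  have hv : ∀ i : S, Via N (i : H →L[ℂ] H) (star (i : H →L[ℂ] H) * i) (i * star (i : H →L[ℂ] H)) :=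
    fun i => ⟨(hSP i i.2).1, rfl, rfl, (hSP i i.2).2.1⟩
  obtain ⟨V, hV, hVe, hfV⟩ := exists_via_supProj hv
    (fun i j hij => by
      have := (hSR i.2 j.2 (fun h => hij (Subtype.ext h))).1
      rw [mul_assoc, ← mul_assoc (i : H →L[ℂ] H), this, zero_mul, mul_zero])
    (fun i j hij => by
      have := (hSR i.2 j.2 (fun h => hij (Subtype.ext h))).2
      rw [mul_assoc, ← mul_assoc (star (i : H →L[ℂ] H)), this, zero_mul, mul_zero])
  set E := supProj fun i : S => star (i : H →L[ℂ] H) * (i : H →L[ℂ] H)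
  set F := supProj fun i : S => (i : H →L[ℂ] H) * star (i : H →L[ℂ] H)
  have hE := hV.left
  have hF := hV.right
  have hEe : E * e = E := supProj_le he fun i => by
    have := congrArg star (hSP i i.2).2.2.1
    rw [star_mul, he.sa] at this
    rw [← mul_assoc, this]
  have hFf : F * f = F := supProj_le hf fun i => by rw [← mul_assoc, (hSP i i.2).2.2.2]
  have hvE : ∀ v ∈ S, v * E = v := fun v hvS => by
    have h1 : v * (star v * v) = v := (hv ⟨v, hvS⟩).mul_init
    have h2 : star v * v * E = star v * v := IsPr.le_supProj (fun i => (hv i).left) ⟨v, hvS⟩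
    nth_rw 1 [← h1]
    rw [mul_assoc, h2, h1]
  have hFv : ∀ v ∈ S, F * v = v := fun v hvS => by
    have h1 : v * star v * v = v := (hv ⟨v, hvS⟩).fin_mul
    have h2 : F * (v * star v) = v * star v := supProj_mul (fun i : S => (i : H →L[ℂ] H) * star (i : H →L[ℂ] H)) ⟨v, hvS⟩
    nth_rw 1 [← h1]
    rw [← mul_assoc, h2, h1]
  have he' : IsPr N (e - E) := he.sub hE hEe
  have hf' : IsPr N (f - F) := hf.sub hF hFf
  have hEe' : E * (e - E) = 0 := by rw [mul_sub, hEe, hE.idem, sub_self]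
  have hfF' : (f - F) * F = 0 := by rw [sub_mul, hF.idem, le_symm hF.sa hf.sa hFf, sub_self]
  have hcross : ∀ T ∈ N, (f - F) * (T * (e - E)) = 0 := by
    intro T hT
    obtain ⟨v, hv1, hv2, hv3, hv4⟩ := exists_polar ((f - F) * (T * (e - E)))
    set Q := (f - F) * (T * (e - E)) with hQ
    have hQN : Q ∈ N := mul_mem hf'.mem (mul_mem hT he'.mem)
    have hvN : v ∈ N := mem_of_commute fun c hc =>
      hv4 c (commute_of_mem hQN hc) (commute_of_mem (star_mem hQN) hc)
    have hvv : Via N v (rangeProj (star Q)) (rangeProj Q) :=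
      ⟨hvN, hv2, hv3, IsPr.range (star_mem hQN)⟩
    have h1 : (e - E) * rangeProj (star Q) = 1 * rangeProj (star Q) := by
      refine mul_rangeProj_congr ?_
      rw [hQ, star_mul, star_mul, he'.sa, hf'.sa, one_mul, mul_assoc, ← mul_assoc, he'.idem]
    have h2 : (f - F) * rangeProj Q = 1 * rangeProj Q := by
      refine mul_rangeProj_congr ?_
      rw [one_mul, hQ, ← mul_assoc, hf'.idem]
    rw [one_mul] at h1 h2
    have h1' : v * (e - E) = v := by
      rw [← hvv.mul_init, mul_assoc, le_symm' hvv.left.sa he'.sa h1]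
    have h2' : (f - F) * v = v := by rw [← hvv.fin_mul, ← mul_assoc, h2]
    have hvE0 : v * E = 0 := by
      rw [← h1', mul_assoc, sub_mul, le_symm hE.sa he.sa hEe, hE.idem, sub_self, mul_zero]
    have hvS : v ∈ S := by
      refine hSmax v ⟨hvN, by rw [hv2]; exact hvv.left, ?_, ?_⟩ fun w hw => ⟨?_, ?_⟩
      · rw [← h1', mul_assoc, sub_mul, he.idem, hEe]
      · rw [← h2', ← mul_assoc, mul_sub, hf.idem, le_symm hF.sa hf.sa hFf]
      · have := congrArg star (hvE w hw)
        rw [star_mul, hE.sa] at this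
        rw [← this, ← mul_assoc, hvE0, zero_mul]
      · have := congrArg star h2'
        rw [star_mul, hf'.sa] at this
        rw [← this, ← hFv w hw, mul_assoc, ← mul_assoc (f - F), hfF', zero_mul, mul_zero]
    have hv0 : v = 0 := by rw [← hvE v hvS, hvE0]
    rw [← hv1, hv0, zero_mul]
  let x : N → H →L[ℂ] H := fun T => (T : H →L[ℂ] H) * (e - E)
  have hxN : ∀ i, x i ∈ N := fun i => mul_mem i.2 he'.mem
  have hz : Cen N (supProj x) := by
    refine ⟨IsPr.sup hxN, fun T hT => (supProj_commute (fun i => ?_) (fun i => ?_)).symm⟩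
    · rw [← mul_assoc]
      exact (supProj_mul x ⟨T * i, mul_mem hT i.2⟩).symm
    · rw [← mul_assoc]
      exact (supProj_mul x ⟨star T * i, mul_mem (star_mem hT) i.2⟩).symm
  set z := supProj x
  have hze : z * (e - E) = e - E := by
    simpa [x] using supProj_mul x ⟨1, one_mem _⟩
  have hzf : z * (f - F) = 0 := by
    rw [hz.comm _ hf'.mem]
    exact mul_supProj_eq_zero fun i => hcross i i.2
  have hc := hz.compl
  have k1 : (1 - z) * e = (1 - z) * E := by
    rw [← sub_eq_zero, ← mul_sub, sub_mul, one_mul, hze, sub_self]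
  have k2 : z * f = z * F := by
    rw [← sub_eq_zero, ← mul_sub, hzf]
  refine ⟨1 - z, hc, ?_, ?_⟩
  · rw [k1]
    refine (Sub.of_eqv (Eqv.cut ⟨V, hV⟩ hc)).le_right (hc.pr_mul hf) ?_
    rw [hc.mul_mul_mul hF.mem, hFf]
  · rw [sub_sub_cancel, k2]
    refine (Sub.of_eqv (Eqv.cut (Eqv.symm ⟨V, hV⟩) hz)).le_right (hz.pr_mul he) ?_
    rw [hz.mul_mul_mul hE.mem, hEe]

end Sums

section Types

variable {H : Type*} [NormedAddCommGroup H] [InnerProductSpace ℂ H] [CompleteSpace H]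
variable {N : VonNeumannAlgebra H} {e f g p q x y z a b : H →L[ℂ] H}

/-- A projection which is the sum of two copies of itself. -/
def Halv (N : VonNeumannAlgebra H) (p : H →L[ℂ] H) : Prop :=
  IsPr N p ∧ ∃ p₁ p₂, p₁ * p₂ = 0 ∧ p₁ + p₂ = p ∧ Eqv N p p₁ ∧ Eqv N p p₂

/-- A projection not equivalent to a proper subprojection. -/
def IsFin (N : VonNeumannAlgebra H) (p : H →L[ℂ] H) : Prop :=
  IsPr N p ∧ ∀ g, Eqv N p g → g * p = g → g = p

theorem Eqv.image_add (h : Eqv N p q) (ha : IsPr N a) (hb : IsPr N b) (hab : a * b = 0)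
    (hp : a + b = p) : ∃ a' b', Eqv N a a' ∧ Eqv N b b' ∧ a' * b' = 0 ∧ a' + b' = q := by
  obtain ⟨v, hv⟩ := h
  have h1 : a * p = a := by rw [← hp, mul_add, ha.idem, hab, add_zero]
  have h2 : b * p = b := by rw [← hp, mul_add, hb.idem, orth_symm ha.sa hb.sa hab, zero_add]
  refine ⟨v * a * star v, v * b * star v, ⟨_, hv.restrict ha h1⟩, ⟨_, hv.restrict hb h2⟩, ?_, ?_⟩
  · simp only [mul_assoc, mul_mul_of_eq hv.init]
    rw [← mul_assoc a p, h1, ← mul_assoc a, hab, zero_mul, mul_zero]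
  · rw [← add_mul, ← mul_add, hp, hv.mul_init, hv.fin]

theorem orth_of_le (_ : IsPr N a) (_ : IsPr N x) (hxy : x * y = 0) (hax : a * x = a)
    (hb : IsPr N b) (hy : IsPr N y) (hby : b * y = b) : a * b = 0 := by
  rw [← hax, ← le_symm hb.sa hy.sa hby, mul_assoc, ← mul_assoc x, hxy, zero_mul, mul_zero]

theorem le_trans' (h : a * b = a) (h' : b * x = b) : a * x = a := by
  rw [← h, mul_assoc, h']

theorem halv_of_sub (hp : IsPr N p) (h1 : Sub N p a) (h2 : Sub N p b) (hab : a * b = 0)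
    (ha : a * p = a) (hb : b * p = b) : Halv N p := by
  obtain ⟨g1, k1, k2, k3⟩ := h1
  obtain ⟨g2, k4, k5, k6⟩ := h2
  have h12 : g1 * g2 = 0 := orth_of_le k1.right k3 hab k2 k4.right k6 k5
  have l1 : g1 * p = g1 := le_trans' k2 ha
  have l2 : g2 * p = g2 := le_trans' k5 hb
  have hg2 := k4.right
  refine ⟨hp, p - g2, g2, ?_, sub_add_cancel _ _, ?_, k4⟩
  · rw [sub_mul, hg2.idem, le_symm hg2.sa hp.sa l2, sub_self]
  · refine eqv_of_between k1 ?_ ?_ (hp.sub hg2 l2)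
    · rw [mul_sub, l1, h12, sub_zero]
    · rw [sub_mul, hp.idem, l2]

theorem Halv.of_eqv (h : Halv N p) (hpq : Eqv N p q) : Halv N q := by
  obtain ⟨hp, p1, p2, h1, h2, h3, h4⟩ := h
  obtain ⟨a, b, k1, k2, k3, k4⟩ := hpq.image_add h3.right h4.right h1 h2
  exact ⟨hpq.right, a, b, k3, k4, hpq.symm.trans (h3.trans k1), hpq.symm.trans (h4.trans k2)⟩

theorem Halv.cut (h : Halv N p) (hz : Cen N z) : Halv N (z * p) := by
  obtain ⟨hp, p1, p2, h1, h2, h3, h4⟩ := h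
  refine ⟨hz.pr_mul hp, z * p1, z * p2, ?_, by rw [← mul_add, h2], h3.cut hz, h4.cut hz⟩
  rw [hz.mul_mul_mul h3.right.mem, h1, mul_zero]

theorem exists_sub_supProj {ι : Type*} {e f : ι → H →L[ℂ] H}
    (h : ∀ i, Sub N (e i) (f i)) (he : ∀ i j, i ≠ j → e i * e j = 0)
    (hf : ∀ i j, i ≠ j → f i * f j = 0) : Sub N (supProj e) (supProj f) := by
  have hf' : ∀ i, IsPr N (f i) := fun i => (h i).right
  choose g h1 h2 h3 using h
  have hg : ∀ i, IsPr N (g i) := fun i => (h1 i).right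
  have hF : IsPr N (supProj f) := IsPr.sup fun i => (hf' i).mem
  refine ⟨supProj g, exists_eqv_supProj h1 he fun i j hij => ?_, ?_, hF⟩
  · exact orth_of_le (hg i) (hf' i) (hf i j hij) (h2 i) (hg j) (hf' j) (h2 j)
  · refine supProj_le hF fun i => ?_
    rw [← le_symm (hg i).sa (hf' i).sa (h2 i), ← mul_assoc, supProj_mul]

theorem halv_supProj {ι : Type*} {x : ι → H →L[ℂ] H} (h : ∀ i, Halv N (x i))
    (hx : ∀ i j, i ≠ j → x i * x j = 0) : Halv N (supProj x) := by
  have hxp : ∀ i, IsPr N (x i) := fun i => (h i).1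
  choose _ a b hab hs ha hb using h
  have hap : ∀ i, IsPr N (a i) := fun i => (ha i).right
  have hbp : ∀ i, IsPr N (b i) := fun i => (hb i).right
  have hax : ∀ i, a i * x i = a i := fun i => by
    rw [← hs, mul_add, (hap i).idem, hab, add_zero]
  have hbx : ∀ i, b i * x i = b i := fun i => by
    rw [← hs, mul_add, (hbp i).idem, orth_symm (hap i).sa (hbp i).sa (hab i), zero_add]
  have hX : IsPr N (supProj x) := IsPr.sup fun i => (hxp i).mem
  refine halv_of_sub hX (a := supProj a) (b := supProj b) ?_ ?_ ?_ ?_ ?_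
  · refine Sub.of_eqv (exists_eqv_supProj ha hx fun i j hij => ?_)
    exact orth_of_le (hap i) (hxp i) (hx i j hij) (hax i) (hap j) (hxp j) (hax j)
  · refine Sub.of_eqv (exists_eqv_supProj hb hx fun i j hij => ?_)
    exact orth_of_le (hbp i) (hxp i) (hx i j hij) (hbx i) (hbp j) (hxp j) (hbx j)
  · refine orth_supProj (fun i j => ?_) hap hbp
    by_cases hij : i = j
    · subst hij; exact hab i
    · exact orth_of_le (hap i) (hxp i) (hx i j hij) (hax i) (hbp j) (hxp j) (hbx j)
  · refine supProj_le hX fun i => ?_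
    rw [← le_symm (hap i).sa (hxp i).sa (hax i), ← mul_assoc, supProj_mul]
  · refine supProj_le hX fun i => ?_
    rw [← le_symm (hbp i).sa (hxp i).sa (hbx i), ← mul_assoc, supProj_mul]

theorem supProj_mul_right {ι : Type*} {c : ι → H →L[ℂ] H} (hc : ∀ i, Cen N (c i))
    (hp : IsPr N p) : supProj c * p = supProj fun i => c i * p := by
  have hZ : Cen N (supProj c) := Cen.sup hc
  have hcp : ∀ i, IsPr N (c i * p) := fun i => (hc i).pr_mul hp
  have h1 : (supProj fun i => c i * p) * (supProj c * p) = supProj fun i => c i * p := by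
    refine supProj_le (hZ.pr_mul hp) fun i => ?_
    rw [mul_assoc, ← mul_assoc p, ← (hc i).comm p hp.mem, mul_assoc, hp.idem, ← mul_assoc,
      supProj_mul]
  have h2 : (supProj fun i => c i * p) * p * supProj c = p * supProj c := by
    refine mul_supProj_congr fun i => ?_
    rw [mul_assoc, ← (hc i).comm p hp.mem]
    exact supProj_mul (fun i => c i * p) i
  rw [mul_assoc, ← hZ.comm p hp.mem, h1] at h2
  exact h2.symm

theorem exists_injections (S : Type*) [Infinite S] : ∃ φ ψ : Option S → S,
    Function.Injective φ ∧ Function.Injective ψ ∧ ∀ i j, φ i ≠ ψ j := by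
  have h : Cardinal.mk (Option S ⊕ Option S) = Cardinal.mk S := by
    have h1 : Cardinal.mk (Option S) = Cardinal.mk S := by
      rw [Cardinal.mk_option, Cardinal.add_one_eq (Cardinal.aleph0_le_mk S)]
    rw [Cardinal.mk_sum, h1, Cardinal.lift_id, Cardinal.add_eq_self (Cardinal.aleph0_le_mk S)]
  obtain ⟨σ⟩ := Cardinal.eq.1 h
  refine ⟨fun i => σ (Sum.inl i), fun i => σ (Sum.inr i), ?_, ?_, ?_⟩
  · exact σ.injective.comp Sum.inl_injective
  · exact σ.injective.comp Sum.inr_injective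
  · intro i j h
    exact Sum.inl_ne_inr (σ.injective h)

theorem exists_halv_cut (hp : IsPr N p) (hpf : ¬ IsFin N p) :
    ∃ c, Cen N c ∧ c * p ≠ 0 ∧ Halv N (c * p) := by
  simp only [IsFin, not_and, not_forall] at hpf
  obtain ⟨g, ⟨v, hv⟩, hgp, hne⟩ := hpf hp
  have hg := hv.right
  set r := p - g with hr
  have hrp : IsPr N r := hp.sub hg hgp
  have hr0 : r ≠ 0 := fun h => hne (sub_eq_zero.1 h).symm
  have hpr : p * r = r := by rw [hr, mul_sub, hp.idem, le_symm hg.sa hp.sa hgp]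
  have hpv : p * v = v := by rw [← hv.fin_mul, ← mul_assoc, le_symm hg.sa hp.sa hgp]
  have hrv : r * v = 0 := by rw [hr, sub_mul, hpv, hv.fin_mul, sub_self]
  have hvn : ∀ (n : ℕ) (x : H →L[ℂ] H), p * x = x → star (v ^ n) * (v ^ n * x) = x := by
    intro n x hx
    induction n with
    | zero => simp
    | succ n ih =>
      rw [pow_succ' v n, star_mul, mul_assoc, mul_assoc v, ← mul_assoc (star v), hv.init]
      have : p * (v ^ n * x) = v ^ n * x := by
        cases n with
        | zero => simpa using hx
        | succ n => rw [pow_succ', mul_assoc, ← mul_assoc, hpv]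
      rw [this, ih]
  have hpow : ∀ n, p * (v ^ n * r) = v ^ n * r := by
    intro n
    cases n with
    | zero => simpa using hpr
    | succ n => rw [pow_succ', mul_assoc, ← mul_assoc, hpv]
  have horth : ∀ m k, star (v ^ m * r) * (v ^ (m + (k + 1)) * r) = 0 := by
    intro m k
    rw [pow_add, star_mul, hrp.sa, mul_assoc, mul_assoc (v ^ m), hvn, pow_succ', mul_assoc,
      ← mul_assoc, hrv, zero_mul]
    rw [pow_succ', mul_assoc, ← mul_assoc, hpv]
  have horth' : ∀ m n, m ≠ n → star (v ^ m * r) * (v ^ n * r) = 0 := by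
    intro m n hmn
    rcases lt_or_gt_of_ne hmn with h | h
    · obtain ⟨k, rfl⟩ := Nat.exists_eq_add_of_lt h
      rw [add_assoc]; exact horth m k
    · obtain ⟨k, rfl⟩ := Nat.exists_eq_add_of_lt h
      have := congrArg star (horth n k)
      rw [star_mul, star_star, star_zero] at this
      rw [add_assoc]; exact this
  have hself : ∀ n, star (v ^ n * r) * (v ^ n * r) = r := fun n => by
    rw [star_mul, hrp.sa, mul_assoc, hvn _ _ hpr, hrp.idem]
  have hinj : Function.Injective fun n : ℕ => v ^ n * r := by
    intro m n hmn
    by_contra hne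
    have := horth' m n hne
    rw [← show v ^ m * r = v ^ n * r from hmn, hself] at this
    exact hr0 this
  obtain ⟨S, hS0, hSP, hSR, hSmax⟩ := exists_maximal_pairwise
    (fun w => w ∈ N ∧ star w * w = r ∧ p * w = w) (fun w w' => star w * w' = 0)
    (fun w w' h => by simpa using congrArg star h)
    (Set.range fun n : ℕ => v ^ n * r)
    (by
      rintro _ ⟨n, rfl⟩
      exact ⟨mul_mem (pow_mem hv.mem n) hrp.mem, hself n, hpow n⟩)
    (by
      rintro _ ⟨m, rfl⟩ _ ⟨n, rfl⟩ hmn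
      exact horth' m n fun h => hmn (by rw [h]))
  have hSinf : Infinite S := ((Set.infinite_range_of_injective hinj).mono hS0).to_subtype
  let F : S → H →L[ℂ] H := fun w => (w : H →L[ℂ] H) * star (w : H →L[ℂ] H)
  have hw : ∀ w : S, Via N (w : H →L[ℂ] H) r (F w) := fun w =>
    ⟨(hSP w w.2).1, (hSP w w.2).2.1, rfl, hrp⟩
  have hFp : ∀ w, IsPr N (F w) := fun w => (hw w).right
  have hF0 : ∀ w w', w ≠ w' → F w * F w' = 0 := fun w w' hww => by
    have := hSR w.2 w'.2 (fun h => hww (Subtype.ext h))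
    change (w : H →L[ℂ] H) * star (w : H →L[ℂ] H) * ((w' : H →L[ℂ] H) * star (w' : H →L[ℂ] H)) = 0
    rw [mul_assoc, ← mul_assoc (star (w : H →L[ℂ] H)), this, zero_mul, mul_zero]
  have hpF : ∀ w, p * F w = F w := fun w => by
    change p * ((w : H →L[ℂ] H) * star (w : H →L[ℂ] H)) = _
    rw [← mul_assoc, (hSP w w.2).2.2]
  have hsF : IsPr N (supProj F) := IsPr.sup fun w => (hFp w).mem
  have hsFp : supProj F * p = supProj F := supProj_le hp hpF
  set q := p - supProj F with hq
  have hqp : IsPr N q := hp.sub hsF hsFp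
  have hqF : q * supProj F = 0 := by
    rw [hq, sub_mul, hsF.idem, le_symm hsF.sa hp.sa hsFp, sub_self]
  obtain ⟨z, hz, hz1, hz2⟩ := exists_comparison hrp hqp
  have hc := hz.compl
  set c := 1 - z with hcz
  have hcr : c * r ≠ 0 := by
    intro h0
    have hzr : z * r = r := by
      rw [hcz, sub_mul, one_mul, sub_eq_zero] at h0
      exact h0.symm
    rw [hzr] at hz1
    obtain ⟨g', ⟨w, hwv⟩, hg'q, -⟩ := hz1.trans (Sub.of_le (hz.pr_mul hqp) hqp (Cen.le hqp))
    have hqw : q * w = w := by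
      rw [← hwv.fin_mul, ← mul_assoc, le_symm hwv.right.sa hqp.sa hg'q]
    have hqS : ∀ w' ∈ S, q * w' = 0 := fun w' hw' => by
      have h1 : supProj F * (F ⟨w', hw'⟩) = F ⟨w', hw'⟩ := supProj_mul F _
      have h2 : F ⟨w', hw'⟩ * w' = w' := (hw ⟨w', hw'⟩).fin_mul
      rw [← h2, ← h1, ← mul_assoc, ← mul_assoc, hqF, zero_mul, zero_mul]
    have hwS : w ∈ S := by
      refine hSmax w ⟨hwv.mem, hwv.init, ?_⟩ fun w' hw' => ?_
      · rw [← hqw, ← mul_assoc, hq, mul_sub, hp.idem, le_symm hsF.sa hp.sa hsFp]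
      · have := congrArg star hqw
        rw [star_mul, hqp.sa] at this
        rw [← this, mul_assoc, hqS w' hw', mul_zero]
    have hw0 : w = 0 := by rw [← hqw, hqS w hwS]
    exact hr0 (by rw [← hwv.init, hw0, mul_zero])
  refine ⟨c, hc, fun h0 => hcr (by rw [← hpr, ← mul_assoc, h0, zero_mul]), ?_⟩
  let e : Option S → H →L[ℂ] H := fun o => o.elim (c * q) fun w => c * F w
  have hqFw : ∀ w, q * F w = 0 := fun w => by
    rw [← supProj_mul F w, ← mul_assoc, hqF, zero_mul]
  have he0 : ∀ o o', o ≠ o' → e o * e o' = 0 := by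
    rintro (_ | w) (_ | w') h
    · exact absurd rfl h
    · change c * q * (c * F w') = 0
      rw [hc.mul_mul_mul hqp.mem, hqFw, mul_zero]
    · change c * F w * (c * q) = 0
      rw [hc.mul_mul_mul (hFp w).mem, orth_symm hqp.sa (hFp w).sa (hqFw w), mul_zero]
    · change c * F w * (c * F w') = 0
      rw [hc.mul_mul_mul (hFp w).mem, hF0 w w' (fun h' => h (by rw [h'])), mul_zero]
  have hep : ∀ o, IsPr N (e o) := by
    rintro (_ | w)
    exacts [hc.pr_mul hqp, hc.pr_mul (hFp w)]
  have hcp : IsPr N (c * p) := hc.pr_mul hp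
  have hE : supProj e = c * p := by
    have h1 : supProj e * (c * p) = supProj e := by
      refine supProj_le hcp ?_
      rintro (_ | w)
      · change c * p * (c * q) = c * q
        rw [hc.mul_mul_mul hp.mem, hq, mul_sub, hp.idem, le_symm hsF.sa hp.sa hsFp]
      · change c * p * (c * F w) = c * F w
        rw [hc.mul_mul_mul hp.mem, hpF]
    have h2 : supProj e * (c * q) = c * q := supProj_mul e none
    have h3 : supProj e * c * supProj F = c * supProj F := by
      refine mul_supProj_congr fun w => ?_
      rw [mul_assoc]
      exact supProj_mul e (some w)
    have h4 : c * p = c * q + c * supProj F := by rw [← mul_add, hq, sub_add_cancel]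
    rw [← h1, h4, mul_add, h2, ← mul_assoc, h3]
  obtain ⟨φ, ψ, hφ, hψ, hφψ⟩ := exists_injections S
  have hkey : ∀ φ : Option S → S, Function.Injective φ →
      Sub N (c * p) (supProj fun o => c * F (φ o)) := by
    intro φ hφ
    rw [← hE]
    refine exists_sub_supProj ?_ he0 fun o o' h => ?_
    · rintro (_ | w)
      · exact hz2.trans (Sub.of_eqv (Eqv.cut ⟨_, hw _⟩ hc))
      · exact Sub.of_eqv (Eqv.cut (Eqv.trans (Eqv.symm ⟨_, hw w⟩) ⟨_, hw _⟩) hc)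
    · rw [hc.mul_mul_mul (hFp _).mem, hF0 _ _ (fun h' => h (hφ h')), mul_zero]
  have hle : ∀ φ : Option S → S, (supProj fun o => c * F (φ o)) * (c * p) =
      supProj fun o => c * F (φ o) := fun φ => supProj_le hcp fun o => by
    rw [hc.mul_mul_mul hp.mem, hpF]
  refine halv_of_sub hcp (hkey φ hφ) (hkey ψ hψ) ?_ (hle φ) (hle ψ)
  refine orth_supProj (fun i j => ?_) (fun o => hc.pr_mul (hFp _)) (fun o => hc.pr_mul (hFp _))
  rw [hc.mul_mul_mul (hFp _).mem, hF0 _ _ (hφψ i j), mul_zero]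

/-- Every projection splits centrally into a finite and a properly infinite part. -/
theorem exists_fin_halv (hp : IsPr N p) :
    ∃ z, Cen N z ∧ IsFin N (z * p) ∧ Halv N ((1 - z) * p) := by
  obtain ⟨S, -, hSP, hSR, hSmax⟩ := exists_maximal_pairwise
    (fun c => Cen N c ∧ Halv N (c * p)) (fun c d => c * d = 0 ∧ d * c = 0)
    (fun c d h => ⟨h.2, h.1⟩) ∅ (by simp) (by simp)
  have hc : ∀ c : S, Cen N (c : H →L[ℂ] H) := fun c => (hSP c c.2).1
  set Z := supProj fun c : S => (c : H →L[ℂ] H) with hZdef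
  have hZ : Cen N Z := Cen.sup hc
  have hcc := hZ.compl
  refine ⟨1 - Z, hcc, ?_, ?_⟩
  · by_contra hcon
    obtain ⟨c, hcen, hne, hh⟩ := exists_halv_cut (hcc.pr_mul hp) hcon
    rw [← mul_assoc] at hne hh
    have hd := hcen.mul hcc
    have hdS : c * (1 - Z) ∈ S := by
      refine hSmax _ ⟨hd, hh⟩ fun d hdS => ?_
      have h1 : Z * d = d := supProj_mul (fun c : S => (c : H →L[ℂ] H)) ⟨d, hdS⟩
      have h2 : c * (1 - Z) * d = 0 := by rw [mul_assoc, sub_mul, one_mul, h1, sub_self, mul_zero]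
      exact ⟨h2, by rw [← hd.comm d (hSP d hdS).1.mem, h2]⟩
    have h3 : Z * (c * (1 - Z)) = c * (1 - Z) :=
      supProj_mul (fun c : S => (c : H →L[ℂ] H)) ⟨_, hdS⟩
    have h4 : Z * (c * (1 - Z)) = 0 := by
      rw [hZ.comm _ hd.mem, mul_assoc, sub_mul, one_mul, hZ.idem, sub_self, mul_zero]
    rw [h4] at h3
    rw [← h3, zero_mul] at hne
    exact hne rfl
  · rw [sub_sub_cancel, hZdef, supProj_mul_right hc hp]
    refine halv_supProj (fun c => (hSP c c.2).2) fun c d hcd => ?_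
    rw [mul_assoc, ← mul_assoc p, ← (hc d).comm p hp.mem, mul_assoc, ← mul_assoc,
      (hSR c.2 d.2 (fun h => hcd (Subtype.ext h))).1, zero_mul]

end Types

section Arith

variable {H : Type*} [NormedAddCommGroup H] [InnerProductSpace ℂ H] [CompleteSpace H]
variable {N : VonNeumannAlgebra H} {e f g p q x y z a b e₁ f₁ : H →L[ℂ] H}

theorem IsFin.of_le (h : IsFin N p) (hq : IsPr N q) (hqp : q * p = q) : IsFin N q := by
  refine ⟨hq, fun g hqg hgq => ?_⟩
  have hp := h.1
  have hg := hqg.right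
  have hpq := le_symm hq.sa hp.sa hqp
  have h1 : (p - q) * q = 0 := by rw [sub_mul, hpq, hq.idem, sub_self]
  have h2 : (p - q) * g = 0 := by rw [← le_symm hg.sa hq.sa hgq, ← mul_assoc, h1, zero_mul]
  have h3 := (Eqv.refl (hp.sub hq hqp)).add hqg h1 h2
  rw [sub_add_cancel] at h3
  have h4 := h.2 _ h3 (by rw [add_mul, sub_mul, hp.idem, hqp, le_trans' hgq hqp])
  have : g = q + (p - q + g - p) := by abel
  rw [this, h4, sub_self, add_zero]

theorem IsFin.of_eqv (h : IsFin N p) (hpq : Eqv N p q) : IsFin N q := by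
  obtain ⟨v, hv⟩ := hpq
  refine ⟨hv.right, fun g hqg hgq => ?_⟩
  have hg := hqg.right
  have h1 := h.2 _ (Eqv.trans ⟨v, hv⟩ (hqg.trans ⟨_, hv.symm.restrict hg hgq⟩))
    hv.symm.restrict_le
  have h2 := congrArg (fun T => v * T * star v) h1
  simp only [star_star] at h2
  rw [hv.mul_init, hv.fin] at h2
  rw [← h2]
  simp only [mul_assoc, hv.fin]
  rw [hgq, ← mul_assoc, hv.fin, le_symm hg.sa hv.right.sa hgq]

theorem IsFin.cut (h : IsFin N p) (hz : Cen N z) : IsFin N (z * p) :=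
  h.of_le (hz.pr_mul h.1) (Cen.le h.1)

theorem IsFin.eqv_sub_of_sub (h : IsFin N e) (hef : Eqv N e f) (h₁ : Eqv N e₁ f₁)
    (he : e₁ * e = e₁) (hf : f₁ * f = f₁) (hs : Sub N (e - e₁) (f - f₁)) :
    Eqv N (e - e₁) (f - f₁) := by
  obtain ⟨g, k1, k2, k3⟩ := hs
  have hfp := hef.right
  have hg := k1.right
  have h2 : (e - e₁) * e₁ = 0 := by
    rw [sub_mul, le_symm h₁.left.sa h.1.sa he, h₁.left.idem, sub_self]
  have h3 : (f - f₁) * f₁ = 0 := by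
    rw [sub_mul, le_symm h₁.right.sa hfp.sa hf, h₁.right.idem, sub_self]
  have h4 : g * f₁ = 0 := by rw [← k2, mul_assoc, h3, mul_zero]
  have h5 := k1.add h₁ h2 h4
  rw [sub_add_cancel] at h5
  have h6 : (f - f₁) * f = f - f₁ := by rw [sub_mul, hfp.idem, hf]
  have h7 := (h.of_eqv hef).2 _ (hef.symm.trans h5) (by rw [add_mul, le_trans' k2 h6, hf])
  rwa [← h7, add_sub_cancel_right]

/-- Cancellation of equivalent subprojections of a finite projection. -/
theorem IsFin.eqv_sub (h : IsFin N e) (hef : Eqv N e f) (h₁ : Eqv N e₁ f₁)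
    (he : e₁ * e = e₁) (hf : f₁ * f = f₁) : Eqv N (e - e₁) (f - f₁) := by
  have hd := h.1.sub h₁.left he
  have hd' := hef.right.sub h₁.right hf
  obtain ⟨z, hz, k1, k2⟩ := exists_comparison hd hd'
  have hc := hz.compl
  have h2 := (h.cut hz).eqv_sub_of_sub (hef.cut hz) (h₁.cut hz)
    (by rw [hz.mul_mul_mul h₁.left.mem, he]) (by rw [hz.mul_mul_mul h₁.right.mem, hf])
    (by rwa [← mul_sub, ← mul_sub])
  have h3 := ((h.of_eqv hef).cut hc).eqv_sub_of_sub (hef.symm.cut hc) (h₁.symm.cut hc)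
    (by rw [hc.mul_mul_mul h₁.right.mem, hf]) (by rw [hc.mul_mul_mul h₁.left.mem, he])
    (by rwa [← mul_sub, ← mul_sub])
  rw [← mul_sub, ← mul_sub] at h2 h3
  have h4 := h2.add h3.symm (hz.compl_mul hd.mem) (hz.compl_mul hd'.mem)
  rwa [Cen.mul_add_compl, Cen.mul_add_compl] at h4

theorem Eqv.range {T : H →L[ℂ] H} (hT : T ∈ N) :
    Eqv N (rangeProj (star T)) (rangeProj T) := by
  obtain ⟨v, -, h1, h2, h3⟩ := exists_polar T
  refine ⟨v, mem_of_commute fun c hc => ?_, h1, h2, IsPr.range (star_mem hT)⟩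
  exact h3 c (commute_of_mem hT hc) (commute_of_mem (star_mem hT) hc)

theorem range_split (hP : IsPr N p) (hb : IsPr N b) (h : p * (a + b) = p) :
    ∃ m k l, m + k = p ∧ m * k = 0 ∧ IsPr N m ∧ m * p = m ∧ m * a = m ∧ l * b = l ∧
      Eqv N k l ∧ ∀ T, T * (b * p) = 0 → T * l = 0 := by
  have hT' : b * p ∈ N := mul_mem hb.mem hP.mem
  have hr : IsPr N (rangeProj (p * b)) := IsPr.range (mul_mem hP.mem hb.mem)
  have hr' := IsPr.range hT'
  have h1 : p * rangeProj (p * b) = rangeProj (p * b) := by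
    have : p * rangeProj (p * b) = 1 * rangeProj (p * b) :=
      mul_rangeProj_congr (by rw [← mul_assoc, hP.idem, one_mul])
    rwa [one_mul] at this
  have h2 : b * rangeProj (b * p) = rangeProj (b * p) := by
    have : b * rangeProj (b * p) = 1 * rangeProj (b * p) :=
      mul_rangeProj_congr (by rw [← mul_assoc, hb.idem, one_mul])
    rwa [one_mul] at this
  have h3 := le_symm' hr.sa hP.sa h1
  have h4 : (p - rangeProj (p * b)) * p = p - rangeProj (p * b) := by
    rw [sub_mul, hP.idem, h3]
  refine ⟨p - rangeProj (p * b), rangeProj (p * b), rangeProj (b * p), sub_add_cancel _ _, ?_,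
    hP.sub hr h3, h4, ?_, le_symm' hr'.sa hb.sa h2, ?_, fun T => mul_rangeProj_eq_zero⟩
  · rw [sub_mul, h1, hr.idem, sub_self]
  · have h5 : (p - rangeProj (p * b)) * b = 0 := by
      rw [← h4, mul_assoc, sub_mul, ← mul_assoc p, hP.idem, rangeProj_mul, sub_self]
    have h6 : (p - rangeProj (p * b)) * (a + b) = p - rangeProj (p * b) := by
      rw [← h4, mul_assoc, h]
    rwa [mul_add, h5, add_zero] at h6
  · have := Eqv.range hT'
    rw [star_mul, hP.sa, hb.sa] at this
    exact this

/-- A properly infinite projection below `a + b` is centrally split into a part below `b` and a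
part below `a`. -/
theorem Halv.exists_split (h : Halv N y) (ha : IsPr N a) (hb : IsPr N b)
    (hy : Sub N y (a + b)) : ∃ z, Cen N z ∧ Sub N (z * y) b ∧ Sub N ((1 - z) * y) a := by
  obtain ⟨g, hyg, hg, -⟩ := hy
  obtain ⟨hgp, P, P', hPP, hsum, hP, hP'⟩ := h.of_eqv hyg
  have hPr := hP.right
  have hPr' := hP'.right
  have hPP' := orth_symm hPr.sa hPr'.sa hPP
  have hPg : P * g = P := by rw [← hsum, mul_add, hPr.idem, hPP, add_zero]
  have hPg' : P' * g = P' := by rw [← hsum, mul_add, hPr'.idem, hPP', zero_add]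
  obtain ⟨m, k, l, hmk, hmk0, hm, hmP, hma, hlb, hkl, hl0⟩ :=
    range_split hPr hb (le_trans' hPg hg)
  obtain ⟨m', k', l', hmk', hmk0', hm', hmP', hmb', hla', hkl', hl0'⟩ :=
    range_split hPr' ha (by rw [add_comm]; exact le_trans' hPg' hg)
  obtain ⟨z, hz, k1, k2⟩ := exists_comparison hm hm'
  have hc := hz.compl
  have o1 : m' * l = 0 := hl0 _ (by rw [← mul_assoc, hmb', ← hmP', mul_assoc, hPP', mul_zero])
  have o2 : m * l' = 0 := hl0' _ (by rw [← mul_assoc, hma, ← hmP, mul_assoc, hPP, mul_zero])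
  refine ⟨z, hz, ?_, ?_⟩
  · have h1 := k1.add (Sub.of_eqv (hkl.cut hz)) (by rw [hz.mul_mul_mul hm.mem, hmk0, mul_zero])
      (by rw [hz.mul_mul_mul hm'.mem, o1, mul_zero])
    rw [← mul_add, ← mul_add, hmk] at h1
    have h2 := (Sub.of_eqv ((hyg.trans hP).cut hz)).trans h1
    refine h2.le_right hb ?_
    rw [mul_assoc, add_mul, hmb', hlb]
  · have h1 := k2.add (Sub.of_eqv (hkl'.cut hc)) (by rw [hc.mul_mul_mul hm'.mem, hmk0', mul_zero])
      (by rw [hc.mul_mul_mul hm.mem, o2, mul_zero])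
    rw [← mul_add, ← mul_add, hmk'] at h1
    have h2 := (Sub.of_eqv ((hyg.trans hP').cut hc)).trans h1
    refine h2.le_right ha ?_
    rw [mul_assoc, add_mul, hma, hla']

/-- A properly infinite projection below a finite orthogonal sum is centrally distributed among
the summands. -/
theorem Halv.exists_distrib {ι : Type*} (s : Finset ι) {P : ι → H →L[ℂ] H}
    (hP : ∀ i ∈ s, IsPr N (P i)) (hP0 : ∀ i ∈ s, ∀ j ∈ s, i ≠ j → P i * P j = 0)
    (h : Halv N y) (hy : Sub N y (∑ i ∈ s, P i)) :
    ∃ ζ : ι → H →L[ℂ] H, (∀ i, Cen N (ζ i)) ∧ (∀ i j, i ≠ j → ζ i * ζ j = 0) ∧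
      (∀ i ∈ s, Sub N (ζ i * y) (P i)) ∧ (∑ i ∈ s, ζ i) * y = y := by
  classical
  induction s using Finset.induction_on generalizing y with
  | empty =>
    rw [Finset.sum_empty] at hy
    exact ⟨fun _ => 0, fun _ => Cen.zero, by simp, by simp, by simp [hy.eq_zero]⟩
  | insert a s ha ih =>
    have hPa := hP a (by simp)
    have hPs : ∀ i ∈ s, IsPr N (P i) := fun i hi => hP i (by simp [hi])
    have hPs0 : ∀ i ∈ s, ∀ j ∈ s, i ≠ j → P i * P j = 0 :=
      fun i hi j hj => hP0 i (by simp [hi]) j (by simp [hj])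
    have hne : ∀ i ∈ s, a ≠ i := fun i hi h => ha (h ▸ hi)
    rw [Finset.sum_insert ha] at hy
    obtain ⟨z, hz, k1, k2⟩ := h.exists_split hPa (IsPr.sum s hPs hPs0) hy
    obtain ⟨ζ, h1, h2, h3, h4⟩ := ih hPs hPs0 (h.cut hz) k1
    have hz0 : (1 - z) * z = 0 := by rw [sub_mul, hz.idem, one_mul, sub_self]
    have hz0' : z * (1 - z) = 0 := by rw [mul_sub, hz.idem, mul_one, sub_self]
    refine ⟨fun i => if i = a then 1 - z else ζ i * z, fun i => ?_, fun i j hij => ?_,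
      fun i hi => ?_, ?_⟩
    · beta_reduce
      split_ifs
      exacts [hz.compl, (h1 i).mul hz]
    · beta_reduce
      split_ifs with hi hj hj
      · exact absurd (hi.trans hj.symm) hij
      · rw [(h1 j).comm z hz.mem, ← mul_assoc, hz0, zero_mul]
      · rw [mul_assoc, hz0', mul_zero]
      · rw [mul_assoc, hz.comm _ (mul_mem (h1 j).mem hz.mem), ← mul_assoc, ← mul_assoc, h2 i j hij,
          zero_mul, zero_mul]
    · beta_reduce
      split_ifs with hia
      · rw [hia]; exact k2
      · rw [mul_assoc]
        exact h3 i ((Finset.mem_insert.1 hi).resolve_left hia)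
    · rw [Finset.sum_insert ha, if_pos rfl, Finset.sum_congr rfl fun i hi =>
        if_neg (hne i hi).symm, ← Finset.sum_mul, add_mul, mul_assoc, h4, add_comm,
        Cen.mul_add_compl]

/-- `x` is dominated by a properly infinite projection below `p`. -/
def Dom (N : VonNeumannAlgebra H) (x p : H →L[ℂ] H) : Prop :=
  ∃ y, Halv N y ∧ Sub N x y ∧ Sub N y p

theorem Dom.left_sub (h : Dom N y p) (hx : Sub N x y) : Dom N x p := by
  obtain ⟨w, h1, h2, h3⟩ := h
  exact ⟨w, h1, hx.trans h2, h3⟩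

theorem Dom.sub_right (h : Dom N x p) (hq : Sub N p q) : Dom N x q := by
  obtain ⟨w, h1, h2, h3⟩ := h
  exact ⟨w, h1, h2, h3.trans hq⟩

theorem Dom.absorb (h : Dom N x p) (hxp : p * x = 0) : Eqv N (p + x) p := by
  obtain ⟨y, hy, hxy, hyp⟩ := h
  have hp := hyp.right
  have hx := hxy.left
  obtain ⟨g, hyg, hgp, -⟩ := hyp
  obtain ⟨hg, a, b, hab, hs, ha, hb⟩ := hy.of_eqv hyg
  have hgx : g * x = 0 := by rw [← hgp, mul_assoc, hxp, mul_zero]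
  have hrg : (p - g) * g = 0 := by rw [sub_mul, le_symm hg.sa hp.sa hgp, hg.idem, sub_self]
  have hrx : (p - g) * x = 0 := by rw [sub_mul, hxp, hgx, sub_self]
  have h1 := (Sub.of_eqv ha).add (hxy.trans (Sub.of_eqv (hyg.trans hb))) hgx hab
  rw [hs] at h1
  have h2 := (Sub.refl (hp.sub hg hgp)).add h1 (by rw [mul_add, hrg, hrx, add_zero]) hrg
  rw [← add_assoc, sub_add_cancel] at h2
  exact h2.antisymm (Sub.of_le hp (hp.add hx hxp) (by rw [mul_add, hp.idem, hxp, add_zero]))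

end Arith

section Exhaust

variable {H : Type*} [NormedAddCommGroup H] [InnerProductSpace ℂ H] [CompleteSpace H]
variable {N : VonNeumannAlgebra H} {e f g p q x y z a b : H →L[ℂ] H}

theorem exists_dependent_seq {α : Type*} (P : ℕ → α → Prop) (Q : ℕ → α → α → Prop)
    (h0 : ∃ a, P 0 a) (h : ∀ n a, P n a → ∃ b, P (n + 1) b ∧ Q n a b) :
    ∃ F : ℕ → α, (∀ n, P n (F n)) ∧ ∀ n, Q n (F n) (F (n + 1)) := by
  obtain ⟨a, ha⟩ := h0
  choose φ h1 h2 using h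
  let F : ∀ n, {a // P n a} := fun n => Nat.rec ⟨a, ha⟩ (fun n x => ⟨φ n x x.2, h1 n x x.2⟩) n
  exact ⟨fun n => (F n).1, fun n => (F n).2, fun n => h2 n (F n).1 (F n).2⟩

theorem supProj_sub_succ {E : ℕ → H →L[ℂ] H} (hE : ∀ n, IsPr N (E n)) (h0 : E 0 = 0)
    (hmono : ∀ n, E n * E (n + 1) = E n) :
    supProj E = supProj fun n => E (n + 1) - E n := by
  have hD : ∀ n, IsPr N (E (n + 1) - E n) := fun n => (hE _).sub (hE n) (hmono n)
  have hs : IsPr N (supProj fun n => E (n + 1) - E n) := IsPr.sup fun n => (hD n).mem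
  have hS : IsPr N (supProj E) := IsPr.sup fun n => (hE n).mem
  have h1 : supProj E * (supProj fun n => E (n + 1) - E n) = supProj E := by
    refine supProj_le hs fun n => ?_
    induction n with
    | zero => rw [h0, mul_zero]
    | succ n ih =>
      have : E (n + 1) = (E (n + 1) - E n) + E n := (sub_add_cancel _ _).symm
      rw [this, mul_add, ih, supProj_mul (fun n => E (n + 1) - E n) n]
  have h2 : (supProj fun n => E (n + 1) - E n) * supProj E = supProj fun n => E (n + 1) - E n :=
    supProj_le hS fun n => by rw [mul_sub, supProj_mul, supProj_mul]
  rw [← h1, le_symm hs.sa hS.sa h2]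

theorem sub_supProj_of_seq {E : ℕ → H →L[ℂ] H} (hE : ∀ n, IsPr N (E n)) (h0 : E 0 = 0)
    (hmono : ∀ n, E n * E (n + 1) = E n) (hf : IsPr N f) (Inv : (H →L[ℂ] H) → Prop)
    (hInv : Inv 0)
    (hstep : ∀ n F, IsPr N F → F * f = F → Eqv N (E n) F → Inv F →
      ∃ F', IsPr N F' ∧ F' * f = F' ∧ Inv F' ∧ F * F' = F ∧ Eqv N (E (n + 1) - E n) (F' - F)) :
    Sub N (supProj E) f := by
  obtain ⟨F, h1, h2⟩ := exists_dependent_seq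
    (fun n F => IsPr N F ∧ F * f = F ∧ Eqv N (E n) F ∧ Inv F)
    (fun n F F' => F * F' = F ∧ Eqv N (E (n + 1) - E n) (F' - F))
    ⟨0, IsPr.zero, zero_mul _, by rw [h0]; exact Eqv.refl IsPr.zero, hInv⟩
    (fun n F ⟨k1, k2, k3, k4⟩ => by
      obtain ⟨F', m1, m2, m3, m4, m5⟩ := hstep n F k1 k2 k3 k4
      refine ⟨F', ⟨m1, m2, ?_, m3⟩, m4, m5⟩
      have h := m5.add k3 (by rw [sub_mul, le_symm (hE n).sa (hE _).sa (hmono n), (hE n).idem,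
        sub_self]) (by rw [sub_mul, le_symm k1.sa m1.sa m4, k1.idem, sub_self])
      rwa [sub_add_cancel, sub_add_cancel] at h)
  have horth : ∀ {E : ℕ → H →L[ℂ] H}, (∀ n, IsPr N (E n)) → (∀ n, E n * E (n + 1) = E n) →
      ∀ i j, i ≠ j → (E (i + 1) - E i) * (E (j + 1) - E j) = 0 := by
    intro E hE hmono
    have hle : ∀ i k, E i * E (i + k) = E i := by
      intro i k
      induction k with
      | zero => exact (hE i).idem
      | succ k ih => exact le_trans' ih (hmono (i + k))
    have hlt : ∀ i j, i < j → (E (i + 1) - E i) * (E (j + 1) - E j) = 0 := by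
      intro i j hij
      obtain ⟨k, rfl⟩ := Nat.exists_eq_add_of_lt hij
      have e1 := hle (i + 1) k
      have e2 := hle (i + 1) (k + 1)
      have e3 := hle i (k + 1)
      have e4 := hle i (k + 2)
      rw [show i + 1 + k = i + k + 1 by ring] at e1
      rw [show i + 1 + (k + 1) = i + k + 1 + 1 by ring] at e2
      rw [show i + (k + 1) = i + k + 1 by ring] at e3
      rw [show i + (k + 2) = i + k + 1 + 1 by ring] at e4
      rw [mul_sub, sub_mul, sub_mul, e1, e2, e3, e4, sub_self]
    intro i j hij
    rcases lt_or_gt_of_ne hij with h | h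
    · exact hlt i j h
    · exact orth_symm ((hE _).sub (hE j) (hmono j)).sa ((hE _).sub (hE i) (hmono i)).sa (hlt j i h)
  rw [supProj_sub_succ hE h0 hmono]
  refine ⟨_, exists_eqv_supProj (fun n => (h2 n).2) (horth hE hmono)
    (horth (fun n => (h1 n).1) fun n => (h2 n).1), supProj_le hf fun n => ?_, hf⟩
  rw [mul_sub, le_symm (h1 _).1.sa hf.sa (h1 _).2.1, le_symm (h1 _).1.sa hf.sa (h1 _).2.1]

theorem Cen.mul_supProj {ι : Type*} {E : ι → H →L[ℂ] H} (hz : Cen N z)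
    (hE : ∀ i, IsPr N (E i)) : z * supProj E = supProj fun i => z * E i := by
  have hS : IsPr N (supProj E) := IsPr.sup fun i => (hE i).mem
  have h1 : (supProj fun i => z * E i) * (z * supProj E) = supProj fun i => z * E i :=
    supProj_le (hz.pr_mul hS) fun i => by rw [hz.mul_mul_mul hS.mem, supProj_mul]
  have h2 : (supProj fun i => z * E i) * z * supProj E = z * supProj E :=
    mul_supProj_congr fun i => by rw [mul_assoc]; exact supProj_mul (fun i => z * E i) i
  rw [← h2, mul_assoc, h1]

/-- The supremum of an increasing sequence of projections subequivalent to `f` is subequivalent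
to `f`. -/
theorem sub_supProj_of_mono {E : ℕ → H →L[ℂ] H} (h0 : E 0 = 0)
    (hmono : ∀ n, E n * E (n + 1) = E n) (hE : ∀ n, Sub N (E n) f) : Sub N (supProj E) f := by
  have hEp : ∀ n, IsPr N (E n) := fun n => (hE n).left
  have hf : IsPr N f := (hE 0).right
  have hS : IsPr N (supProj E) := IsPr.sup fun i => (hEp i).mem
  obtain ⟨z, hz, hfin, hhalv⟩ := exists_fin_halv hf
  have hc := hz.compl
  have hcut : ∀ {z : H →L[ℂ] H}, Cen N z → ∀ n, z * E n * (z * E (n + 1)) = z * E n :=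
    fun hz n => by rw [hz.mul_mul_mul (hEp n).mem, hmono]
  have h1 : Sub N (z * supProj E) (z * f) := by
    rw [hz.mul_supProj hEp]
    refine sub_supProj_of_seq (fun n => hz.pr_mul (hEp n)) (by rw [h0, mul_zero]) (hcut hz)
      hfin.1 (fun _ => True) trivial fun n F hF hFf hEF _ => ?_
    obtain ⟨G, ⟨w, hw⟩, hG, -⟩ := (hE (n + 1)).cut hz
    have hEn := hz.pr_mul (hEp n)
    have hr := hw.restrict hEn (hcut hz n)
    have hr' := hr.right
    have hrG : w * (z * E n) * star w * G = w * (z * E n) * star w := hw.restrict_le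
    have k1 := hfin.eqv_sub (Eqv.refl hfin.1) (Eqv.trans (Eqv.symm ⟨_, hr⟩) hEF)
      (le_trans' hrG hG) hFf
    have hd := hw.restrict ((hz.pr_mul (hEp (n + 1))).sub hEn (hcut hz n))
      (by rw [sub_mul, hcut hz n, (hz.pr_mul (hEp (n + 1))).idem])
    have k2 : w * (z * E (n + 1) - z * E n) * star w = G - w * (z * E n) * star w := by
      rw [mul_sub, hw.mul_init, sub_mul, hw.fin]
    rw [k2] at hd
    have k3 : Sub N (z * E (n + 1) - z * E n) (z * f - F) :=
      (Sub.le_right (Sub.of_eqv ⟨_, hd⟩) (hfin.1.sub hr' (le_trans' hrG hG)) (by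
        rw [sub_mul, mul_sub, mul_sub, hG, hr'.idem, le_trans' hrG hG,
          le_symm hr'.sa hw.right.sa hrG, sub_self, sub_zero])).trans (Sub.of_eqv k1)
    obtain ⟨g, m1, m2, m3⟩ := k3
    have hFg : F * g = 0 := by
      rw [← le_symm m1.right.sa m3.sa m2, ← mul_assoc, mul_sub, hFf, hF.idem, sub_self, zero_mul]
    refine ⟨F + g, hF.add m1.right hFg, ?_, trivial, by rw [mul_add, hF.idem, hFg, add_zero], ?_⟩
    · rw [add_mul, hFf, ← m2, mul_assoc, sub_mul, hFf, hfin.1.idem]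
    · rwa [add_sub_cancel_left]
  have h2 : Sub N ((1 - z) * supProj E) ((1 - z) * f) := by
    rw [hc.mul_supProj hEp]
    refine sub_supProj_of_seq (fun n => hc.pr_mul (hEp n)) (by rw [h0, mul_zero]) (hcut hc)
      hhalv.1 (fun F => Eqv N ((1 - z) * f) ((1 - z) * f - F)) (by
        rw [sub_zero]; exact Eqv.refl hhalv.1) fun n F hF hFf _ hInv => ?_
    set k := (1 - z) * f
    have hd : IsPr N ((1 - z) * E (n + 1) - (1 - z) * E n) :=
      (hc.pr_mul (hEp (n + 1))).sub (hc.pr_mul (hEp n)) (hcut hc n)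
    have hdk : Sub N ((1 - z) * E (n + 1) - (1 - z) * E n) k :=
      (Sub.of_le hd (hc.pr_mul (hEp (n + 1)))
        (by rw [sub_mul, hcut hc n, (hc.pr_mul (hEp (n + 1))).idem])).trans ((hE (n + 1)).cut hc)
    obtain ⟨hkF, a, b, hab, hs, ha, hb⟩ := hhalv.of_eqv hInv
    obtain ⟨g, m1, m2, m3⟩ := hdk.trans (Sub.of_eqv (hInv.trans ha))
    have hg := m1.right
    have hak : a * (k - F) = a := by rw [← hs, mul_add, m3.idem, hab, add_zero]
    have hgk := le_trans' m2 hak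
    have hFg : F * g = 0 := by
      rw [← le_symm hg.sa hkF.sa hgk, ← mul_assoc, mul_sub, hFf, hF.idem, sub_self, zero_mul]
    have hgk' : g * k = g := by
      rw [← hgk, mul_assoc, sub_mul, hFf, hhalv.1.idem]
    have hFgp := hF.add hg hFg
    have hFgk : (F + g) * k = F + g := by rw [add_mul, hFf, hgk']
    refine ⟨F + g, hFgp, hFgk, ?_, by rw [mul_add, hF.idem, hFg, add_zero], ?_⟩
    · refine Sub.antisymm ?_ (Sub.of_le (hhalv.1.sub hFgp hFgk) hhalv.1
        (by rw [sub_mul, hFgk, hhalv.1.idem]))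
      refine (Sub.of_eqv (hInv.trans hb)).le_right (hhalv.1.sub hFgp hFgk) ?_
      have hbg : b * g = 0 := by
        rw [← le_symm hg.sa m3.sa m2, ← mul_assoc, orth_symm m3.sa hb.right.sa hab, zero_mul]
      have hbk : b * (k - F) = b := by
        rw [← hs, mul_add, hb.right.idem, orth_symm m3.sa hb.right.sa hab, zero_add]
      rw [← sub_sub, mul_sub, hbk, hbg, sub_zero]
    · rwa [add_sub_cancel_left]
  have := h1.add h2 (hz.compl_mul hS.mem) (hz.compl_mul hf.mem)
  rwa [Cen.mul_add_compl, Cen.mul_add_compl] at this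

end Exhaust

section LogPath

variable {H : Type*} [NormedAddCommGroup H] [InnerProductSpace ℂ H] [CompleteSpace H]

theorem norm_sub_one_lt_two_of_nonneg {V A : H →L[ℂ] H} (hV : star V * V = 1)
    (h : V + star V = A) (hA : 0 ≤ A) : ‖V - 1‖ < 2 := by
  have h1 : ‖V - 1‖ ≤ √2 := by
    refine ContinuousLinearMap.opNorm_le_bound _ (by positivity) fun x => ?_
    have hVx : ‖V x‖ = ‖x‖ :=
      norm_apply_eq_of_star_mul_self_eq (S := V) (T := 1) (by rw [hV, star_one, one_mul]) x
    have hpos : 0 ≤ RCLike.re (inner ℂ (A x) x) :=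
      ((ContinuousLinearMap.nonneg_iff_isPositive A).1 hA).re_inner_nonneg_left x
    have hsum : RCLike.re (inner ℂ (A x) x) = 2 * RCLike.re (inner ℂ (V x) x) := by
      rw [← h, _root_.add_apply, inner_add_left, map_add,
        ContinuousLinearMap.star_eq_adjoint, ContinuousLinearMap.adjoint_inner_left,
        inner_re_symm x (V x)]
      ring
    have h2 : ‖V x - x‖ ^ 2 ≤ 2 * ‖x‖ ^ 2 := by
      rw [norm_sub_sq (𝕜 := ℂ), hVx]
      linarith
    change ‖V x - x‖ ≤ _
    rw [← Real.sqrt_sq (norm_nonneg (V x - x)), ← Real.sqrt_sq (norm_nonneg x),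
      ← Real.sqrt_mul (by norm_num)]
    exact Real.sqrt_le_sqrt h2
  refine h1.trans_lt ?_
  rw [Real.sqrt_lt' (by norm_num)]
  norm_num

theorem exists_sqrt_unitary {w : H →L[ℂ] H} (h1 : star w * w = 1) (h2 : w * star w = 1) :
    ∃ V : H →L[ℂ] H, star V * V = 1 ∧ V * star V = 1 ∧ V * V = w ∧ ‖V - 1‖ < 2 ∧
      ∀ c, c * w = w * c → c * star w = star w * c → c * V = V * c ∧ c * star V = star V * c := by
  obtain ⟨u, hu, hi, hf, hc⟩ := exists_polar (1 + w)
  set T := 1 + w with hT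
  set A := CFC.abs T with hA
  set r := rangeProj T with hr
  have hApos : 0 ≤ A := CFC.abs_nonneg T
  have hAsa : star A = A := hApos.isSelfAdjoint.star_eq
  have hAA : A * A = star T * T := CFC.abs_mul_abs T
  have hsT : star T = 1 + star w := by rw [hT, star_add, star_one]
  have hrp := isStarProjection_rangeProj T
  have hrp' := isStarProjection_rangeProj (star T)
  have hrs : star r = r := hrp.isSelfAdjoint.star_eq
  have hri : r * r = r := hrp.isIdempotentElem
  have hri' : rangeProj (star T) * rangeProj (star T) = rangeProj (star T) :=
    hrp'.isIdempotentElem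
  have hcT : ∀ c, c * w = w * c → c * T = T * c := fun c h => by
    rw [hT, mul_add, add_mul, h, mul_one, one_mul]
  have hcT' : ∀ c, c * star w = star w * c → c * star T = star T * c := fun c h => by
    rw [hsT, mul_add, add_mul, h, mul_one, one_mul]
  have hcu : ∀ c, c * w = w * c → c * star w = star w * c → c * u = u * c := fun c h h' =>
    hc c (hcT c h) (hcT' c h')
  have hcu' : ∀ c, c * w = w * c → c * star w = star w * c → c * star u = star u * c := by
    intro c h h'
    have := congrArg star (hcu (star c) (by
      have := congrArg star h'; simpa using this.symm) (by
      have := congrArg star h; simpa using this.symm))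
    simpa using this.symm
  have hrw : (1 - r) * w = -(1 - r) := by
    have : (1 - r) * T = 0 := by rw [sub_mul, rangeProj_mul, one_mul, sub_self]
    rw [hT, mul_add, mul_one] at this
    exact eq_neg_of_add_eq_zero_right this
  have hrr : star u * u = r := by
    rw [hi]
    have e1 : (1 - r) * star T = 0 := by
      have : (1 - r) * w * star w = -((1 - r) * star w) := by rw [hrw, neg_mul]
      rw [mul_assoc, h2, mul_one] at this
      rw [hsT, mul_add, mul_one]
      nth_rewrite 1 [this]
      exact neg_add_cancel _
    have e2 : (1 - rangeProj (star T)) * T = 0 := by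
      have k : (1 - rangeProj (star T)) * star T = 0 := by
        rw [sub_mul, rangeProj_mul, one_mul, sub_self]
      rw [hsT, mul_add, mul_one] at k
      have k2 := congrArg (fun X => X * w) k
      simp only [add_mul, mul_assoc, h1, mul_one, zero_mul] at k2
      rw [mul_add, mul_one, add_comm]
      rw [← hsT] at k2
      exact k2
    have e3 := mul_rangeProj_eq_zero e1
    have e4 : (1 - rangeProj (star T)) * r = 0 := mul_rangeProj_eq_zero e2
    rw [sub_mul, one_mul, sub_eq_zero] at e3 e4
    have e5 := congrArg star e3
    rw [star_mul, hrs, hrp'.isSelfAdjoint.star_eq, ← e4] at e5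
    exact e5
  have hww : w * star w = star w * w := by rw [h1, h2]
  have hur : u * r = u := mul_of_star_mul_self_eq hrp hrr
  have hur' : star u * r = star u := mul_of_star_mul_self_eq hrp (by rw [star_star, hf])
  have hru : r * u = u := by rw [← hf, mul_assoc, hrr, hur]
  have hwu : w * u = u * w := hcu w rfl hww
  have hTu : T * u = u * T := by rw [hT, add_mul, mul_add, hwu, one_mul, mul_one]
  have hrT : r * T = T := rangeProj_mul T
  have hTr : T * r = T := by
    have : T * rangeProj (star T) = T := mul_rangeProj_star T
    rwa [← hi, hrr] at this
  have hAr : A * r = A := by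
    have : A * (1 - r) = 0 := by
      refine star_mul_self_eq_zero ?_
      rw [star_mul, hAsa, mul_assoc, ← mul_assoc A, hAA, mul_assoc, mul_sub, hTr, mul_one,
        sub_self, mul_zero, mul_zero]
    rw [mul_sub, mul_one, sub_eq_zero] at this
    exact this.symm
  have hrA : r * A = A := by
    have := congrArg star hAr
    rwa [star_mul, hAsa, hrs] at this
  have hAT : A = star u * T := by rw [← hu, ← mul_assoc, hrr, hrA]
  have hAu : A * u = T := by rw [hAT, mul_assoc, hTu, ← mul_assoc, hrr, hrT]
  have hsTA : star T = star u * A := by rw [← hAu, star_mul, hAsa]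
  have hsTw : star T = star w * T := by rw [hsT, hT, mul_add, mul_one, h1, add_comm]
  have huu : u * u = w * r := by
    have e1 : w * A = u * u * A := by
      have : r * A = u * (star w * (u * A)) := by
        rw [hu, ← hsTw, hsTA, ← mul_assoc, hf]
      rw [hrA] at this
      calc w * A = w * (u * (star w * (u * A))) := by rw [← this]
        _ = u * ((w * star w) * (u * A)) := by simp only [← mul_assoc, hwu]
        _ = u * u * A := by rw [h2, one_mul, mul_assoc]
    have e2 : w * T = u * u * T := by rw [← hAu, ← mul_assoc, e1, mul_assoc]
    have e3 : w * r = u * u * r := mul_rangeProj_congr e2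
    rw [e3, mul_assoc, hur]
  have huA : u + star u = A := by
    have e1 : (u + star u) * A = A * A := by
      rw [add_mul, hu, ← hsTA, hAA, hsT, hT]
      simp only [mul_add, add_mul, h1, one_mul, mul_one]
      abel
    have e2 : (u + star u) * T = A * T := by rw [← hAu, ← mul_assoc, e1, mul_assoc]
    have e3 : (u + star u) * r = A * r := mul_rangeProj_congr e2
    rwa [hAr, add_mul, hur, hur'] at e3
  have hur0 : u * (1 - r) = 0 := by rw [mul_sub, hur, mul_one, sub_self]
  have hru0 : (1 - r) * u = 0 := by rw [sub_mul, hru, one_mul, sub_self]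
  have hur0' : star u * (1 - r) = 0 := by rw [mul_sub, hur', mul_one, sub_self]
  have hru0' : (1 - r) * star u = 0 := by
    have := congrArg star hur0
    rwa [star_mul, star_sub, star_one, hrs, star_zero] at this
  have hqq : (1 - r) * (1 - r) = 1 - r := by
    rw [mul_sub, sub_mul, sub_mul, hri]; simp
  have hsV : star (u + Complex.I • (1 - r)) = star u + (-Complex.I) • (1 - r) := by
    rw [star_add, star_smul, star_sub, star_one, hrs, Complex.star_def, Complex.conj_I]
  have hII : ∀ x : H →L[ℂ] H, Complex.I • Complex.I • x = -x := fun x => by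
    rw [← mul_smul, Complex.I_mul_I, neg_smul, one_smul]
  have hIn : ∀ x : H →L[ℂ] H, Complex.I • -x = -(Complex.I • x) := fun x => smul_neg _ x
  have hwq : w * (1 - r) = -(1 - r) := by
    have h3 : w * r = r * w := by
      rw [← hf, ← mul_assoc, hwu, mul_assoc, hcu' w rfl hww, mul_assoc]
    rw [← hrw, mul_sub, sub_mul, h3, mul_one, one_mul]
  refine ⟨u + Complex.I • (1 - r), ?_, ?_, ?_, ?_, fun c h h' => ?_⟩
  · rw [hsV]
    simp only [mul_add, add_mul, mul_smul_comm, smul_mul_assoc, hrr, hur0', hru0, hqq,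
      smul_zero, smul_smul, Complex.I_mul_I, neg_smul, one_smul, neg_mul, mul_neg, neg_neg, hII]
    simp only [hIn, hII, sub_neg_eq_add, neg_neg, add_sub_cancel, zero_add, add_zero, neg_zero, neg_sub, sub_zero]
  · rw [hsV]
    simp only [mul_add, add_mul, mul_smul_comm, smul_mul_assoc, hf, hur0, hru0', hqq,
      smul_zero, smul_smul, Complex.I_mul_I, neg_smul, one_smul, neg_mul, mul_neg, neg_neg, hII]
    simp only [hIn, hII, sub_neg_eq_add, neg_neg, add_sub_cancel, zero_add, add_zero, neg_zero, neg_sub, sub_zero]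
  · simp only [mul_add, add_mul, mul_smul_comm, smul_mul_assoc, huu, hur0, hru0, hqq,
      smul_zero, smul_smul, Complex.I_mul_I, zero_add, add_zero, neg_smul, one_smul]
    rw [← hwq, ← mul_add, add_sub_cancel, mul_one]
  · refine norm_sub_one_lt_two_of_nonneg (A := A) ?_ ?_ hApos
    · rw [hsV]
      simp only [mul_add, add_mul, mul_smul_comm, smul_mul_assoc, hrr, hur0', hru0, hqq,
        smul_zero, smul_smul, Complex.I_mul_I, neg_smul, one_smul, neg_mul, mul_neg, neg_neg, hII]
      simp only [hIn, hII, sub_neg_eq_add, neg_neg, add_sub_cancel, zero_add, add_zero, neg_zero, neg_sub, sub_zero]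
    · rw [hsV, ← huA, neg_smul]
      abel
  · have k1 := hcu c h h'
    have k2 := hcu' c h h'
    have k3 : c * r = r * c := by rw [← hf, ← mul_assoc, k1, mul_assoc, k2, mul_assoc]
    rw [hsV]
    simp only [mul_add, add_mul, mul_sub, sub_mul, mul_smul_comm, smul_mul_assoc, k1, k2, k3,
      mul_one, one_mul, and_self]

theorem exists_unitary_line {B : Type*} [CStarAlgebra B] {V : B} (hV1 : star V * V = 1)
    (hV2 : V * star V = 1) (hV : ‖V - 1‖ < 2) :
    ∃ g : ℝ → B, Continuous g ∧ g 0 = 1 ∧ g 1 = V ∧ (∀ t, g t ∈ unitary B) ∧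
      ∀ c t, Commute V c → Commute (star V) c → Commute c (g t) := by
  let Vu : unitary B := ⟨V, Unitary.mem_iff.2 ⟨hV1, hV2⟩⟩
  let a := Unitary.argSelfAdjoint Vu
  have ha : selfAdjoint.expUnitary a = Vu := expUnitary_argSelfAdjoint hV
  refine ⟨fun t => (selfAdjoint.expUnitary (t • a) : B), ?_, ?_, ?_,
    fun t => (selfAdjoint.expUnitary _).2, fun c t h h' => ?_⟩
  · refine continuous_subtype_val.comp (selfAdjoint.continuous_expUnitary.comp ?_)
    fun_prop
  · simp only [zero_smul, selfAdjoint.expUnitary_zero, OneMemClass.coe_one]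
  · simp only [one_smul, ha, Vu]
  · have k : Commute (a : B) c := Commute.cfc h h' _
    simp only [selfAdjoint.expUnitary_coe]
    refine Commute.exp_right ?_
    exact ((k.symm.smul_right (t : ℝ)).smul_right Complex.I)

theorem exists_joinedIn_commutant {w : H →L[ℂ] H} (h1 : star w * w = 1) (h2 : w * star w = 1) :
    JoinedIn {v : H →L[ℂ] H | star v * v = 1 ∧ v * star v = 1 ∧
      ∀ c, c * w = w * c → c * star w = star w * c → c * v = v * c} 1 w := by
  obtain ⟨V, hV1, hV2, hVV, hV, hc⟩ := exists_sqrt_unitary h1 h2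
  obtain ⟨g, hg, hg0, hg1, hgu, hgc⟩ := exists_unitary_line hV1 hV2 hV
  refine ⟨⟨⟨fun t => g t * g t, by fun_prop⟩, ?_, ?_⟩, fun t => ⟨?_, ?_, fun c h h' => ?_⟩⟩
  · simp [hg0]
  · simp [hg1, hVV]
  · exact Unitary.star_mul_self_of_mem (mul_mem (hgu _) (hgu _))
  · exact Unitary.mul_star_self_of_mem (mul_mem (hgu _) (hgu _))
  · have k : Commute c (g t) := hgc c t (Commute.symm (hc c h h').1) (Commute.symm (hc c h h').2)
    exact (k.mul_right k).eq

end LogPath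

section Connect

variable {H : Type*} [NormedAddCommGroup H] [InnerProductSpace ℂ H] [CompleteSpace H]
variable {N : VonNeumannAlgebra H} {e e' e'' e₁ e₁' f v w u : H →L[ℂ] H} {F : Type*}
  {x y z x₁ y₁ D : F → H →L[ℂ] H}

theorem Via.norm_le_one (hv : Via N v e f) : ‖v‖ ≤ 1 :=
  ContinuousLinearMap.opNorm_le_bound _ zero_le_one fun h => by
    rw [one_mul]
    exact hv.norm_apply_le h

theorem Via.norm_conj_le (hv : Via N v e f) (T : H →L[ℂ] H) : ‖star v * T * v‖ ≤ ‖T‖ :=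
  calc ‖star v * T * v‖ ≤ ‖star v‖ * ‖T‖ * ‖v‖ :=
        (norm_mul_le _ _).trans (mul_le_mul_of_nonneg_right (norm_mul_le _ _) (norm_nonneg _))
    _ ≤ 1 * ‖T‖ * 1 := by
        have := hv.norm_le_one
        have := hv.symm.norm_le_one
        gcongr
    _ = ‖T‖ := by ring

/-- Partial isometries of `N` from `e'` onto `e` conjugating the family `x` to within `c` of the
family `y`. -/
def Adm (N : VonNeumannAlgebra H) (e : H →L[ℂ] H) (x : F → H →L[ℂ] H) (e' : H →L[ℂ] H)
    (y : F → H →L[ℂ] H) (c : F → ℝ) : Set (H →L[ℂ] H) :=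
  {w | Via N w e' e ∧ ∀ f, ‖star w * x f * w - y f‖ ≤ c f}

/-- There is a norm continuous path on `[0, 1)` of partial isometries of `N` from `e'` onto `e`
which asymptotically conjugates `x` to `y`. -/
def Conn (N : VonNeumannAlgebra H) (e : H →L[ℂ] H) (x : F → H →L[ℂ] H) (e' : H →L[ℂ] H)
    (y : F → H →L[ℂ] H) : Prop :=
  ∃ γ : ℝ → (H →L[ℂ] H), ContinuousOn γ (Set.Ico 0 1) ∧
    (∀ t ∈ Set.Ico (0 : ℝ) 1, Via N (γ t) e' e) ∧
    ∀ f, Tendsto (fun t => star (γ t) * x f * γ t) (𝓝[Set.Ico 0 1] 1) (𝓝 (y f))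

theorem Conn.of_via (hv : Via N v e' e) (h : ∀ f, star v * x f * v = y f) : Conn N e x e' y :=
  ⟨fun _ => v, continuousOn_const, fun _ _ => hv, fun f => by
    simp only [h f]
    exact tendsto_const_nhds⟩

theorem Conn.symm (h : Conn N e x e' y) (hx : ∀ f, e * x f * e = x f) : Conn N e' y e x := by
  obtain ⟨γ, hc, hv, ht⟩ := h
  refine ⟨fun t => star (γ t), hc.star, fun t ht => (hv t ht).symm, fun f => ?_⟩
  rw [tendsto_iff_norm_sub_tendsto_zero]
  have h1 := tendsto_iff_norm_sub_tendsto_zero.1 (ht f)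
  refine squeeze_zero' (Eventually.of_forall fun _ => norm_nonneg _) ?_ h1
  filter_upwards [self_mem_nhdsWithin] with t ht
  have hvt := hv t ht
  have h2 := hvt.symm.norm_conj_le (star (γ t) * x f * γ t - y f)
  rw [star_star] at h2 ⊢
  rw [norm_sub_rev]
  have h3 : x f = γ t * (star (γ t) * x f * γ t) * star (γ t) :=
    calc x f = (γ t * star (γ t)) * x f * (γ t * star (γ t)) := by rw [hvt.fin, hx]
      _ = _ := by simp only [mul_assoc]
  rw [mul_sub, sub_mul, ← h3] at h2
  exact h2

theorem Conn.trans (h : Conn N e x e' y) (h' : Conn N e' y e'' z) : Conn N e x e'' z := by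
  obtain ⟨γ, hc, hv, ht⟩ := h
  obtain ⟨δ, hc', hv', ht'⟩ := h'
  refine ⟨fun t => γ t * δ t, hc.mul hc', fun t ht => (hv' t ht).trans (hv t ht), fun f => ?_⟩
  have h1 := tendsto_iff_norm_sub_tendsto_zero.1 (ht f)
  have h2 := tendsto_iff_norm_sub_tendsto_zero.1 (ht' f)
  rw [tendsto_iff_norm_sub_tendsto_zero]
  have h3 := h1.add h2
  rw [add_zero] at h3
  refine squeeze_zero' (Eventually.of_forall fun _ => norm_nonneg _) ?_ h3
  filter_upwards [self_mem_nhdsWithin] with t ht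
  have h4 := (hv' t ht).norm_conj_le (star (γ t) * x f * γ t - y f)
  have h5 : star (γ t * δ t) * x f * (γ t * δ t) - z f =
      star (δ t) * (star (γ t) * x f * γ t - y f) * δ t + (star (δ t) * y f * δ t - z f) := by
    rw [star_mul]
    simp only [mul_sub, sub_mul, mul_assoc]
    abel
  rw [h5]
  exact (norm_add_le _ _).trans (by gcongr)

theorem Conn.add (h : Conn N e x e' y) (h' : Conn N e₁ x₁ e₁' y₁) (h0 : e * e₁ = 0)
    (h0' : e' * e₁' = 0) (hx : ∀ f, e * x f * e = x f) (hx₁ : ∀ f, e₁ * x₁ f * e₁ = x₁ f) :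
    Conn N (e + e₁) (fun f => x f + x₁ f) (e' + e₁') fun f => y f + y₁ f := by
  obtain ⟨γ, hc, hv, ht⟩ := h
  obtain ⟨δ, hc', hv', ht'⟩ := h'
  refine ⟨fun t => γ t + δ t, hc.add hc', fun t ht => (hv t ht).add (hv' t ht) h0' h0,
    fun f => ?_⟩
  refine Tendsto.congr' ?_ ((ht f).add (ht' f))
  filter_upwards [self_mem_nhdsWithin] with t ht
  have a := hv t ht
  have b := hv' t ht
  have h0s : e₁ * e = 0 := orth_symm a.right.sa b.right.sa h0
  have k1 : star (γ t) * x₁ f = 0 := by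
    rw [← hx₁ f, ← a.mul_fin]
    simp only [mul_assoc, mul_mul_of_eq h0, zero_mul, mul_zero]
  have k2 : star (δ t) * x f = 0 := by
    rw [← hx f, ← b.mul_fin]
    simp only [mul_assoc, mul_mul_of_eq h0s, zero_mul, mul_zero]
  have k3 : x₁ f * γ t = 0 := by
    rw [← hx₁ f, ← a.fin_mul]
    simp only [mul_assoc, mul_mul_of_eq h0s, zero_mul, mul_zero]
  have k4 : x f * δ t = 0 := by
    rw [← hx f, ← b.fin_mul]
    simp only [mul_assoc, mul_mul_of_eq h0, zero_mul, mul_zero]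
  rw [star_add]
  simp only [add_mul, mul_add, k1, k2, zero_mul, mul_assoc, k3, k4, mul_zero, add_zero, zero_add]

theorem exists_continuous_concat {E : Type*} [NormedAddCommGroup E] {S : ℕ → Set E} {w : ℕ → E}
    (h : ∀ n, JoinedIn (S n) (w n) (w (n + 1))) :
    ∃ g : ℝ → E, Continuous g ∧ ∀ t, 0 ≤ t → g t ∈ S ⌊t⌋₊ := by
  let p : ∀ n, Path (w n) (w (n + 1)) := fun n => (h n).somePath
  have hp : ∀ n t, (p n).extend t ∈ S n := fun n t => by
    have : (p n).extend t ∈ Set.range (p n).extend := Set.mem_range_self t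
    rw [Path.extend_range] at this
    obtain ⟨s, hs⟩ := this
    rw [← hs]
    exact (h n).somePath_mem s
  let q : ℕ → ℝ → E := fun n t => (p n).extend (t - n) - w n
  have hq0 : ∀ (n : ℕ) (t : ℝ), t ≤ n → q n t = 0 := fun n t ht => by
    simp only [q]
    rw [Path.extend_of_le_zero _ (by linarith), sub_self]
  have hq1 : ∀ (n : ℕ) (t : ℝ), (n : ℝ) + 1 ≤ t → q n t = w (n + 1) - w n := fun n t ht => by
    simp only [q]
    rw [Path.extend_of_one_le _ (by linarith)]
  refine ⟨fun t => w 0 + ∑ᶠ n, q n t, continuous_const.add (continuous_finsum (fun n => ?_) ?_),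
    fun t ht => ?_⟩
  · exact ((p n).continuous_extend.comp (by fun_prop)).sub continuous_const
  · intro t
    refine ⟨Set.Iio (t + 1), Iio_mem_nhds (by linarith), ?_⟩
    refine (Set.finite_Iio (⌈t + 1⌉₊)).subset ?_
    rintro n ⟨s, hs1, hs2⟩
    have : (n : ℝ) < s := by
      by_contra hns
      exact hs1 (hq0 n s (not_lt.1 hns))
    rw [Set.mem_Iio] at hs2 ⊢
    exact Nat.lt_ceil.2 (this.trans hs2)
  · have hsup : (Function.support fun n => q n t) ⊆ Finset.range (⌊t⌋₊ + 1) := by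
      intro n hn
      rw [Finset.coe_range, Set.mem_Iio]
      by_contra hns
      refine hn (hq0 n t ?_)
      have h1 := Nat.lt_floor_add_one t
      have h2 : ((⌊t⌋₊ + 1 : ℕ) : ℝ) ≤ n := by exact_mod_cast not_lt.1 hns
      push_cast at h2
      linarith
    change w 0 + ∑ᶠ n, q n t ∈ _
    rw [finsum_eq_sum_of_support_subset _ hsup, Finset.sum_range_succ]
    have h3 : ∑ n ∈ Finset.range ⌊t⌋₊, q n t = ∑ n ∈ Finset.range ⌊t⌋₊, (w (n + 1) - w n) := by
      refine Finset.sum_congr rfl fun n hn => hq1 n t ?_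
      have h1 := Nat.floor_le ht
      have h2 : ((n + 1 : ℕ) : ℝ) ≤ ⌊t⌋₊ := by exact_mod_cast Finset.mem_range.1 hn
      push_cast at h2
      linarith
    rw [h3, Finset.sum_range_sub]
    have h4 : w 0 + (w ⌊t⌋₊ - w 0 + q ⌊t⌋₊ t) = (p ⌊t⌋₊).extend (t - ⌊t⌋₊) := by
      simp only [q]
      abel
    rw [h4]
    exact hp _ _

theorem Conn.of_joinedIn {c : ℕ → F → ℝ} {w : ℕ → H →L[ℂ] H}
    (hc : ∀ f, Tendsto (fun n => c n f) atTop (𝓝 0))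
    (h : ∀ n, JoinedIn (Adm N e x e' y (c n)) (w n) (w (n + 1))) : Conn N e x e' y := by
  obtain ⟨g, hg, hgS⟩ := exists_continuous_concat h
  have hnn : ∀ t ∈ Set.Ico (0 : ℝ) 1, 0 ≤ t / (1 - t) := fun t ht =>
    div_nonneg ht.1 (by linarith [ht.2])
  refine ⟨fun t => g (t / (1 - t)), ?_, fun t ht => (hgS _ (hnn t ht)).1, fun f => ?_⟩
  · refine hg.comp_continuousOn (continuousOn_id.div (by fun_prop) fun t ht => ?_)
    have := ht.2
    intro h0
    linarith
  · have hlim : Tendsto (fun t : ℝ => t / (1 - t)) (𝓝[Set.Ico 0 1] 1) atTop := by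
      have h1 : Tendsto (fun t : ℝ => 1 - t) (𝓝[Set.Ico 0 1] 1) (𝓝[>] 0) := by
        refine tendsto_nhdsWithin_iff.2 ⟨?_, ?_⟩
        · have : Tendsto (fun t : ℝ => 1 - t) (𝓝 1) (𝓝 (1 - 1)) :=
            (continuous_const.sub continuous_id).tendsto 1
          rw [sub_self] at this
          exact this.mono_left nhdsWithin_le_nhds
        · filter_upwards [self_mem_nhdsWithin] with t ht
          exact sub_pos.2 ht.2
      have h2 : Tendsto (fun t : ℝ => t) (𝓝[Set.Ico 0 1] 1) (𝓝 1) :=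
        tendsto_id.mono_left nhdsWithin_le_nhds
      exact h2.pos_mul_atTop one_pos (tendsto_inv_nhdsGT_zero.comp h1)
    rw [tendsto_iff_norm_sub_tendsto_zero]
    have h1 := (hc f).comp (tendsto_nat_floor_atTop.comp hlim)
    refine squeeze_zero' (Eventually.of_forall fun _ => norm_nonneg _) ?_ h1
    filter_upwards [self_mem_nhdsWithin] with t ht
    exact (hgS _ (hnn t ht)).2 f

theorem joinedIn_adm {δ δ' : F → ℝ} (hu : Via N u e' e) (hv : Via N v e' e)
    (hD : ∀ f, e * D f = D f) (hD' : ∀ f, D f * e = D f)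
    (huv : ∀ f, star u * D f * u = star v * D f * v) (hx : ∀ f, ‖x f - D f‖ ≤ δ f)
    (hy : ∀ f, ‖star u * D f * u - y f‖ ≤ δ' f) :
    JoinedIn (Adm N e x e' y fun f => δ f + δ' f) u v := by
  have he : IsPr N e := hu.right
  set w := v * star u + (1 - e) with hw
  have hvu : Via N (v * star u) e e := hu.symm.trans hv
  have hwv : Via N w 1 1 := by
    have := hvu.add (Via.refl he.compl) (by rw [mul_sub, mul_one, he.idem, sub_self])
      (by rw [mul_sub, mul_one, he.idem, sub_self])
    rwa [add_sub_cancel] at this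
  have hwu : w * u = v := by
    rw [hw, add_mul, mul_assoc, hu.init, hv.mul_init, sub_mul, one_mul, hu.fin_mul, sub_self,
      add_zero]
  have hwe : e * w = w * e := by
    rw [hw, mul_add, add_mul, hvu.fin_mul, hvu.mul_init, mul_sub, sub_mul, one_mul, mul_one]
  have hstar : ∀ T, T * w = w * T → T * star w = star w * T := fun T hT => by
    calc T * star w = (star w * w) * T * star w := by rw [hwv.init, one_mul]
      _ = star w * (T * w) * star w := by rw [hT]; simp only [mul_assoc]
      _ = star w * T * (w * star w) := by simp only [mul_assoc]
      _ = star w * T := by rw [hwv.fin, mul_one]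
  have hwD : ∀ f, D f * w = w * D f := fun f => by
    have h1 : v * (star u * D f * u) * star u = v * star u * D f := by
      calc _ = v * star u * (D f * (u * star u)) := by simp only [mul_assoc]
        _ = _ := by rw [hu.fin, hD']
    have h2 : v * (star v * D f * v) * star u = D f * (v * star u) := by
      calc _ = ((v * star v) * D f) * (v * star u) := by simp only [mul_assoc]
        _ = _ := by rw [hv.fin, hD]
    rw [huv f, h2] at h1
    rw [hw, mul_add, add_mul, h1, mul_sub, sub_mul, hD, hD', mul_one, one_mul]
  obtain ⟨p, hp⟩ := exists_joinedIn_commutant hwv.init hwv.fin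
  have hpe : ∀ t, e * p t = p t * e := fun t => (hp t).2.2 e hwe (hstar e hwe)
  have hvia : ∀ t, Via N (p t * u) e' e := by
    intro t
    have hm : p t ∈ N := mem_of_commute fun c hc =>
      (hp t).2.2 c (commute_of_mem hwv.mem hc) (commute_of_mem (star_mem hwv.mem) hc)
    refine ⟨mul_mem hm hu.mem, ?_, ?_, hu.left⟩
    · rw [star_mul, mul_assoc, mul_mul_of_eq (hp t).1, one_mul, hu.init]
    · calc p t * u * star (p t * u) = p t * (u * star u) * star (p t) := by
            rw [star_mul]; simp only [mul_assoc]
        _ = e := by rw [hu.fin, ← hpe, mul_assoc, (hp t).2.1, mul_one]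
  refine ⟨⟨⟨fun t => p t * u, by fun_prop⟩, ?_, ?_⟩, fun t => ⟨hvia t, fun f => ?_⟩⟩
  · simp
  · simp [hwu]
  · have h1 : star (p t * u) * D f * (p t * u) = star u * D f * u := by
      have : D f * p t = p t * D f := (hp t).2.2 _ (hwD f) (hstar _ (hwD f))
      calc star (p t * u) * D f * (p t * u) = star u * star (p t) * (D f * p t) * u := by
            rw [star_mul]; simp only [mul_assoc]
        _ = star u * ((star (p t) * p t) * D f) * u := by rw [this]; simp only [mul_assoc]
        _ = _ := by rw [(hp t).1, one_mul]
    have h2 : star (p t * u) * x f * (p t * u) - y f =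
        star (p t * u) * (x f - D f) * (p t * u) + (star u * D f * u - y f) := by
      rw [mul_sub, sub_mul, h1]
      abel
    change ‖star (p t * u) * x f * (p t * u) - y f‖ ≤ _
    rw [h2]
    exact (norm_add_le _ _).trans (add_le_add (((hvia t).norm_conj_le _).trans (hx f)) (hy f))

end Connect

section Families

variable {H : Type*} [NormedAddCommGroup H] [InnerProductSpace ℂ H] [CompleteSpace H]
variable {N : VonNeumannAlgebra H} {e e' p q x x₁ x₂ u v : H →L[ℂ] H} {ι κ : Type*}

theorem Dom.zero (hp : IsPr N p) : Dom N 0 p :=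
  ⟨0, ⟨IsPr.zero, 0, 0, by simp, by simp, Eqv.refl IsPr.zero, Eqv.refl IsPr.zero⟩,
    Sub.refl IsPr.zero, Sub.zero hp⟩

theorem Dom.eq_zero (h : Dom N x 0) : x = 0 := by
  obtain ⟨y, -, h1, h2⟩ := h
  rw [h2.eq_zero] at h1
  exact h1.eq_zero

theorem Dom.left (h : Dom N x p) : IsPr N x := by
  obtain ⟨y, -, h1, h2⟩ := h
  exact h1.left

theorem Dom.right (h : Dom N x p) : IsPr N p := by
  obtain ⟨y, -, h1, h2⟩ := h
  exact h2.right

theorem Sub.glue {z : H →L[ℂ] H} (hz : Cen N z) (h : Sub N (z * p) (z * q))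
    (h' : Sub N ((1 - z) * p) ((1 - z) * q)) (hp : p ∈ N) (hq : q ∈ N) : Sub N p q := by
  have := h.add h' (hz.compl_mul hp) (hz.compl_mul hq)
  rwa [Cen.mul_add_compl, Cen.mul_add_compl] at this

theorem Eqv.glue {z : H →L[ℂ] H} (hz : Cen N z) (h : Eqv N (z * p) (z * q))
    (h' : Eqv N ((1 - z) * p) ((1 - z) * q)) (hp : p ∈ N) (hq : q ∈ N) : Eqv N p q := by
  have := h.add h' (hz.compl_mul hp) (hz.compl_mul hq)
  rwa [Cen.mul_add_compl, Cen.mul_add_compl] at this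

theorem Halv.glue {z : H →L[ℂ] H} (hz : Cen N z) (hp : Halv N p) (hq : Halv N q) :
    Halv N (z * p + (1 - z) * q) := by
  obtain ⟨hpp, a, b, h1, h2, h3, h4⟩ := hp
  obtain ⟨hqp, c, d, k1, k2, k3, k4⟩ := hq
  have hzc := hz.compl
  have ho := hz.compl_mul (f := q) hpp.mem
  refine ⟨(hz.pr_mul hpp).add (hzc.pr_mul hqp) ho, z * a + (1 - z) * c, z * b + (1 - z) * d,
    ?_, ?_, (h3.cut hz).add (k3.cut hzc) ho (hz.compl_mul h3.right.mem),
    (h4.cut hz).add (k4.cut hzc) ho (hz.compl_mul h4.right.mem)⟩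
  · have l1 := hz.compl_mul (f := d) h3.right.mem
    have l2 : (1 - z) * c * (z * b) = 0 := by
      have := hzc.compl_mul (f := b) k3.right.mem
      rwa [sub_sub_cancel] at this
    rw [add_mul, mul_add, mul_add, l1, l2, hz.mul_mul_mul h3.right.mem,
      hzc.mul_mul_mul k3.right.mem, h1, k1]
    simp
  · rw [← h2, ← k2, mul_add, mul_add]
    abel

theorem Dom.add (h₁ : Dom N x₁ p) (h₂ : Dom N x₂ p) (h : x₁ * x₂ = 0) : Dom N (x₁ + x₂) p := by
  have hp := h₁.right
  obtain ⟨y₁, hy₁, k₁, l₁⟩ := h₁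
  obtain ⟨y₂, hy₂, k₂, l₂⟩ := h₂
  obtain ⟨z, hz, hz1, hz2⟩ := exists_comparison hy₁.1 hy₂.1
  have hzc := hz.compl
  have key : ∀ {c a b y}, Cen N c → Halv N y → Sub N a y → Sub N b y → a * b = 0 →
      Sub N (c * (a + b)) (c * y) := by
    intro c a b y hc hy ha hb hab
    obtain ⟨hyp, y1, y2, m1, m2, m3, m4⟩ := hy
    have := (ha.trans (Sub.of_eqv m3)).add (hb.trans (Sub.of_eqv m4)) hab m1
    rw [m2] at this
    exact this.cut hc
  have hx : x₁ + x₂ ∈ N := add_mem k₁.left.mem k₂.left.mem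
  have hzy := hz.compl_mul (f := y₁) hy₂.1.mem
  have hyN : z * y₂ + (1 - z) * y₁ ∈ N :=
    add_mem (mul_mem hz.mem hy₂.1.mem) (mul_mem hzc.mem hy₁.1.mem)
  have e1 : z * (z * y₂ + (1 - z) * y₁) = z * y₂ := by
    have : z * (1 - z) = 0 := by rw [mul_sub, hz.idem, mul_one, sub_self]
    rw [mul_add, ← mul_assoc, ← mul_assoc, hz.idem, this, zero_mul, add_zero]
  have e2 : (1 - z) * (z * y₂ + (1 - z) * y₁) = (1 - z) * y₁ := by
    have : (1 - z) * z = 0 := by rw [sub_mul, hz.idem, one_mul, sub_self]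
    rw [mul_add, ← mul_assoc, ← mul_assoc, hzc.idem, this, zero_mul, zero_add]
  refine ⟨z * y₂ + (1 - z) * y₁, hy₂.glue hz hy₁, Sub.glue hz ?_ ?_ hx hyN,
    Sub.glue hz ?_ ?_ hyN hp.mem⟩
  · rw [e1]
    have m1 : Sub N (z * x₁) (z * y₂) := (k₁.cut hz).trans hz1
    have := key hz (hy₂.cut hz) m1 (k₂.cut hz) (by rw [hz.mul_mul_mul k₁.left.mem, h, mul_zero])
    rwa [mul_add, ← mul_assoc, ← mul_assoc, ← mul_assoc, hz.idem, ← mul_add] at this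
  · rw [e2]
    have m1 : Sub N ((1 - z) * x₂) ((1 - z) * y₁) := (k₂.cut hzc).trans hz2
    have := key hzc (hy₁.cut hzc) (k₁.cut hzc) m1
      (by rw [hzc.mul_mul_mul k₁.left.mem, h, mul_zero])
    rwa [mul_add, ← mul_assoc, ← mul_assoc, ← mul_assoc, hzc.idem, ← mul_add] at this
  · rw [e1]
    exact l₂.cut hz
  · rw [e2]
    exact l₁.cut hzc

/-- A finite orthogonal family of projections of `N` with sum `e`. -/
structure Fam (N : VonNeumannAlgebra H) (s : Finset ι) (p : ι → H →L[ℂ] H)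
    (e : H →L[ℂ] H) : Prop where
  pr : ∀ i ∈ s, IsPr N (p i)
  orth : ∀ i ∈ s, ∀ j ∈ s, i ≠ j → p i * p j = 0
  sum : ∑ i ∈ s, p i = e

namespace Fam

variable {s : Finset ι} {P : ι → H →L[ℂ] H}

theorem isPr (h : Fam N s P e) : IsPr N e := h.sum ▸ IsPr.sum s h.pr h.orth

theorem mul_right (h : Fam N s P e) {i : ι} (hi : i ∈ s) : P i * e = P i := by
  rw [← h.sum, Finset.mul_sum, Finset.sum_eq_single_of_mem i hi fun j hj hij =>
    h.orth i hi j hj (Ne.symm hij), (h.pr i hi).idem]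

theorem mul_left (h : Fam N s P e) {i : ι} (hi : i ∈ s) : e * P i = P i :=
  le_symm (h.pr i hi).sa h.isPr.sa (h.mul_right hi)

theorem dom (h : Fam N s P e) (hd : ∀ i ∈ s, Dom N (P i) p) (hp : IsPr N p) : Dom N e p := by
  classical
  obtain ⟨-, ho, rfl⟩ := h
  induction s using Finset.induction_on with
  | empty => simpa using Dom.zero hp
  | insert a s ha ih =>
    rw [Finset.sum_insert ha]
    refine (hd a (Finset.mem_insert_self _ _)).add
      (ih (fun i hi => hd i (Finset.mem_insert_of_mem hi))
        fun i hi j hj => ho i (Finset.mem_insert_of_mem hi) j (Finset.mem_insert_of_mem hj)) ?_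
    rw [Finset.mul_sum]
    refine Finset.sum_eq_zero fun j hj => ho a (Finset.mem_insert_self _ _) j
      (Finset.mem_insert_of_mem hj) ?_
    rintro rfl
    exact ha hj

theorem norm_le (h : Fam N s P e) {T : H →L[ℂ] H} (hT : T * e = T)
    (hc : ∀ i ∈ s, T * P i = P i * T) {δ : ℝ} (hδ : 0 ≤ δ) (hn : ∀ i ∈ s, ‖T * P i‖ ≤ δ) :
    ‖T‖ ≤ δ := by
  classical
  refine ContinuousLinearMap.opNorm_le_bound _ hδ fun v => ?_
  have key : ∀ t ⊆ s, ‖(T * ∑ i ∈ t, P i) v‖ ^ 2 ≤ δ ^ 2 * ‖(∑ i ∈ t, P i) v‖ ^ 2 := by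
    intro t
    induction t using Finset.induction_on with
    | empty => simp
    | insert a t ha ih =>
      intro hts
      have has := hts (Finset.mem_insert_self a t)
      have htt : t ⊆ s := fun i hi => hts (Finset.mem_insert_of_mem hi)
      have ho : P a * ∑ i ∈ t, P i = 0 := by
        rw [Finset.mul_sum]
        refine Finset.sum_eq_zero fun j hj => h.orth a has j (htt hj) ?_
        rintro rfl
        exact ha hj
      have hTP : T * P a = P a * (T * P a) := by
        rw [← mul_assoc, ← hc a has, mul_assoc, (h.pr a has).idem]
      have hin : ∀ S : H →L[ℂ] H, P a * S = 0 → ∀ R : H →L[ℂ] H, P a * R = R →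
          ‖(R + S) v‖ ^ 2 = ‖R v‖ ^ 2 + ‖S v‖ ^ 2 := by
        intro S hS R hR
        have : inner ℂ (R v) (S v) = 0 := by
          rw [← hR, mul_apply_eq_comp, ← (h.pr a has).sa, ContinuousLinearMap.star_eq_adjoint,
            ContinuousLinearMap.adjoint_inner_left, ← mul_apply_eq_comp, hS,
            _root_.zero_apply, inner_zero_right]
        rw [_root_.add_apply, norm_add_sq (𝕜 := ℂ), this]
        simp
      have hTo : P a * (T * ∑ i ∈ t, P i) = 0 := by
        rw [← mul_assoc, ← hc a has, mul_assoc, ho, mul_zero]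
      rw [Finset.sum_insert ha, mul_add, hin _ hTo _ hTP.symm, hin _ ho _ (h.pr a has).idem,
        mul_add]
      refine add_le_add ?_ (ih htt)
      have h1 : ‖(T * P a) v‖ ≤ δ * ‖P a v‖ := by
        have : (T * P a) v = (T * P a) (P a v) := by
          rw [← mul_apply_eq_comp, mul_assoc, (h.pr a has).idem]
        rw [this]
        exact (ContinuousLinearMap.le_opNorm _ _).trans
          (mul_le_mul_of_nonneg_right (hn a has) (norm_nonneg _))
      calc ‖(T * P a) v‖ ^ 2 ≤ (δ * ‖P a v‖) ^ 2 := by gcongr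
        _ = _ := by ring
  have h1 := key s subset_rfl
  rw [h.sum, hT] at h1
  have h2 := h.isPr.norm_apply_le v
  have h3 : ‖T v‖ ≤ δ * ‖e v‖ := by
    refine le_of_sq_le_sq ?_ (by positivity)
    rwa [mul_pow]
  exact h3.trans (by gcongr)

theorem norm_sub_le (h : Fam N s P e) {T : H →L[ℂ] H} (hT : T * e = T)
    (hc : ∀ i ∈ s, T * P i = P i * T) {δ : ℝ} (hδ : 0 ≤ δ) {μ : ι → ℂ}
    (hn : ∀ i ∈ s, ‖(T - μ i • 1) * P i‖ ≤ δ) : ‖T - ∑ i ∈ s, μ i • P i‖ ≤ δ := by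
  classical
  have h1 : ∀ i ∈ s, (∑ j ∈ s, μ j • P j) * P i = μ i • P i := fun i hi => by
    rw [Finset.sum_mul, Finset.sum_eq_single_of_mem i hi, smul_mul_assoc, (h.pr i hi).idem]
    intro j hj hij
    rw [smul_mul_assoc, h.orth j hj i hi hij, smul_zero]
  have h2 : ∀ i ∈ s, P i * (∑ j ∈ s, μ j • P j) = μ i • P i := fun i hi => by
    rw [Finset.mul_sum, Finset.sum_eq_single_of_mem i hi, mul_smul_comm, (h.pr i hi).idem]
    intro j hj hij
    rw [mul_smul_comm, h.orth i hi j hj (Ne.symm hij), smul_zero]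
  refine h.norm_le ?_ (fun i hi => ?_) hδ fun i hi => ?_
  · rw [sub_mul, hT, Finset.sum_mul]
    congr 1
    exact Finset.sum_congr rfl fun i hi => by rw [smul_mul_assoc, h.mul_right hi]
  · rw [sub_mul, mul_sub, h1 i hi, h2 i hi, hc i hi]
  · rw [sub_mul, h1 i hi]
    have := hn i hi
    rwa [sub_mul, smul_mul_assoc, one_mul] at this

end Fam

end Families

section Absorb

variable {H : Type*} [NormedAddCommGroup H] [InnerProductSpace ℂ H] [CompleteSpace H]
variable {N : VonNeumannAlgebra H} {e e' p u v w : H →L[ℂ] H} {ι κ F : Type*}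
  {s : Finset ι} {P q q' : ι → H →L[ℂ] H} {J : Finset κ} {X : κ → H →L[ℂ] H} {a b : κ → ι}
  {x x' : F → H →L[ℂ] H} {lab : F → ι → ℂ} {δ : F → ℝ}

theorem Fam.subset (h : Fam N J X e) {t : Finset κ} (ht : t ⊆ J) : Fam N t X (∑ j ∈ t, X j) :=
  ⟨fun i hi => h.pr i (ht hi), fun i hi j hj => h.orth i (ht hi) j (ht hj), rfl⟩

/-- `u` absorbs the pieces `X j` into the projections `P (a j)`. -/
def St (N : VonNeumannAlgebra H) (s : Finset ι) (P : ι → H →L[ℂ] H) (e : H →L[ℂ] H)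
    (J : Finset κ) (X : κ → H →L[ℂ] H) (a : κ → ι) (e' u : H →L[ℂ] H) : Prop :=
  Via N u (e + e') e ∧ ∀ μ : ι → ℂ, star u * (∑ i ∈ s, μ i • P i) * u =
    ∑ i ∈ s, μ i • P i + ∑ j ∈ J, μ (a j) • X j

theorem St.congr (h : St N s P e J X a e' u) (hab : ∀ j ∈ J, a j = b j) :
    St N s P e J X b e' u := by
  refine ⟨h.1, fun μ => ?_⟩
  rw [h.2]
  congr 1
  exact Finset.sum_congr rfl fun j hj => by rw [hab j hj]

theorem exists_st (hP : Fam N s P e) (hX : Fam N J X e') (h0 : e * e' = 0)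
    (ha : ∀ j ∈ J, a j ∈ s) (hd : ∀ j ∈ J, Dom N (X j) (P (a j))) :
    ∃ u, St N s P e J X a e' u := by
  classical
  let Y : ι → H →L[ℂ] H := fun i => ∑ j ∈ J with a j = i, X j
  have hY : ∀ i, Fam N {j ∈ J | a j = i} X (Y i) := fun i => hX.subset (Finset.filter_subset _ _)
  have hYe : ∀ i, e' * Y i = Y i := fun i => by
    simp only [Y, Finset.mul_sum]
    exact Finset.sum_congr rfl fun j hj => hX.mul_left (Finset.mem_filter.1 hj).1
  have hYd : ∀ i ∈ s, Dom N (Y i) (P i) := fun i hi => (hY i).dom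
    (fun j hj => by
      obtain ⟨h1, h2⟩ := Finset.mem_filter.1 hj
      exact h2 ▸ hd j h1) (hP.pr i hi)
  have hPY : ∀ i ∈ s, ∀ j, P i * Y j = 0 := fun i hi j => by
    rw [← hP.mul_right hi, ← hYe j, mul_assoc, mul_mul_of_eq h0, zero_mul, mul_zero]
  have hYP : ∀ i, ∀ j ∈ s, Y i * P j = 0 := fun i j hj =>
    orth_symm (hP.pr j hj).sa (hY i).isPr.sa (hPY j hj i)
  have hYY : ∀ i j, i ≠ j → Y i * Y j = 0 := fun i j hij => by
    simp only [Y, Finset.sum_mul, Finset.mul_sum]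
    refine Finset.sum_eq_zero fun k hk => Finset.sum_eq_zero fun l hl => ?_
    rw [Finset.mem_filter] at hk hl
    refine hX.orth _ hl.1 _ hk.1 ?_
    rintro rfl
    exact hij (hl.2.symm.trans hk.2)
  have hex : ∀ i, ∃ v, i ∈ s → Via N v (P i + Y i) (P i) := fun i => by
    by_cases hi : i ∈ s
    · obtain ⟨v, hv⟩ := (hYd i hi).absorb (hPY i hi i)
      exact ⟨v, fun _ => hv⟩
    · exact ⟨0, fun h => absurd h hi⟩
  choose v hv using hex
  have hsumY : ∀ μ : ι → ℂ, ∑ i ∈ s, μ i • Y i = ∑ j ∈ J, μ (a j) • X j := fun μ => by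
    rw [← Finset.sum_fiberwise_of_maps_to ha]
    refine Finset.sum_congr rfl fun i _ => ?_
    simp only [Y, Finset.smul_sum]
    exact Finset.sum_congr rfl fun j hj => by rw [(Finset.mem_filter.1 hj).2]
  have hsum1 : ∑ i ∈ s, Y i = e' := by
    have := hsumY fun _ => 1
    simpa only [one_smul, hX.sum] using this
  have hvia := Via.sum (N := N) s hv (fun i hi j hj hij => by
    rw [add_mul, mul_add, mul_add, hP.orth i hi j hj hij, hPY i hi, hYP i j hj, hYY i j hij]
    simp) hP.orth
  rw [Finset.sum_add_distrib, hP.sum, hsum1] at hvia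
  refine ⟨∑ i ∈ s, v i, hvia, fun μ => ?_⟩
  have h1 : (∑ i ∈ s, μ i • P i) * ∑ i ∈ s, v i = ∑ i ∈ s, μ i • v i := by
    rw [Finset.mul_sum]
    refine Finset.sum_congr rfl fun k hk => ?_
    rw [Finset.sum_mul, Finset.sum_eq_single_of_mem k hk, smul_mul_assoc, (hv k hk).fin_mul]
    intro j hj hjk
    rw [smul_mul_assoc, ← (hv k hk).fin_mul, ← mul_assoc, hP.orth j hj k hk hjk, zero_mul,
      smul_zero]
  have h2 : ∀ k ∈ s, star (∑ i ∈ s, v i) * v k = P k + Y k := fun k hk => by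
    rw [star_sum, Finset.sum_mul, Finset.sum_eq_single_of_mem k hk, (hv k hk).init]
    exact fun j hj hjk => (hv j hj).orth_fin (hv k hk) (hP.orth j hj k hk hjk)
  rw [mul_assoc, h1, Finset.mul_sum, ← hsumY, ← Finset.sum_add_distrib]
  exact Finset.sum_congr rfl fun k hk => by rw [mul_smul_comm, h2 k hk, smul_add]

theorem norm_sub_smul_mul_le {T : H →L[ℂ] H} {c d : ℂ} {r r' : ℝ} (hp : IsPr N p)
    (h : ‖(T - c • 1) * p‖ ≤ r) (h' : ‖c - d‖ ≤ r') : ‖(T - d • 1) * p‖ ≤ r + r' := by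
  have h1 : (T - d • 1) * p = (T - c • 1) * p + (c - d) • p := by
    simp only [sub_mul, smul_mul_assoc, one_mul, sub_smul]
    abel
  rw [h1]
  refine (norm_add_le _ _).trans (add_le_add h ?_)
  rw [norm_smul]
  have := (Via.refl hp).norm_le_one
  calc ‖c - d‖ * ‖p‖ ≤ ‖c - d‖ * 1 := by gcongr
    _ ≤ r' := by rwa [mul_one]

theorem norm_sub_le_of_ne_zero {T : H →L[ℂ] H} {c d : ℂ} {r r' : ℝ} (hp : IsPr N p) (hp0 : p ≠ 0)
    (h : ‖(T - c • 1) * p‖ ≤ r) (h' : ‖(T - d • 1) * p‖ ≤ r') : ‖c - d‖ ≤ r + r' := by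
  have h1 : (c - d) • p = (T - d • 1) * p - (T - c • 1) * p := by
    simp only [sub_mul, smul_mul_assoc, one_mul, sub_smul]
    abel
  have h2 : ‖(c - d) • p‖ ≤ r + r' := by
    rw [h1, add_comm]
    exact (norm_sub_le _ _).trans (add_le_add h' h)
  have h3 : ‖p‖ = 1 := by
    have : ‖star p * p‖ = ‖p‖ * ‖p‖ := CStarRing.norm_star_mul_self
    rw [hp.sa, hp.idem] at this
    have h4 : ‖p‖ ≠ 0 := norm_ne_zero_iff.2 hp0
    exact (mul_left_cancel₀ h4 (by rw [mul_one, ← this])).symm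
  rwa [norm_smul, h3, mul_one] at h2

/-- The family `x` is supported by `e`, commutes with the orthogonal family `P` of sum `e`, and is
within `δ` of the scalar `lab f i` on `P i`. -/
structure Near (N : VonNeumannAlgebra H) (s : Finset ι) (P : ι → H →L[ℂ] H) (e : H →L[ℂ] H)
    (x : F → H →L[ℂ] H) (lab : F → ι → ℂ) (δ : F → ℝ) : Prop extends Fam N s P e where
  supp : ∀ f, x f * e = x f
  comm : ∀ f, ∀ i ∈ s, x f * P i = P i * x f
  near : ∀ f, ∀ i ∈ s, ‖(x f - lab f i • 1) * P i‖ ≤ δ f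

theorem Near.norm_sub_le (h : Near N s P e x lab δ) (hδ : ∀ f, 0 ≤ δ f) (f : F) :
    ‖x f - ∑ i ∈ s, lab f i • P i‖ ≤ δ f :=
  h.toFam.norm_sub_le (h.supp f) (h.comm f) (hδ f) (h.near f)

theorem Near.change {lab' : F → ι → ℂ} {δ' : F → ℝ} (h : Near N s P e x lab δ)
    (hl : ∀ f, ∀ i ∈ s, ‖lab f i - lab' f i‖ ≤ δ' f) :
    Near N s P e x lab' fun f => δ f + δ' f :=
  ⟨h.toFam, h.supp, h.comm, fun f i hi =>
    norm_sub_smul_mul_le (h.pr i hi) (h.near f i hi) (hl f i hi)⟩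

theorem Fam.sum_mul_self (h : Fam N s P e) (μ : ι → ℂ) :
    e * (∑ i ∈ s, μ i • P i) = ∑ i ∈ s, μ i • P i ∧
      (∑ i ∈ s, μ i • P i) * e = ∑ i ∈ s, μ i • P i := by
  rw [Finset.mul_sum, Finset.sum_mul]
  exact ⟨Finset.sum_congr rfl fun i hi => by rw [mul_smul_comm, h.mul_left hi],
    Finset.sum_congr rfl fun i hi => by rw [smul_mul_assoc, h.mul_right hi]⟩

theorem St.joinedIn_of_label (hP : Near N s P e x lab δ)
    (hX : Near N J X e' x' (fun f j => lab f (a j)) δ) (hδ : ∀ f, 0 ≤ δ f)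
    (ha : ∀ j ∈ J, a j ∈ s) {μ : F → ι → ℂ}
    (hμ : ∀ f, ∀ i ∈ s, ‖lab f i - μ f i‖ ≤ 2 * δ f)
    (hab : ∀ f, ∑ j ∈ J, μ f (a j) • X j = ∑ j ∈ J, μ f (b j) • X j)
    (hu : St N s P e J X a e' u) (hv : St N s P e J X b e' v) :
    JoinedIn (Adm N e x (e + e') (fun f => x f + x' f) fun f => 9 * δ f) u v := by
  have h1 := (hP.change hμ).norm_sub_le fun f => by linarith [hδ f]
  have h2 := (hX.change (lab' := fun f j => μ f (a j)) fun f j hj =>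
    hμ f (a j) (ha j hj)).norm_sub_le fun f => by linarith [hδ f]
  have h3 := joinedIn_adm (y := fun f => x f + x' f)
    (δ' := fun f => (δ f + 2 * δ f) + (δ f + 2 * δ f)) hu.1 hv.1
    (fun f => (hP.toFam.sum_mul_self (μ f)).1) (fun f => (hP.toFam.sum_mul_self (μ f)).2)
    (fun f => by rw [hu.2, hv.2, hab]) h1 (fun f => by
      rw [hu.2, add_sub_add_comm]
      refine (norm_add_le _ _).trans (add_le_add ?_ ?_)
      · rw [norm_sub_rev]
        exact h1 f
      · rw [norm_sub_rev]
        exact h2 f)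
  have h4 : (fun f => 9 * δ f) =
      fun f => (δ f + 2 * δ f) + ((δ f + 2 * δ f) + (δ f + 2 * δ f)) := by
    funext f
    ring
  rwa [h4]

theorem St.joinedIn (hP : Near N s P e x lab δ)
    (hXa : Near N J X e' x' (fun f j => lab f (a j)) δ)
    (hXb : Near N J X e' x' (fun f j => lab f (b j)) δ) (hδ : ∀ f, 0 ≤ δ f) (h0 : e * e' = 0)
    (ha : ∀ j ∈ J, a j ∈ s) (hb : ∀ j ∈ J, b j ∈ s) (hda : ∀ j ∈ J, Dom N (X j) (P (a j)))
    (hdb : ∀ j ∈ J, Dom N (X j) (P (b j)))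
    (hu : St N s P e J X a e' u) (hv : St N s P e J X b e' v) :
    JoinedIn (Adm N e x (e + e') (fun f => x f + x' f) fun f => 9 * δ f) u v := by
  classical
  let c : Finset κ → κ → ι := fun B j => if j ∈ B then b j else a j
  have hc : ∀ (B) (Q : κ → ι → Prop), (∀ j ∈ J, Q j (a j)) → (∀ j ∈ J, Q j (b j)) →
      ∀ j ∈ J, Q j (c B j) := by
    intro B Q h1 h2 j hj
    simp only [c]
    split_ifs
    exacts [h2 j hj, h1 j hj]
  have hXc : ∀ B, Near N J X e' x' (fun f j => lab f (c B j)) δ := fun B =>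
    ⟨hXa.toFam, hXa.supp, hXa.comm, fun f =>
      hc B (fun j i => ‖(x' f - lab f i • 1) * X j‖ ≤ δ f) (hXa.near f) (hXb.near f)⟩
  have hcs : ∀ B, ∀ j ∈ J, c B j ∈ s := fun B => hc B (fun _ i => i ∈ s) ha hb
  have key : ∀ B ⊆ J, ∀ v, St N s P e J X (c B) e' v →
      JoinedIn (Adm N e x (e + e') (fun f => x f + x' f) fun f => 9 * δ f) u v := by
    intro B
    induction B using Finset.induction_on with
    | empty =>
      intro _ v hv
      refine St.joinedIn_of_label (μ := lab) hP hXa hδ ha (fun f i _ => ?_) (fun f => ?_) hu hv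
      · rw [sub_self, norm_zero]
        linarith [hδ f]
      · simp [c]
    | insert j₀ B hj₀ ih =>
      intro hB v hv
      obtain ⟨w, hw⟩ := exists_st hP.toFam hXa.toFam h0 (hcs B)
        (hc B (fun j i => Dom N (X j) (P i)) hda hdb)
      have hjJ : j₀ ∈ J := hB (Finset.mem_insert_self _ _)
      refine (ih (fun i hi => hB (Finset.mem_insert_of_mem hi)) w hw).trans ?_
      have hne : ∀ j, j ≠ j₀ → c (insert j₀ B) j = c B j := fun j hj => by
        simp [c, Finset.mem_insert, hj]
      by_cases hX0 : X j₀ = 0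
      · refine St.joinedIn_of_label (μ := lab) hP (hXc B) hδ (hcs B) (fun f i _ => ?_)
          (fun f => ?_) hw hv
        · rw [sub_self, norm_zero]
          linarith [hδ f]
        · refine Finset.sum_congr rfl fun j _ => ?_
          by_cases hj : j = j₀
          · rw [hj, hX0, smul_zero, smul_zero]
          · rw [hne j hj]
      · have hl : ∀ f, ‖lab f (b j₀) - lab f (a j₀)‖ ≤ 2 * δ f := fun f => by
          rw [two_mul]
          exact norm_sub_le_of_ne_zero (hXa.pr j₀ hjJ) hX0 (hXb.near f j₀ hjJ)
            (hXa.near f j₀ hjJ)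
        have hcB : c B j₀ = a j₀ := by simp [c, hj₀]
        have hcI : c (insert j₀ B) j₀ = b j₀ := by simp [c]
        refine St.joinedIn_of_label
          (μ := fun f => Function.update (lab f) (b j₀) (lab f (a j₀))) hP (hXc B) hδ (hcs B)
          (fun f i _ => ?_) (fun f => ?_) hw hv
        · by_cases hi : i = b j₀
          · rw [hi, Function.update_self]
            exact hl f
          · rw [Function.update_of_ne hi, sub_self, norm_zero]
            linarith [hδ f]
        · refine Finset.sum_congr rfl fun j _ => ?_
          by_cases hj : j = j₀
          · rw [hj, hcB, hcI, Function.update_self]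
            by_cases hab : a j₀ = b j₀
            · rw [hab, Function.update_self]
            · rw [Function.update_of_ne hab]
          · rw [hne j hj]
  refine key J subset_rfl v (hv.congr fun j hj => ?_)
  simp [c, hj]

theorem St.joinedIn_of_commute (hP : Near N s P e x lab δ) (hq : Near N s q e' x' lab δ)
    (hq' : Near N s q' e' x' lab δ) (hδ : ∀ f, 0 ≤ δ f) (h0 : e * e' = 0)
    (hd : ∀ i ∈ s, Dom N (q i) (P i)) (hd' : ∀ i ∈ s, Dom N (q' i) (P i))
    (hqq : ∀ i ∈ s, ∀ j ∈ s, q i * q' j = q' j * q i)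
    (hu : St N s P e s q id e' u) (hv : St N s P e s q' id e' v) :
    JoinedIn (Adm N e x (e + e') (fun f => x f + x' f) fun f => 9 * δ f) u v := by
  classical
  let X : ι × ι → H →L[ℂ] H := fun j => q j.1 * q' j.2
  have hX : ∀ j ∈ s ×ˢ s, IsPr N (X j) := fun j hj => by
    rw [Finset.mem_product] at hj
    exact (hq.pr _ hj.1).mul (hq'.pr _ hj.2) (hqq _ hj.1 _ hj.2)
  have hX1 : ∀ j ∈ s ×ˢ s, X j * q j.1 = X j := fun j hj => by
    rw [Finset.mem_product] at hj
    simp only [X]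
    rw [mul_assoc, ← hqq _ hj.1 _ hj.2, ← mul_assoc, (hq.pr _ hj.1).idem]
  have hX2 : ∀ j ∈ s ×ˢ s, X j * q' j.2 = X j := fun j hj => by
    rw [Finset.mem_product] at hj
    simp only [X]
    rw [mul_assoc, (hq'.pr _ hj.2).idem]
  have hs1 : ∀ μ : ι → ℂ, ∑ j ∈ s ×ˢ s, μ j.1 • X j = ∑ i ∈ s, μ i • q i := fun μ => by
    rw [Finset.sum_product]
    refine Finset.sum_congr rfl fun i hi => ?_
    simp only [X]
    rw [← Finset.smul_sum, ← Finset.mul_sum, hq'.sum, hq.toFam.mul_right hi]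
  have hs2 : ∀ μ : ι → ℂ, ∑ j ∈ s ×ˢ s, μ j.2 • X j = ∑ i ∈ s, μ i • q' i := fun μ => by
    rw [Finset.sum_product_right]
    refine Finset.sum_congr rfl fun i hi => ?_
    simp only [X]
    rw [← Finset.smul_sum, ← Finset.sum_mul, hq.sum, hq'.toFam.mul_left hi]
  have hFam : Fam N (s ×ˢ s) X e' := by
    refine ⟨hX, fun i hi j hj hij => ?_, ?_⟩
    · by_cases h1 : i.1 = j.1
      · have h2 : i.2 ≠ j.2 := fun h2 => hij (Prod.ext h1 h2)
        rw [← hX2 i hi]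
        rw [Finset.mem_product] at hi hj
        simp only [X]
        rw [hqq _ hj.1 _ hj.2, mul_assoc, mul_mul_of_eq (hq'.orth _ hi.2 _ hj.2 h2), zero_mul,
          mul_zero]
      · rw [← hX1 i hi]
        rw [Finset.mem_product] at hi hj
        simp only [X]
        rw [mul_assoc, mul_mul_of_eq (hq.orth _ hi.1 _ hj.1 h1), zero_mul, mul_zero]
    · have := hs1 fun _ => 1
      simpa only [one_smul, hq.sum] using this
  have hcomm : ∀ f, ∀ j ∈ s ×ˢ s, x' f * X j = X j * x' f := fun f j hj => by
    rw [Finset.mem_product] at hj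
    simp only [X]
    rw [← mul_assoc, hq.comm f _ hj.1, mul_assoc, hq'.comm f _ hj.2, mul_assoc]
  have hle : ∀ {T r : H →L[ℂ] H} {j} {c : ℝ}, j ∈ s ×ˢ s → X j * r = X j → IsPr N r →
      ‖T * r‖ ≤ c → ‖T * X j‖ ≤ c := by
    intro T r j c hj hr hrp hT
    have h1 : T * X j = T * r * X j := by
      rw [mul_assoc, le_symm (hX j hj).sa hrp.sa hr]
    rw [h1]
    have h2 := (Via.refl (hX j hj)).norm_le_one
    calc ‖T * r * X j‖ ≤ ‖T * r‖ * ‖X j‖ := norm_mul_le _ _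
      _ ≤ ‖T * r‖ * 1 := by gcongr
      _ ≤ c := by rwa [mul_one]
  have hdle : ∀ {r y : H →L[ℂ] H} {j}, j ∈ s ×ˢ s → X j * r = X j → Dom N r y →
      Dom N (X j) y := fun hj hr hd => hd.left_sub (Sub.of_le (hX _ hj) hd.left hr)
  refine St.joinedIn (J := s ×ˢ s) (X := X) (a := Prod.fst) (b := Prod.snd) hP
    ⟨hFam, hq.supp, hcomm, fun f j hj => ?_⟩ ⟨hFam, hq.supp, hcomm, fun f j hj => ?_⟩ hδ h0
    (fun j hj => (Finset.mem_product.1 hj).1) (fun j hj => (Finset.mem_product.1 hj).2)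
    (fun j hj => ?_) (fun j hj => ?_) ⟨hu.1, fun μ => ?_⟩ ⟨hv.1, fun μ => ?_⟩
  · exact hle hj (hX1 j hj) (hq.pr _ (Finset.mem_product.1 hj).1)
      (hq.near f _ (Finset.mem_product.1 hj).1)
  · exact hle hj (hX2 j hj) (hq'.pr _ (Finset.mem_product.1 hj).2)
      (hq'.near f _ (Finset.mem_product.1 hj).2)
  · exact hdle hj (hX1 j hj) (hd _ (Finset.mem_product.1 hj).1)
  · exact hdle hj (hX2 j hj) (hd' _ (Finset.mem_product.1 hj).2)
  · rw [hu.2, hs1]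
    rfl
  · rw [hv.2, hs2]
    rfl

end Absorb

section Systems

variable {H : Type*} [NormedAddCommGroup H] [InnerProductSpace ℂ H] [CompleteSpace H]
variable {N : VonNeumannAlgebra H} {Y : Type*} [TopologicalSpace Y]

/-- A family `x` of operators indexed by `C(Y, ℂ)` together with its spectral projections `R U` for
open sets `U`. -/
structure Sys (N : VonNeumannAlgebra H) (R : Opens Y → H →L[ℂ] H) (x : C(Y, ℂ) → H →L[ℂ] H) :
    Prop where
  isPr : ∀ U, IsPr N (R U)
  inf : ∀ U V, R (U ⊓ V) = R U * R V
  sup : ∀ U V, R (U ⊔ V) = R U + R V - R U * R V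
  bot : R ⊥ = 0
  mem : ∀ f, x f ∈ N
  comm : ∀ f U, x f * R U = R U * x f
  top : ∀ f, x f * R ⊤ = x f
  near : ∀ f U (c : ℂ) (ε : ℝ), 0 ≤ ε → (∀ y ∈ U, ‖f y - c‖ ≤ ε) → ‖(x f - c • 1) * R U‖ ≤ ε

variable {R R' : Opens Y → H →L[ℂ] H} {x x' : C(Y, ℂ) → H →L[ℂ] H} {W : ℕ → Opens Y} {k : ℕ}
  {S S' : Finset ℕ}

namespace Sys

theorem commute (h : Sys N R x) (U V : Opens Y) : R U * R V = R V * R U := by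
  rw [← h.inf, ← h.inf, inf_comm]

theorem mul_of_le (h : Sys N R x) {U V : Opens Y} (hUV : U ≤ V) : R U * R V = R U := by
  rw [← h.inf, inf_eq_left.2 hUV]

theorem mul_of_le' (h : Sys N R x) {U V : Opens Y} (hUV : U ≤ V) : R V * R U = R U := by
  rw [← h.inf, inf_eq_right.2 hUV]

theorem top_mul (h : Sys N R x) (f : C(Y, ℂ)) : R ⊤ * x f = x f := by
  rw [← h.comm, h.top]

theorem top_mul_top (h : Sys N R x) (f : C(Y, ℂ)) : R ⊤ * x f * R ⊤ = x f := by
  rw [h.top_mul, h.top]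

theorem cut (h : Sys N R x) {G : H →L[ℂ] H} (hG : IsPr N G) (hR : ∀ U, R U * G = G * R U)
    (hx : ∀ f, x f * G = G * x f) : Sys N (fun U => R U * G) fun f => x f * G := by
  have hGG := fun T => mul_mul_of_eq hG.idem T
  have hRG : ∀ U T, G * (R U * T) = R U * (G * T) := fun U T => by
    rw [← mul_assoc, ← hR, mul_assoc]
  refine ⟨fun U => (h.isPr U).mul hG (hR U), fun U V => ?_, fun U V => ?_, by rw [h.bot, zero_mul],
    fun f => mul_mem (h.mem f) hG.mem, fun f U => ?_, fun f => ?_, fun f U c ε hε hf => ?_⟩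
  · rw [h.inf, hR V]
    simp only [mul_assoc, hGG, hR V]
  · rw [h.sup, hR V]
    simp only [sub_mul, add_mul, mul_assoc, hGG, hR V]
  · simp only [mul_assoc, hRG, hG.idem]
    rw [hx, hGG, ← hx, mul_mul_of_eq (h.comm f U), mul_assoc]
  · rw [mul_assoc, hRG, hG.idem, ← mul_assoc, h.top]
  · have h1 : (x f * G - c • 1) * (R U * G) = (x f - c • 1) * R U * G := by
      simp only [sub_mul, smul_mul_assoc, one_mul, mul_assoc, hRG, hG.idem]
    rw [h1]
    refine (norm_mul_le _ _).trans ?_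
    have h2 := (Via.refl hG).norm_le_one
    have h3 := h.near f U c ε hε hf
    nlinarith [norm_nonneg ((x f - c • 1) * R U), norm_nonneg G]

theorem via (h : Sys N R x) {v e p : H →L[ℂ] H} (hv : Via N v e p) (he : R ⊤ * e = R ⊤) :
    Sys N (fun U => v * R U * star v) fun f => v * x f * star v := by
  have hi := fun T => mul_mul_of_eq hv.init T
  have heR : ∀ U, e * R U = R U := fun U => by
    rw [← h.mul_of_le' (le_top : U ≤ ⊤), ← mul_assoc,
      le_symm (h.isPr ⊤).sa hv.left.sa he]
  have hRe : ∀ U, R U * e = R U := fun U => by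
    rw [← h.mul_of_le (le_top : U ≤ ⊤), mul_assoc, he]
  have hex : ∀ f, e * x f = x f := fun f => by
    rw [← h.top_mul, ← mul_assoc, heR]
  have heR' := fun U T => mul_mul_of_eq (heR U) T
  have hex' := fun f T => mul_mul_of_eq (hex f) T
  refine ⟨fun U => ⟨mul_mem (mul_mem hv.mem (h.isPr U).mem) (star_mem hv.mem), ?_, ?_⟩,
    fun U V => ?_, fun U V => ?_, by rw [h.bot, mul_zero, zero_mul],
    fun f => mul_mem (mul_mem hv.mem (h.mem f)) (star_mem hv.mem), fun f U => ?_, fun f => ?_,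
    fun f U c ε hε hf => ?_⟩
  · simp only [mul_assoc, hi, heR', mul_mul_of_eq (h.isPr U).idem]
  · simp only [star_mul, star_star, (h.isPr U).sa, mul_assoc]
  · simp only [mul_assoc, hi, heR', h.inf]
  · simp only [mul_assoc, hi, heR', h.sup, mul_add, add_mul, mul_sub, sub_mul]
  · simp only [mul_assoc, hi, heR', hex']
    rw [mul_mul_of_eq (h.comm f U), mul_assoc]
  · simp only [mul_assoc, hi, heR', hex']
    rw [mul_mul_of_eq (h.top f)]
  · have h1 : (v * x f * star v - c • 1) * (v * R U * star v)
        = v * ((x f - c • 1) * R U) * star v := by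
      simp only [sub_mul, mul_sub, smul_mul_assoc, mul_smul_comm, one_mul, mul_assoc, hi, heR']
    rw [h1]
    have := hv.symm.norm_conj_le ((x f - c • 1) * R U)
    rw [star_star] at this
    exact this.trans (h.near f U c ε hε hf)

end Sys

/-- The spectral projection of the set of points `y` such that `y ∈ W i ↔ i ∈ S` for all `i < k`. -/
noncomputable def cell (R : Opens Y → H →L[ℂ] H) (W : ℕ → Opens Y) : ℕ → Finset ℕ → H →L[ℂ] H
  | 0, _ => R ⊤
  | k + 1, S => cell R W k S * if k ∈ S then R (W k) else 1 - R (W k)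

theorem cell_congr (h : ∀ i < k, (i ∈ S ↔ i ∈ S')) : cell R W k S = cell R W k S' := by
  induction k with
  | zero => rfl
  | succ k ih =>
    rw [cell, cell, ih fun i hi => h i (hi.trans (Nat.lt_succ_self k))]
    simp only [h k (Nat.lt_succ_self k)]

theorem exists_cell_eq (W : ℕ → Opens Y) (k : ℕ) (S : Finset ℕ) :
    ∃ U V : Opens Y, (∀ y, (y ∈ U ∧ y ∉ V) ↔ ∀ i < k, (i ∈ S ↔ y ∈ W i)) ∧
      ∀ (R : Opens Y → H →L[ℂ] H) (x : C(Y, ℂ) → H →L[ℂ] H), Sys N R x →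
        cell R W k S = R U - R (U ⊓ V) := by
  induction k with
  | zero =>
    refine ⟨⊤, ⊥, fun y => by simp, fun R x h => ?_⟩
    rw [inf_bot_eq, h.bot, sub_zero, cell]
  | succ k ih =>
    obtain ⟨U, V, hUV, hR⟩ := ih
    by_cases hk : k ∈ S
    · refine ⟨U ⊓ W k, V, fun y => ?_, fun R x h => ?_⟩
      · rw [Nat.forall_lt_succ_right, ← hUV y]
        simp only [hk, true_iff, Opens.mem_inf]
        tauto
      · rw [cell, hR R x h, if_pos hk, inf_right_comm]
        simp only [h.inf, sub_mul]
    · refine ⟨U, V ⊔ W k, fun y => ?_, fun R x h => ?_⟩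
      · rw [Nat.forall_lt_succ_right, ← hUV y]
        simp only [hk, false_iff, Opens.mem_sup]
        tauto
      · have h1 := fun T => mul_mul_of_eq (h.isPr U).idem T
        have h2 := fun T => mul_mul_of_eq (h.commute V U) T
        rw [cell, hR R x h, if_neg hk, inf_sup_left, h.sup]
        simp only [h.inf, sub_mul, mul_sub, mul_one, mul_assoc, h2, h1]
        abel

namespace Sys

theorem cell_isPr (h : Sys N R x) : IsPr N (cell R W k S) := by
  obtain ⟨U, V, -, hR⟩ := exists_cell_eq (H := H) (N := N) W k S
  rw [hR R x h]
  exact (h.isPr U).sub (h.isPr _) (h.mul_of_le inf_le_left)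

theorem cell_eq_zero (h : Sys N R x) (he : ¬ ∃ y, ∀ i < k, (i ∈ S ↔ y ∈ W i)) :
    cell R W k S = 0 := by
  obtain ⟨U, V, hUV, hR⟩ := exists_cell_eq (H := H) (N := N) W k S
  have : U ≤ V := fun y hy => by
    by_contra hyV
    exact he ⟨y, (hUV y).1 ⟨hy, hyV⟩⟩
  rw [hR R x h, inf_eq_left.2 this, sub_self]

end Sys

theorem cell_commute {c : H →L[ℂ] H} (hc : ∀ U, c * R U = R U * c) :
    c * cell R W k S = cell R W k S * c := by
  induction k with
  | zero => exact hc _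
  | succ k ih =>
    rw [cell, ← mul_assoc, ih, mul_assoc, mul_assoc]
    split_ifs
    · rw [hc]
    · rw [mul_sub, sub_mul, hc, one_mul, mul_one]

namespace Sys

theorem cell_mul_of_mem (h : Sys N R x) {i : ℕ} (hik : i < k) (hi : i ∈ S) :
    cell R W k S * R (W i) = cell R W k S := by
  induction k with
  | zero => omega
  | succ k ih =>
    rw [cell, mul_assoc]
    rcases Nat.lt_succ_iff_lt_or_eq.1 hik with hlt | rfl
    · have : (if k ∈ S then R (W k) else 1 - R (W k)) * R (W i)
        = R (W i) * (if k ∈ S then R (W k) else 1 - R (W k)) := by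
        split_ifs
        · exact h.commute _ _
        · rw [sub_mul, mul_sub, h.commute, one_mul, mul_one]
      rw [this, ← mul_assoc, ih hlt]
    · rw [if_pos hi, (h.isPr _).idem]

theorem cell_mul_of_notMem (h : Sys N R x) {i : ℕ} (hik : i < k) (hi : i ∉ S) :
    cell R W k S * R (W i) = 0 := by
  induction k with
  | zero => omega
  | succ k ih =>
    rw [cell, mul_assoc]
    rcases Nat.lt_succ_iff_lt_or_eq.1 hik with hlt | rfl
    · have : (if k ∈ S then R (W k) else 1 - R (W k)) * R (W i)
        = R (W i) * (if k ∈ S then R (W k) else 1 - R (W k)) := by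
        split_ifs
        · exact h.commute _ _
        · rw [sub_mul, mul_sub, h.commute, one_mul, mul_one]
      rw [this, ← mul_assoc, ih hlt, zero_mul]
    · rw [if_neg hi, sub_mul, one_mul, (h.isPr _).idem, sub_self, mul_zero]

theorem cell_orth (h : Sys N R x) (hS : S ⊆ Finset.range k) (hS' : S' ⊆ Finset.range k)
    (hne : S ≠ S') : cell R W k S * cell R W k S' = 0 := by
  have hcc : cell R W k S * cell R W k S' = cell R W k S' * cell R W k S :=
    cell_commute fun U => (cell_commute fun V => h.commute U V).symm
  have key : ∀ {A B : Finset ℕ}, A ⊆ Finset.range k → ∀ i ∈ A, i ∉ B →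
      cell R W k B * cell R W k A = 0 := by
    intro A B hA i hi hiB
    have hik := Finset.mem_range.1 (hA hi)
    have h1 := h.cell_mul_of_mem (W := W) hik hi
    have h2 := le_symm h.cell_isPr.sa (h.isPr _).sa h1
    rw [← h2, ← mul_assoc, h.cell_mul_of_notMem hik hiB, zero_mul]
  by_cases hsub : S ⊆ S'
  · have : ¬ S' ⊆ S := fun h' => hne (hsub.antisymm h')
    obtain ⟨i, hi, hi'⟩ := Finset.not_subset.1 this
    exact key hS' i hi hi'
  · obtain ⟨i, hi, hi'⟩ := Finset.not_subset.1 hsub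
    rw [hcc]
    exact key hS i hi hi'

end Sys

theorem cell_succ_add (k : ℕ) (S : Finset ℕ) (hS : k ∉ S) :
    cell R W (k + 1) S + cell R W (k + 1) (insert k S) = cell R W k S := by
  have h1 : cell R W k (insert k S) = cell R W k S :=
    cell_congr fun i hi => by simp [hi.ne]
  rw [cell, cell, if_neg hS, if_pos (Finset.mem_insert_self _ _), h1, ← mul_add, sub_add_cancel,
    mul_one]

theorem sum_cell : ∑ S ∈ (Finset.range k).powerset, cell R W k S = R ⊤ := by
  induction k with
  | zero => simp [cell]
  | succ k ih =>
    rw [Finset.range_add_one, Finset.sum_powerset_insert Finset.notMem_range_self,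
      ← Finset.sum_add_distrib, ← ih]
    refine Finset.sum_congr rfl fun S hS => cell_succ_add k S fun hk => ?_
    exact Finset.notMem_range_self (Finset.mem_powerset.1 hS hk)

theorem Sys.fam_cell (h : Sys N R x) :
    Fam N (Finset.range k).powerset (cell R W k) (R ⊤) :=
  ⟨fun _ _ => h.cell_isPr, fun _ hS _ hS' hne =>
    h.cell_orth (Finset.mem_powerset.1 hS) (Finset.mem_powerset.1 hS') hne, sum_cell⟩

open scoped Classical in
/-- The value of `f` at some point of a cell. -/
noncomputable def cellVal (W : ℕ → Opens Y) (k : ℕ) (f : C(Y, ℂ)) (S : Finset ℕ) : ℂ :=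
  if h : ∃ y, ∀ i < k, (i ∈ S ↔ y ∈ W i) then f h.choose else 0

/-- Every point lies in one of the first `k + 1` sets, on which each `f` varies by at most
`δ k f`. -/
structure Fine (W : ℕ → Opens Y) (δ : ℕ → C(Y, ℂ) → ℝ) : Prop where
  exists_mem : ∀ k y, ∃ i < k + 1, y ∈ W i ∧ ∀ f, ∀ y' ∈ W i, ∀ y'' ∈ W i, ‖f y' - f y''‖ ≤ δ k f
  nonneg : ∀ k f, 0 ≤ δ k f
  tendsto : ∀ f, Tendsto (fun k => δ k f) atTop (𝓝 0)
  top : W 0 = ⊤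

theorem Sys.near_cell {δ : ℕ → C(Y, ℂ) → ℝ} (h : Sys N R x) (hW : Fine W δ) (k : ℕ) :
    Near N (Finset.range (k + 1)).powerset (cell R W (k + 1)) (R ⊤) x (cellVal W (k + 1))
      (δ k) := by
  refine ⟨h.fam_cell, h.top, fun f S _ => cell_commute (h.comm f), fun f S _ => ?_⟩
  by_cases he : ∃ y, ∀ i < k + 1, (i ∈ S ↔ y ∈ W i)
  · rw [cellVal, dif_pos he]
    have hy := he.choose_spec
    generalize he.choose = y at hy
    obtain ⟨i, hik, hyi, hf⟩ := hW.exists_mem k y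
    have h1 := le_symm h.cell_isPr.sa (h.isPr _).sa
      (h.cell_mul_of_mem (W := W) hik ((hy i hik).2 hyi))
    have h2 := h.near f (W i) (f y) (δ k f) (hW.nonneg k f) fun y' hy' => hf f y' hy' y hyi
    rw [← h1, ← mul_assoc]
    refine (norm_mul_le _ _).trans ?_
    have h3 := (Via.refl (h.cell_isPr (W := W) (k := k + 1) (S := S))).norm_le_one
    nlinarith [norm_nonneg ((x f - f y • 1) * R (W i)), norm_nonneg (cell R W (k + 1) S)]
  · rw [h.cell_eq_zero he, mul_zero, norm_zero]
    exact hW.nonneg k f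

theorem Sys.conn_of_eqv {δ : ℕ → C(Y, ℂ) → ℝ} (h : Sys N R x) (h' : Sys N R' x') (hW : Fine W δ)
    (hRR : ∀ U V, Eqv N (R U - R (U ⊓ V)) (R' U - R' (U ⊓ V))) :
    Conn N (R ⊤) x (R' ⊤) x' := by
  have hv : ∀ k S, ∃ v, Via N v (cell R' W k S) (cell R W k S) := fun k S => by
    obtain ⟨U, V, -, hc⟩ := exists_cell_eq (H := H) (N := N) W k S
    rw [hc R x h, hc R' x' h']
    exact (hRR U V).symm
  choose v hv using hv
  let w : ℕ → H →L[ℂ] H := fun k => ∑ S ∈ (Finset.range k).powerset, v k S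
  have hw : ∀ k, Via N (w k) (R' ⊤) (R ⊤) := fun k => by
    have := Via.sum (N := N) _ (fun S _ => hv k S) (h'.fam_cell (W := W)).orth
      (h.fam_cell (W := W)).orth
    rwa [sum_cell, sum_cell] at this
  have hconj : ∀ k, ∀ S ∈ (Finset.range k).powerset,
      star (w k) * cell R W k S * w k = cell R' W k S := fun k S hS => by
    have h1 : cell R W k S * w k = v k S := by
      rw [Finset.mul_sum, Finset.sum_eq_single_of_mem S hS, (hv k S).fin_mul]
      intro T hT hne
      rw [← (hv k T).fin_mul, ← mul_assoc, h.fam_cell.orth S hS T hT hne.symm, zero_mul]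
    have h2 : star (cell R W k S * w k) = star (v k S) := by rw [h1]
    rw [star_mul, (h.cell_isPr).sa] at h2
    rw [← (h.cell_isPr).idem, ← mul_assoc, mul_assoc, h1, h2, (hv k S).init]
  have hconj' : ∀ k, ∀ S ∈ (Finset.range k).powerset,
      star (w (k + 1)) * cell R W k S * w (k + 1) = cell R' W k S := fun k S hS => by
    have hS := Finset.mem_powerset.1 hS
    have hkS : k ∉ S := fun hk => Finset.notMem_range_self (hS hk)
    rw [← cell_succ_add k S hkS, ← cell_succ_add k S hkS, mul_add, add_mul, hconj, hconj]
    · rw [Finset.mem_powerset, Finset.range_add_one]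
      exact Finset.insert_subset_insert _ hS
    · rw [Finset.mem_powerset, Finset.range_add_one]
      exact hS.trans (Finset.subset_insert _ _)
  have hsum : ∀ (u : H →L[ℂ] H) k (μ : Finset ℕ → ℂ), (∀ S ∈ (Finset.range k).powerset,
      star u * cell R W k S * u = cell R' W k S) →
      star u * (∑ S ∈ (Finset.range k).powerset, μ S • cell R W k S) * u =
        ∑ S ∈ (Finset.range k).powerset, μ S • cell R' W k S := fun u k μ hu => by
    rw [Finset.mul_sum, Finset.sum_mul]
    refine Finset.sum_congr rfl fun S hS => ?_
    rw [mul_smul_comm, smul_mul_assoc, hu S hS]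
  refine Conn.of_joinedIn (c := fun k f => δ k f + δ k f) (w := fun k => w (k + 1)) (fun f => ?_)
    fun k => ?_
  · simpa using (hW.tendsto f).add (hW.tendsto f)
  have hn := h.near_cell hW k
  have hn' := h'.near_cell hW k
  refine joinedIn_adm (hw _) (hw _)
    (D := fun f => ∑ S ∈ (Finset.range (k + 1)).powerset,
      cellVal W (k + 1) f S • cell R W (k + 1) S)
    (fun f => (hn.toFam.sum_mul_self _).1) (fun f => (hn.toFam.sum_mul_self _).2)
    (fun f => ?_) (hn.norm_sub_le (hW.nonneg k)) fun f => ?_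
  · rw [hsum _ _ _ (hconj _), hsum _ _ _ (hconj' _)]
  · rw [hsum _ _ _ (hconj _), norm_sub_rev]
    exact hn'.norm_sub_le (hW.nonneg k) f

end Systems

section AbsorbSystems

variable {H : Type*} [NormedAddCommGroup H] [InnerProductSpace ℂ H] [CompleteSpace H]
variable {N : VonNeumannAlgebra H} {Y : Type*} [TopologicalSpace Y]
variable {R R' : Opens Y → H →L[ℂ] H} {x x' : C(Y, ℂ) → H →L[ℂ] H} {W : ℕ → Opens Y} {k : ℕ}
  {S S' : Finset ℕ} {δ : ℕ → C(Y, ℂ) → ℝ}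

theorem Fam.norm_mul_sum_le {κ : Type*} {J t : Finset κ} {X : κ → H →L[ℂ] H} {e T : H →L[ℂ] H}
    (h : Fam N J X e) (ht : t ⊆ J) (hc : ∀ j ∈ t, T * X j = X j * T) {d : ℝ} (hd : 0 ≤ d)
    (hn : ∀ j ∈ t, ‖T * X j‖ ≤ d) : ‖T * ∑ j ∈ t, X j‖ ≤ d := by
  have h1 := h.subset ht
  have h2 : ∀ j ∈ t, T * (∑ i ∈ t, X i) * X j = T * X j := fun j hj => by
    rw [mul_assoc, h1.mul_left hj]
  refine h1.norm_le (by rw [mul_assoc, h1.isPr.idem]) (fun j hj => ?_) hd fun j hj => ?_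
  · rw [h2 j hj, ← mul_assoc, ← hc j hj, mul_assoc, h1.mul_right hj]
  · rw [h2 j hj]
    exact hn j hj

theorem cellVal_sub_le (hW : Fine W δ) {y : Y} (hy : ∀ i < k + 1, (i ∈ S ↔ y ∈ W i))
    (f : C(Y, ℂ)) : ‖f y - cellVal W (k + 1) f S‖ ≤ δ k f := by
  have he : ∃ y, ∀ i < k + 1, (i ∈ S ↔ y ∈ W i) := ⟨y, hy⟩
  rw [cellVal, dif_pos he]
  obtain ⟨i, hik, hyi, hf⟩ := hW.exists_mem k y
  exact hf f _ hyi _ ((he.choose_spec i hik).1 ((hy i hik).2 hyi))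

namespace Sys

theorem sum_cell_mem (h : Sys N R x) {i : ℕ} (hi : i < k) :
    ∑ S ∈ (Finset.range k).powerset with i ∈ S, cell R W k S = R (W i) := by
  rw [Finset.sum_filter, ← h.mul_of_le' (le_top : W i ≤ ⊤), ← sum_cell (R := R) (W := W) (k := k),
    Finset.sum_mul]
  refine Finset.sum_congr rfl fun S _ => ?_
  split_ifs with hS
  · exact (h.cell_mul_of_mem hi hS).symm
  · exact (h.cell_mul_of_notMem hi hS).symm

theorem exists_assignment_cell (h : Sys N R x) (h' : Sys N R' x') (hW : Fine W δ)
    (hd : ∀ i, Dom N (R' (W i)) (R (W i))) (k : ℕ) (T : Finset ℕ) :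
    ∃ ξ : Finset ℕ → H →L[ℂ] H, (∀ S, Cen N (ξ S)) ∧ (∀ S S', S ≠ S' → ξ S * ξ S' = 0) ∧
      (∑ S ∈ (Finset.range (k + 1)).powerset, ξ S) * cell R' W (k + 1) T = cell R' W (k + 1) T ∧
      ∀ S ∈ (Finset.range (k + 1)).powerset,
        Dom N (ξ S * cell R' W (k + 1) T) (cell R W (k + 1) S) ∧
        ∀ f, ‖(x' f - cellVal W (k + 1) f S • 1) * (ξ S * cell R' W (k + 1) T)‖ ≤ δ k f := by
  classical
  by_cases hT : ∃ y, ∀ i < k + 1, (i ∈ T ↔ y ∈ W i)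
  swap
  · refine ⟨fun _ => 0, fun _ => Cen.zero, fun _ _ _ => zero_mul _, ?_, fun S _ => ⟨?_, ?_⟩⟩
    · rw [h'.cell_eq_zero hT, mul_zero]
    · rw [zero_mul]
      exact Dom.zero h.cell_isPr
    · intro f
      simpa using hW.nonneg k f
  obtain ⟨y, hy⟩ := hT
  obtain ⟨i, hik, hyi, hf⟩ := hW.exists_mem k y
  have hiT := (hy i hik).2 hyi
  have hQ := h'.cell_mul_of_mem (W := W) hik hiT
  have hQ' := le_symm h'.cell_isPr.sa (h'.isPr _).sa hQ
  obtain ⟨p, hp, hp1, hp2⟩ := hd i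
  rw [← h.sum_cell_mem hik] at hp2
  obtain ⟨ζ, hζ, hζ0, hζs, hζp⟩ := hp.exists_distrib _ (fun _ _ => h.cell_isPr)
    (fun S hS S' hS' => h.fam_cell.orth S (Finset.mem_filter.1 hS).1 S' (Finset.mem_filter.1 hS').1)
    hp2
  have hQp : Sub N (cell R' W (k + 1) T) p := (Sub.of_le h'.cell_isPr (h'.isPr _) hQ).trans hp1
  refine ⟨fun S => if i ∈ S then ζ S else 0, fun S => ?_, fun S S' hne => ?_, ?_,
    fun S hS => ⟨?_, fun f => ?_⟩⟩
  · dsimp only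
    split_ifs
    · exact hζ S
    · exact Cen.zero
  · dsimp only
    split_ifs
    · exact hζ0 S S' hne
    all_goals simp
  · rw [← Finset.sum_filter]
    set Z := ∑ S ∈ (Finset.range (k + 1)).powerset with i ∈ S, ζ S with hZ
    have hZc : Cen N Z := by
      refine ⟨IsPr.sum _ (fun S _ => (hζ S).toIsPr) fun S _ S' _ hne => hζ0 S S' hne, fun A hA => ?_⟩
      rw [hZ, Finset.sum_mul, Finset.mul_sum]
      exact Finset.sum_congr rfl fun S _ => (hζ S).comm A hA
    have h1 := hQp.cut hZc.compl
    rw [sub_mul 1 Z p, hζp, one_mul, sub_self] at h1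
    have h2 := h1.eq_zero
    rw [sub_mul, one_mul, sub_eq_zero] at h2
    exact h2.symm
  · dsimp only
    split_ifs with hiS
    · exact ⟨ζ S * p, hp.cut (hζ S), hQp.cut (hζ S), hζs S (Finset.mem_filter.2 ⟨hS, hiS⟩)⟩
    · rw [zero_mul]
      exact Dom.zero h.cell_isPr
  · dsimp only
    split_ifs with hiS
    swap
    · simpa using hW.nonneg k f
    by_cases hSe : ∃ y, ∀ i < k + 1, (i ∈ S ↔ y ∈ W i)
    swap
    · have h1 : Sub N (ζ S * cell R' W (k + 1) T) (cell R W (k + 1) S) :=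
        (hQp.cut (hζ S)).trans (hζs S (Finset.mem_filter.2 ⟨hS, hiS⟩))
      rw [h.cell_eq_zero hSe] at h1
      rw [h1.eq_zero]
      simpa using hW.nonneg k f
    rw [cellVal, dif_pos hSe]
    have hz := hSe.choose_spec
    generalize hSe.choose = z at hz
    have hzi := (hz i hik).1 hiS
    have h2 := h'.near f (W i) (f z) (δ k f) (hW.nonneg k f) fun y' hy' => hf f y' hy' z hzi
    have hpr : IsPr N (ζ S * cell R' W (k + 1) T) := (hζ S).pr_mul h'.cell_isPr
    have h3 : R' (W i) * (ζ S * cell R' W (k + 1) T) = ζ S * cell R' W (k + 1) T := by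
      rw [← mul_assoc, ← (hζ S).comm _ (h'.isPr _).mem, mul_assoc, hQ']
    rw [← h3, ← mul_assoc]
    refine (norm_mul_le _ _).trans ?_
    have h4 := (Via.refl hpr).norm_le_one
    nlinarith [norm_nonneg ((x' f - f z • 1) * R' (W i)), norm_nonneg (ζ S * cell R' W (k + 1) T)]

theorem exists_assignment (h : Sys N R x) (h' : Sys N R' x') (hW : Fine W δ)
    (hd : ∀ i, Dom N (R' (W i)) (R (W i))) (k : ℕ) :
    ∃ q : Finset ℕ → H →L[ℂ] H,
      Near N (Finset.range (k + 1)).powerset q (R' ⊤) x' (cellVal W (k + 1)) (δ k) ∧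
      (∀ S ∈ (Finset.range (k + 1)).powerset, Dom N (q S) (cell R W (k + 1) S)) ∧
      ∀ c ∈ N, (∀ U, c * R' U = R' U * c) → ∀ S, c * q S = q S * c := by
  choose ξ hξ hξ0 hξs hξd using h.exists_assignment_cell h' hW hd k
  set s := (Finset.range (k + 1)).powerset with hs
  let Q := cell R' W (k + 1)
  have hQ : Fam N s Q (R' ⊤) := h'.fam_cell
  have hprod : ∀ T S T' S', ξ T S * Q T * (ξ T' S' * Q T') = ξ T S * ξ T' S' * (Q T * Q T') :=
    fun T S T' S' => by
      rw [mul_assoc, ← mul_assoc (Q T), ← (hξ T' S').comm (Q T) h'.cell_isPr.mem]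
      simp only [mul_assoc]
  have hX : ∀ S, Fam N s (fun T => ξ T S * Q T) (∑ T ∈ s, ξ T S * Q T) := fun S =>
    ⟨fun T _ => (hξ T S).pr_mul h'.cell_isPr, fun T hT T' hT' hne => by
      rw [hprod, hQ.orth T hT T' hT' hne, mul_zero], rfl⟩
  have hcomm : ∀ c ∈ N, (∀ U, c * R' U = R' U * c) → ∀ T S, c * (ξ T S * Q T) = ξ T S * Q T * c :=
    fun c hc hcR T S => by
      rw [← mul_assoc, ← (hξ T S).comm c hc, mul_assoc, cell_commute hcR, mul_assoc]
  have hcq : ∀ c ∈ N, (∀ U, c * R' U = R' U * c) → ∀ S,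
      c * (∑ T ∈ s, ξ T S * Q T) = (∑ T ∈ s, ξ T S * Q T) * c := fun c hc hcR S => by
    rw [Finset.mul_sum, Finset.sum_mul]
    exact Finset.sum_congr rfl fun T _ => hcomm c hc hcR T S
  refine ⟨fun S => ∑ T ∈ s, ξ T S * Q T, ⟨⟨fun S _ => (hX S).isPr, fun S _ S' _ hne => ?_, ?_⟩,
    h'.top, fun f S _ => hcq _ (h'.mem f) (h'.comm f) S, fun f S hS => ?_⟩, fun S hS => ?_, hcq⟩
  · rw [Finset.sum_mul]
    refine Finset.sum_eq_zero fun T hT => ?_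
    rw [Finset.mul_sum]
    refine Finset.sum_eq_zero fun T' hT' => ?_
    rw [hprod]
    by_cases hTT : T = T'
    · rw [← hTT, hξ0 T S S' hne, zero_mul]
    · rw [hQ.orth T hT T' hT' hTT, mul_zero]
  · rw [Finset.sum_comm, ← hQ.sum]
    refine Finset.sum_congr rfl fun T _ => ?_
    rw [← Finset.sum_mul]
    exact hξs T
  · refine (hX S).norm_mul_sum_le subset_rfl (fun T _ => ?_) (hW.nonneg k f)
      fun T _ => (hξd T S hS).2 f
    rw [sub_mul, mul_sub, hcomm _ (h'.mem f) (h'.comm f), smul_mul_assoc, one_mul, mul_smul_comm,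
      mul_one]
  · exact (hX S).dom (fun T _ => (hξd T S hS).1) h.cell_isPr

end Sys

theorem sum_powerset_range_succ {M : Type*} [AddCommMonoid M] (k : ℕ) (g : Finset ℕ → M) :
    ∑ T ∈ (Finset.range (k + 1)).powerset, g T
      = ∑ S ∈ (Finset.range k).powerset, (g S + g (insert k S)) := by
  rw [Finset.range_add_one, Finset.sum_powerset_insert Finset.notMem_range_self,
    ← Finset.sum_add_distrib]

theorem mem_powerset_range_succ (hS : S ∈ (Finset.range k).powerset) {T : Finset ℕ}
    (hT : T ∈ ({S, insert k S} : Finset (Finset ℕ))) : T ∈ (Finset.range (k + 1)).powerset := by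
  rw [Finset.mem_powerset] at hS ⊢
  rw [Finset.range_add_one]
  rcases Finset.mem_insert.1 hT with rfl | hT
  · exact hS.trans (Finset.subset_insert _ _)
  · rw [Finset.mem_singleton.1 hT]
    exact Finset.insert_subset_insert _ hS

theorem erase_eq_of_mem_pair (hS : S ∈ (Finset.range k).powerset) {T : Finset ℕ}
    (hT : T ∈ ({S, insert k S} : Finset (Finset ℕ))) : T.erase k = S := by
  have hk : k ∉ S := fun hk => Finset.notMem_range_self (Finset.mem_powerset.1 hS hk)
  rcases Finset.mem_insert.1 hT with rfl | hT
  · exact Finset.erase_eq_of_notMem hk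
  · rw [Finset.mem_singleton.1 hT, Finset.erase_insert hk]

theorem sum_pair_insert {M : Type*} [AddCommMonoid M] (g : Finset ℕ → M)
    (hS : S ∈ (Finset.range k).powerset) :
    ∑ T ∈ {S, insert k S}, g T = g S + g (insert k S) := by
  refine Finset.sum_pair fun hS' => ?_
  have hk : k ∉ S := fun hk => Finset.notMem_range_self (Finset.mem_powerset.1 hS hk)
  rw [hS'] at hk
  exact hk (Finset.mem_insert_self _ _)

theorem Fam.coarsen {q : Finset ℕ → H →L[ℂ] H} {e : H →L[ℂ] H}
    (h : Fam N (Finset.range (k + 1)).powerset q e) :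
    Fam N (Finset.range k).powerset (fun S => ∑ T ∈ {S, insert k S}, q T) e := by
  refine ⟨fun S hS => (h.subset fun T => mem_powerset_range_succ hS).isPr,
    fun S hS S' hS' hne => ?_, ?_⟩
  · rw [Finset.sum_mul]
    refine Finset.sum_eq_zero fun T hT => ?_
    rw [Finset.mul_sum]
    refine Finset.sum_eq_zero fun T' hT' => h.orth T (mem_powerset_range_succ hS hT) T'
      (mem_powerset_range_succ hS' hT') ?_
    rintro rfl
    exact hne ((erase_eq_of_mem_pair hS hT).symm.trans (erase_eq_of_mem_pair hS' hT'))
  · rw [← h.sum, sum_powerset_range_succ]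
    exact Finset.sum_congr rfl fun S hS => sum_pair_insert q hS

theorem St.coarsen {P q : Finset ℕ → H →L[ℂ] H} {e e' u : H →L[ℂ] H}
    (h : St N (Finset.range (k + 1)).powerset P e (Finset.range (k + 1)).powerset q id e' u) :
    St N (Finset.range k).powerset (fun S => P S + P (insert k S)) e (Finset.range k).powerset
      (fun S => ∑ T ∈ {S, insert k S}, q T) id e' u := by
  refine ⟨h.1, fun μ => ?_⟩
  have h1 := h.2 fun T => μ (T.erase k)
  have key : ∀ g : Finset ℕ → H →L[ℂ] H,
      ∑ T ∈ (Finset.range (k + 1)).powerset, μ (T.erase k) • g T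
        = ∑ S ∈ (Finset.range k).powerset, μ S • (g S + g (insert k S)) := fun g => by
    rw [sum_powerset_range_succ]
    refine Finset.sum_congr rfl fun S hS => ?_
    rw [erase_eq_of_mem_pair hS (Finset.mem_insert_self _ _), erase_eq_of_mem_pair hS
      (Finset.mem_insert_of_mem (Finset.mem_singleton_self _)), smul_add]
  simp only [id] at h1 ⊢
  rw [key, key] at h1
  rw [h1]
  congr 1
  exact Finset.sum_congr rfl fun S hS => by rw [sum_pair_insert q hS]

theorem Near.mono {ι F : Type*} {s : Finset ι} {P : ι → H →L[ℂ] H} {e : H →L[ℂ] H}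
    {z : F → H →L[ℂ] H} {lab : F → ι → ℂ} {d d' : F → ℝ} (h : Near N s P e z lab d)
    (hd : ∀ f, d f ≤ d' f) : Near N s P e z lab d' :=
  ⟨h.toFam, h.supp, h.comm, fun f i hi => (h.near f i hi).trans (hd f)⟩

theorem Near.coarsen {q : Finset ℕ → H →L[ℂ] H} {e : H →L[ℂ] H} (hW : Fine W δ)
    (h : Near N (Finset.range (k + 2)).powerset q e x (cellVal W (k + 2)) (δ (k + 1)))
    (hx : Sys N R x')
    (hd : ∀ S ∈ (Finset.range (k + 2)).powerset, Dom N (q S) (cell R W (k + 2) S)) :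
    Near N (Finset.range (k + 1)).powerset (fun S => ∑ T ∈ {S, insert (k + 1) S}, q T) e x
      (cellVal W (k + 1)) fun f => δ (k + 1) f + δ k f := by
  refine ⟨h.toFam.coarsen, h.supp, fun f S hS => ?_, fun f S hS => ?_⟩
  · rw [Finset.mul_sum, Finset.sum_mul]
    exact Finset.sum_congr rfl fun T hT => h.comm f T (mem_powerset_range_succ hS hT)
  refine h.toFam.norm_mul_sum_le (fun T => mem_powerset_range_succ hS) (fun T hT => ?_)
    (add_nonneg (hW.nonneg _ _) (hW.nonneg _ _)) fun T hT => ?_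
  · rw [sub_mul, mul_sub, h.comm f T (mem_powerset_range_succ hS hT), smul_mul_assoc, one_mul,
      mul_smul_comm, mul_one]
  have hT' := mem_powerset_range_succ hS hT
  by_cases he : ∃ y, ∀ i < k + 2, (i ∈ T ↔ y ∈ W i)
  swap
  · have h1 := hd T hT'
    rw [hx.cell_eq_zero he] at h1
    rw [h1.eq_zero, mul_zero, norm_zero]
    exact add_nonneg (hW.nonneg _ _) (hW.nonneg _ _)
  have hl : ‖cellVal W (k + 2) f T - cellVal W (k + 1) f S‖ ≤ δ k f := by
    rw [cellVal, dif_pos he]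
    refine cellVal_sub_le hW (fun i hi => ?_) f
    rw [← he.choose_spec i (by omega), ← erase_eq_of_mem_pair hS hT, Finset.mem_erase]
    exact ⟨fun h => h.2, fun h => ⟨by omega, h⟩⟩
  exact norm_sub_smul_mul_le (h.pr T hT') (h.near f T hT') hl

theorem Sys.conn_absorb (h : Sys N R x) (h' : Sys N R' x') (hW : Fine W δ) (h0 : R ⊤ * R' ⊤ = 0)
    (hd : ∀ i, Dom N (R' (W i)) (R (W i))) :
    Conn N (R ⊤) x (R ⊤ + R' ⊤) fun f => x f + x' f := by
  choose q hq hqd hqc using h.exists_assignment h' hW hd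
  have hu : ∀ k, ∃ u, St N (Finset.range (k + 1)).powerset (cell R W (k + 1)) (R ⊤)
      (Finset.range (k + 1)).powerset (q k) id (R' ⊤) u := fun k =>
    exists_st h.fam_cell (hq k).toFam h0 (fun S hS => hS) (hqd k)
  choose u hu using hu
  refine Conn.of_joinedIn (c := fun k f => 9 * (δ (k + 1) f + δ k f)) (w := u) (fun f => ?_)
    fun k => ?_
  · simpa using (((hW.tendsto f).comp (tendsto_add_atTop_nat 1)).add (hW.tendsto f)).const_mul 9
  have hnn : ∀ k f, 0 ≤ δ k f := hW.nonneg
  have hqR : ∀ k S U, q k S * R' U = R' U * q k S := fun k S U =>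
    (hqc k _ (h'.isPr U).mem (fun V => h'.commute U V) S).symm
  have hsub : ∀ S ∈ (Finset.range (k + 1)).powerset, ∀ T ∈ ({S, insert (k + 1) S} : Finset _),
      Dom N (q (k + 1) T) (cell R W (k + 1) S) := fun S hS T hT => by
    have hk : k + 1 ∉ S := fun hk => Finset.notMem_range_self (Finset.mem_powerset.1 hS hk)
    refine (hqd (k + 1) T (mem_powerset_range_succ hS hT)).sub_right
      (Sub.of_le h.cell_isPr h.cell_isPr ?_)
    have h1 : cell R W (k + 1) S = cell R W (k + 1) T := cell_congr fun i hi => by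
      rw [← erase_eq_of_mem_pair hS hT, Finset.mem_erase]
      exact ⟨fun h => h.2, fun h => ⟨by omega, h⟩⟩
    rw [h1, ← cell_commute fun U => (cell_commute fun V => h.commute U V).symm,
      show cell R W (k + 1 + 1) T = cell R W (k + 1) T * _ from rfl, ← mul_assoc,
      h.cell_isPr.idem]
  have hv := (hu (k + 1)).coarsen
  have hv' : St N (Finset.range (k + 1)).powerset (cell R W (k + 1)) (R ⊤)
      (Finset.range (k + 1)).powerset (fun S => ∑ T ∈ {S, insert (k + 1) S}, q (k + 1) T) id
      (R' ⊤) (u (k + 1)) := by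
    refine ⟨hv.1, fun μ => ?_⟩
    have h1 : ∑ S ∈ (Finset.range (k + 1)).powerset, μ S • cell R W (k + 1) S =
        ∑ S ∈ (Finset.range (k + 1)).powerset,
          μ S • (cell R W (k + 2) S + cell R W (k + 2) (insert (k + 1) S)) :=
      Finset.sum_congr rfl fun S hS => by
        rw [cell_succ_add]
        exact fun hk => Finset.notMem_range_self (Finset.mem_powerset.1 hS hk)
    rw [h1]
    exact hv.2 μ
  refine St.joinedIn_of_commute (δ := fun f => δ (k + 1) f + δ k f)
    ((h.near_cell hW k).mono fun f => le_add_of_nonneg_left (hnn _ f))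
    ((hq k).mono fun f => le_add_of_nonneg_left (hnn _ f))
    ((hq (k + 1)).coarsen hW h (hqd (k + 1))) (fun f => add_nonneg (hnn _ f) (hnn _ f)) h0
    (hqd k) (fun S hS => ?_) (fun S _ S' hS' => ?_) (hu k) hv'
  · exact ((hq (k + 1)).toFam.subset fun T => mem_powerset_range_succ hS).dom (hsub S hS)
      h.cell_isPr
  · rw [Finset.mul_sum, Finset.sum_mul]
    refine Finset.sum_congr rfl fun T hT => ?_
    exact (hqc k _ ((hq (k + 1)).pr T (mem_powerset_range_succ hS' hT)).mem
      (fun U => hqR (k + 1) T U) S).symm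

end AbsorbSystems

section FinitePart

variable {H : Type*} [NormedAddCommGroup H] [InnerProductSpace ℂ H] [CompleteSpace H]
variable {N : VonNeumannAlgebra H} {Y : Type*} [TopologicalSpace Y]
variable {R R' : Opens Y → H →L[ℂ] H} {x x' : C(Y, ℂ) → H →L[ℂ] H} {W : ℕ → Opens Y} {k m : ℕ}
  {δ : ℕ → C(Y, ℂ) → ℝ} {z : ℕ → H →L[ℂ] H}

theorem IsPr.mul_supProj {ι : Type*} {E : ι → H →L[ℂ] H} {p : H →L[ℂ] H} (hp : IsPr N p)
    (hE : ∀ i, IsPr N (E i)) (hc : ∀ i, p * E i = E i * p) :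
    p * supProj E = supProj fun i => p * E i := by
  have hS : IsPr N (supProj E) := IsPr.sup fun i => (hE i).mem
  have hpS : p * supProj E = supProj E * p :=
    supProj_commute' hc fun i => by rw [hp.sa, hc]
  have h1 : (supProj fun i => p * E i) * (p * supProj E) = supProj fun i => p * E i :=
    supProj_le (hp.mul hS hpS) fun i => by
      rw [hpS, mul_assoc, mul_mul_of_eq hp.idem, hc, mul_mul_of_eq (supProj_mul E i)]
  have h2 : (supProj fun i => p * E i) * p * supProj E = p * supProj E :=
    mul_supProj_congr fun i => by rw [mul_assoc]; exact supProj_mul (fun i => p * E i) i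
  rw [← h2, mul_assoc, h1]

/-- The complement of the union of the sets `W i`, `i < k`, in the central parts `z i`. -/
noncomputable def finCompl (R : Opens Y → H →L[ℂ] H) (W : ℕ → Opens Y) (z : ℕ → H →L[ℂ] H) :
    ℕ → H →L[ℂ] H
  | 0 => 1
  | k + 1 => finCompl R W z k * (1 - z k * R (W k))

/-- The part of `z m * R (W m)` disjoint from the earlier ones. -/
noncomputable def finPiece (R : Opens Y → H →L[ℂ] H) (W : ℕ → Opens Y) (z : ℕ → H →L[ℂ] H)
    (m : ℕ) : H →L[ℂ] H :=
  finCompl R W z m * (z m * R (W m))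

/-- The supremum of the projections `z m * R (W m)`. -/
noncomputable def finPart (R : Opens Y → H →L[ℂ] H) (W : ℕ → Opens Y) (z : ℕ → H →L[ℂ] H) :
    H →L[ℂ] H :=
  supProj (finPiece R W z)

theorem finCompl_commute {c : H →L[ℂ] H} (hc : ∀ U, c * R U = R U * c)
    (hz : ∀ i, c * z i = z i * c) : c * finCompl R W z k = finCompl R W z k * c := by
  induction k with
  | zero => simp [finCompl]
  | succ k ih =>
    rw [finCompl, ← mul_assoc, ih, mul_assoc, mul_assoc, mul_sub, sub_mul, ← mul_assoc c, hz,
      mul_assoc, hc, one_mul, mul_one, mul_assoc]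

theorem finPiece_commute {c : H →L[ℂ] H} (hc : ∀ U, c * R U = R U * c)
    (hz : ∀ i, c * z i = z i * c) : c * finPiece R W z m = finPiece R W z m * c := by
  rw [finPiece, ← mul_assoc, finCompl_commute hc hz, mul_assoc, ← mul_assoc c, hz, mul_assoc, hc,
    mul_assoc, mul_assoc]

theorem Cen.commute_mem {c T : H →L[ℂ] H} (hc : Cen N c) (hT : T ∈ N) : T * c = c * T :=
  (hc.comm T hT).symm

namespace Sys

theorem commute_finCompl (h : Sys N R x) (hz : ∀ i, Cen N (z i)) (U : Opens Y) :
    R U * finCompl R W z k = finCompl R W z k * R U :=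
  finCompl_commute (h.commute U) fun i => (hz i).commute_mem (h.isPr U).mem

theorem commute_finPiece (h : Sys N R x) (hz : ∀ i, Cen N (z i)) (U : Opens Y) :
    R U * finPiece R W z m = finPiece R W z m * R U :=
  finPiece_commute (h.commute U) fun i => (hz i).commute_mem (h.isPr U).mem

theorem finCompl_isPr (h : Sys N R x) (hz : ∀ i, Cen N (z i)) : IsPr N (finCompl R W z k) := by
  induction k with
  | zero => exact IsPr.one
  | succ k ih =>
    refine ih.mul ((hz k).pr_mul (h.isPr _)).compl ?_
    rw [mul_sub, sub_mul, mul_one, one_mul, ← mul_assoc, (hz k).commute_mem ih.mem, mul_assoc,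
      mul_assoc, h.commute_finCompl hz]

theorem finCompl_mul_comm (h : Sys N R x) (hz : ∀ i, Cen N (z i)) (i : ℕ) :
    finCompl R W z k * (z i * R (W i)) = z i * R (W i) * finCompl R W z k := by
  rw [← mul_assoc, (hz i).commute_mem (h.finCompl_isPr hz).mem, mul_assoc, mul_assoc,
    h.commute_finCompl hz]

theorem finPiece_isPr (h : Sys N R x) (hz : ∀ i, Cen N (z i)) : IsPr N (finPiece R W z m) :=
  (h.finCompl_isPr hz).mul ((hz m).pr_mul (h.isPr _)) (h.finCompl_mul_comm hz m)

theorem finCompl_mul_eq_zero (h : Sys N R x) (hz : ∀ i, Cen N (z i)) (hmk : m < k) :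
    finCompl R W z k * (z m * R (W m)) = 0 := by
  induction k with
  | zero => omega
  | succ k ih =>
    rw [finCompl, mul_assoc]
    rcases Nat.lt_succ_iff_lt_or_eq.1 hmk with hlt | rfl
    · have hcm : (1 - z k * R (W k)) * (z m * R (W m))
          = z m * R (W m) * (1 - z k * R (W k)) :=
        (Commute.one_left _).sub_left (Commute.mul_left
          ((hz k).comm _ ((hz m).pr_mul (h.isPr _)).mem)
          (Commute.mul_right ((hz m).commute_mem (h.isPr _).mem) (h.commute _ _)))
      rw [hcm, ← mul_assoc, ih hlt, zero_mul]
    · rw [sub_mul, one_mul, ((hz m).pr_mul (h.isPr _)).idem, sub_self, mul_zero]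

theorem finPiece_orth (h : Sys N R x) (hz : ∀ i, Cen N (z i)) {i j : ℕ} (hij : i ≠ j) :
    finPiece R W z i * finPiece R W z j = 0 := by
  have key : ∀ {i j : ℕ}, i < j → finPiece R W z j * finPiece R W z i = 0 := by
    intro i j hij
    rw [finPiece, finPiece, h.finCompl_mul_comm hz, mul_assoc, ← mul_assoc (finCompl R W z j),
      finCompl_commute (c := finCompl R W z j) (fun U => (h.commute_finCompl hz U).symm)
        (fun i => (hz i).commute_mem (h.finCompl_isPr hz).mem)]
    simp only [mul_assoc, h.finCompl_mul_eq_zero hz hij, mul_zero]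
  rcases lt_or_gt_of_ne hij with hlt | hlt
  · exact orth_symm (h.finPiece_isPr hz).sa (h.finPiece_isPr hz).sa (key hlt)
  · exact key hlt

theorem finPart_isPr (h : Sys N R x) (hz : ∀ i, Cen N (z i)) : IsPr N (finPart R W z) :=
  IsPr.sup fun _ => (h.finPiece_isPr hz).mem

theorem finPart_commute (h : Sys N R x) (hz : ∀ i, Cen N (z i)) {c : H →L[ℂ] H} (hcN : c ∈ N)
    (hc : ∀ U, c * R U = R U * c) : c * finPart R W z = finPart R W z * c := by
  refine supProj_commute' (fun i => ?_) fun i => ?_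
  · exact finPiece_commute hc fun i => (hz i).commute_mem hcN
  · refine finPiece_commute (fun U => ?_) fun i => (hz i).commute_mem (star_mem hcN)
    have := congrArg star (hc U)
    rw [star_mul, star_mul, (h.isPr U).sa] at this
    exact this.symm

theorem compl_finPart_mul (R : Opens Y → H →L[ℂ] H) (W : ℕ → Opens Y) (z : ℕ → H →L[ℂ] H) (i : ℕ) :
    (1 - finPart R W z) * (z i * R (W i)) = 0 := by
  have h1 : ∀ m, (1 - finPart R W z) * finPiece R W z m = 0 := fun m => by
    rw [sub_mul, one_mul, finPart, supProj_mul, sub_self]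
  have h2 : ∀ k, (1 - finPart R W z) * finCompl R W z k = 1 - finPart R W z := fun k => by
    induction k with
    | zero => rw [finCompl, mul_one]
    | succ k ih =>
      have : finCompl R W z (k + 1) = finCompl R W z k - finPiece R W z k := by
        rw [finCompl, finPiece, mul_sub, mul_one]
      rw [this, mul_sub, ih, h1, sub_zero]
  rw [← h2 i, mul_assoc]
  exact h1 i

theorem mul_compl_finPart_le (h : Sys N R x) (hz : ∀ i, Cen N (z i)) (i : ℕ) :
    R (W i) * (1 - finPart R W z) * ((1 - z i) * R (W i)) = R (W i) * (1 - finPart R W z) := by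
  have h1 := compl_finPart_mul R W z i
  have h2 := h.finPart_commute (W := W) hz (h.isPr (W i)).mem (h.commute (W i))
  rw [sub_mul 1 (z i), one_mul, mul_sub, mul_assoc, mul_assoc (R (W i)) _ (z i * _), h1, mul_zero,
    sub_zero, sub_mul, one_mul, ← h2, mul_sub, mul_mul_of_eq (h.isPr _).idem, (h.isPr _).idem,
    mul_sub, mul_one]

theorem eqv_mul_finCompl (h : Sys N R x) (h' : Sys N R' x') (hz : ∀ i, Cen N (z i))
    (hfin : ∀ i, IsFin N (z i * R (W i))) (hRR : ∀ U, Eqv N (R U) (R' U)) {c : H →L[ℂ] H}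
    (hc : Cen N c) (hcz : c * z m = c) {U : Opens Y} (hU : U ≤ W m) (V : Opens Y) :
    Eqv N (c * (R U - R (U ⊓ V)) * finCompl R W z k)
      (c * (R' U - R' (U ⊓ V)) * finCompl R' W z k) := by
  induction k generalizing c V with
  | zero =>
    rw [finCompl, finCompl, mul_one, mul_one, mul_sub, mul_sub]
    refine IsFin.eqv_sub ((hfin m).of_le (hc.pr_mul (h.isPr U)) ?_) ((hRR U).cut hc)
      ((hRR _).cut hc) ?_ ?_
    · rw [mul_assoc, ← mul_assoc (R U), (hz m).commute_mem (h.isPr U).mem, mul_assoc,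
        h.mul_of_le hU, ← mul_assoc, hcz]
    · rw [hc.mul_mul_mul (h.isPr _).mem, h.mul_of_le inf_le_left]
    · rw [hc.mul_mul_mul (h'.isPr _).mem, h'.mul_of_le inf_le_left]
  | succ k ih =>
    have key : ∀ {R : Opens Y → H →L[ℂ] H} {x : C(Y, ℂ) → H →L[ℂ] H}, Sys N R x →
        z k * (c * (R U - R (U ⊓ V)) * finCompl R W z (k + 1))
          = (z k * c) * (R U - R (U ⊓ (V ⊔ W k))) * finCompl R W z k ∧
        (1 - z k) * (c * (R U - R (U ⊓ V)) * finCompl R W z (k + 1))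
          = ((1 - z k) * c) * (R U - R (U ⊓ V)) * finCompl R W z k ∧
        c * (R U - R (U ⊓ V)) * finCompl R W z (k + 1) ∈ N := by
      intro R x h
      have hB := (h.finCompl_isPr (W := W) (k := k) hz).mem
      have e1 : finCompl R W z (k + 1) = (1 - z k * R (W k)) * finCompl R W z k := by
        rw [finCompl, mul_sub, h.finCompl_mul_comm hz, sub_mul, one_mul, mul_one]
      have e2 : z k * (1 - z k * R (W k)) = z k * (1 - R (W k)) := by
        rw [mul_sub, mul_mul_of_eq (hz k).idem, mul_sub]
      have e3 : (1 - z k) * (1 - z k * R (W k)) = 1 - z k := by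
        rw [mul_sub, ← mul_assoc, sub_mul 1 (z k) (z k), one_mul, (hz k).idem, sub_self, zero_mul,
          sub_zero, mul_one]
      have e4 : (R U - R (U ⊓ V)) * (1 - R (W k)) = R U - R (U ⊓ (V ⊔ W k)) := by
        rw [inf_sup_left, h.sup]
        simp only [h.inf, sub_mul, mul_sub, mul_one, mul_assoc, mul_mul_of_eq (h.commute V U),
          mul_mul_of_eq (h.isPr U).idem]
        abel
      have hd : R U - R (U ⊓ V) ∈ N := sub_mem (h.isPr _).mem (h.isPr _).mem
      have hcd : c * (R U - R (U ⊓ V)) ∈ N := mul_mem hc.mem hd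
      refine ⟨?_, ?_, mul_mem hcd (h.finCompl_isPr hz).mem⟩
      · rw [e1, ← mul_assoc, (hz k).comm _ hcd, mul_assoc, ← mul_assoc (z k), e2, ← e4,
          ← mul_assoc, ← mul_assoc, ← (hz k).comm _ hcd]
        simp only [mul_assoc]
      · rw [e1, ← mul_assoc, (hz k).compl.comm _ hcd, mul_assoc, ← mul_assoc (1 - z k), e3,
          ← mul_assoc, ← (hz k).compl.comm _ hcd]
        simp only [mul_assoc]
    obtain ⟨k1, k2, k3⟩ := key h
    obtain ⟨k1', k2', k3'⟩ := key h'
    refine Eqv.glue (hz k) ?_ ?_ k3 k3'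
    · rw [k1, k1']
      exact ih ((hz k).mul hc) (by rw [mul_assoc, hcz]) _
    · rw [k2, k2']
      exact ih ((hz k).compl.mul hc) (by rw [mul_assoc, hcz]) _

theorem eqv_mul_finPart (h : Sys N R x) (h' : Sys N R' x') (hz : ∀ i, Cen N (z i))
    (hfin : ∀ i, IsFin N (z i * R (W i))) (hRR : ∀ U, Eqv N (R U) (R' U)) (U V : Opens Y) :
    Eqv N ((R U - R (U ⊓ V)) * finPart R W z) ((R' U - R' (U ⊓ V)) * finPart R' W z) := by
  have key : ∀ {R : Opens Y → H →L[ℂ] H} {x : C(Y, ℂ) → H →L[ℂ] H}, Sys N R x →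
      ((R U - R (U ⊓ V)) * finPart R W z = supProj fun m => (R U - R (U ⊓ V)) * finPiece R W z m) ∧
      (∀ m, (R U - R (U ⊓ V)) * finPiece R W z m
        = z m * (R (U ⊓ W m) - R (U ⊓ W m ⊓ V)) * finCompl R W z m) ∧
      ∀ i j, i ≠ j → (R U - R (U ⊓ V)) * finPiece R W z i *
        ((R U - R (U ⊓ V)) * finPiece R W z j) = 0 := by
    intro R x h
    have hd : IsPr N (R U - R (U ⊓ V)) := (h.isPr U).sub (h.isPr _) (h.mul_of_le inf_le_left)
    have hdc : ∀ m, (R U - R (U ⊓ V)) * finPiece R W z m = finPiece R W z m * (R U - R (U ⊓ V)) :=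
      fun m => by rw [sub_mul, mul_sub, h.commute_finPiece hz, h.commute_finPiece hz]
    refine ⟨hd.mul_supProj (fun m => h.finPiece_isPr hz) hdc, fun m => ?_, fun i j hij => ?_⟩
    · rw [finPiece, h.finCompl_mul_comm hz, ← mul_assoc, ← mul_assoc,
        (hz m).commute_mem hd.mem, mul_assoc (z m), sub_mul, ← h.inf, ← h.inf,
        inf_right_comm U V]
    · rw [hdc i, mul_assoc, mul_mul_of_eq hd.idem, hdc j, ← mul_assoc, h.finPiece_orth hz hij,
        zero_mul]
  obtain ⟨k1, k2, k3⟩ := key h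
  obtain ⟨k1', k2', k3'⟩ := key h'
  rw [k1, k1']
  refine exists_eqv_supProj (fun m => ?_) k3 k3'
  rw [k2, k2']
  exact h.eqv_mul_finCompl h' hz hfin hRR (hz m) (hz m).idem inf_le_right V

end Sys

end FinitePart

section Combination

variable {H : Type*} [NormedAddCommGroup H] [InnerProductSpace ℂ H] [CompleteSpace H]
variable {N : VonNeumannAlgebra H} {Y : Type*} [TopologicalSpace Y]
variable {R R' : Opens Y → H →L[ℂ] H} {x x' : C(Y, ℂ) → H →L[ℂ] H} {W : ℕ → Opens Y}
  {δ : ℕ → C(Y, ℂ) → ℝ} {z : ℕ → H →L[ℂ] H} {c p q v w G : H →L[ℂ] H}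

theorem Via.star_mul_eq_zero {e : H →L[ℂ] H} (hv : Via N v c p) (hw : Via N w e q)
    (h : p * q = 0) : star v * w = 0 := by
  rw [← hv.mul_fin, ← hw.fin_mul, mul_assoc, ← mul_assoc p, h, zero_mul, mul_zero]

namespace Sys

theorem cut_cen (h : Sys N R x) (hc : Cen N c) (hG : IsPr N G) (hR : ∀ U, R U * G = G * R U)
    (hx : ∀ f, x f * G = G * x f) :
    Sys N (fun U => R U * (c * G)) fun f => x f * (c * G) := by
  refine h.cut (hc.pr_mul hG) (fun U => ?_) fun f => ?_
  · rw [← mul_assoc, hc.commute_mem (h.isPr U).mem, mul_assoc, hR, mul_assoc]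
  · rw [← mul_assoc, hc.commute_mem (h.mem f), mul_assoc, hx, mul_assoc]

theorem conn_via (h : Sys N R x) (hv : Via N v c p) (hw : Via N w c q) (hc : R ⊤ * c = R ⊤) :
    Conn N (v * R ⊤ * star v) (fun f => v * x f * star v) (w * R ⊤ * star w)
      fun f => w * x f * star w := by
  refine Conn.of_via ((hw.restrict (h.isPr ⊤) hc).symm.trans (hv.restrict (h.isPr ⊤) hc))
    fun f => ?_
  have hc' : c * R ⊤ = R ⊤ := le_symm (h.isPr ⊤).sa hv.left.sa hc
  have hR := (h.isPr ⊤).idem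
  simp only [star_mul, star_star, (h.isPr ⊤).sa, mul_assoc, mul_mul_of_eq hv.init,
    mul_mul_of_eq hc', mul_mul_of_eq hR, mul_mul_of_eq hc, mul_mul_of_eq (h.top f),
    mul_mul_of_eq (h.top_mul f)]

theorem top_mul_add_mul_top {S S' : Opens Y → H →L[ℂ] H} {y y' : C(Y, ℂ) → H →L[ℂ] H}
    (h : Sys N S y) (h' : Sys N S' y') (ho : S ⊤ * S' ⊤ = 0) (f : C(Y, ℂ)) :
    (S ⊤ + S' ⊤) * (y f + y' f) * (S ⊤ + S' ⊤) = y f + y' f := by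
  have ho' : S' ⊤ * S ⊤ = 0 := orth_symm (h.isPr ⊤).sa (h'.isPr ⊤).sa ho
  have h1 : y f * S' ⊤ = 0 := by rw [← h.top, mul_assoc, ho, mul_zero]
  have h2 : y' f * S ⊤ = 0 := by rw [← h'.top, mul_assoc, ho', mul_zero]
  have h3 : S' ⊤ * y f = 0 := by rw [← h.top_mul, ← mul_assoc, ho', zero_mul]
  have h4 : S ⊤ * y' f = 0 := by rw [← h'.top_mul, ← mul_assoc, ho, zero_mul]
  simp only [mul_add, add_mul, h.top_mul, h'.top_mul, h.top, h'.top, h1, h2, h3, h4, add_zero,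
    zero_add]

theorem conn_add_three {S₁ S₂ S₃ : Opens Y → H →L[ℂ] H} {a₁ a₂ a₃ b₁ b₂ b₃ : C(Y, ℂ) → H →L[ℂ] H}
    {e₁ e₂ e₃ : H →L[ℂ] H} (h₁ : Sys N S₁ a₁) (h₂ : Sys N S₂ a₂) (h₃ : Sys N S₃ a₃)
    (c₁ : Conn N (S₁ ⊤) a₁ e₁ b₁) (c₂ : Conn N (S₂ ⊤) a₂ e₂ b₂) (c₃ : Conn N (S₃ ⊤) a₃ e₃ b₃)
    (h₁₂ : S₁ ⊤ * S₂ ⊤ = 0) (h₁₃ : S₁ ⊤ * S₃ ⊤ = 0) (h₂₃ : S₂ ⊤ * S₃ ⊤ = 0)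
    (e₁₂ : e₁ * e₂ = 0) (e₁₃ : e₁ * e₃ = 0) (e₂₃ : e₂ * e₃ = 0) :
    Conn N (S₁ ⊤ + S₂ ⊤ + S₃ ⊤) (fun f => a₁ f + a₂ f + a₃ f) (e₁ + e₂ + e₃)
      fun f => b₁ f + b₂ f + b₃ f :=
  (c₁.add c₂ h₁₂ e₁₂ h₁.top_mul_top h₂.top_mul_top).add c₃ (by rw [add_mul, h₁₃, h₂₃, add_zero])
    (by rw [add_mul, e₁₃, e₂₃, add_zero]) (h₁.top_mul_add_mul_top h₂ h₁₂) h₃.top_mul_top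

/-- Absorbing a copy of the infinite part of `x'` into the halvable part of `x`. -/
theorem conn_halv_absorb (h : Sys N R x) (h' : Sys N R' x') (hW : Fine W δ)
    (hT : R ⊤ = 1) (hz : ∀ i, Cen N (z i)) (hhalv : ∀ i, Halv N ((1 - z i) * R (W i)))
    (hRR : ∀ U, Eqv N (R U) (R' U)) (hc : Cen N c) (hv : Via N v c p) (hw : Via N w c q)
    (hpq : p * q = 0) (hxz : ∀ f, x' f * finPart R' W z = finPart R' W z * x' f) :
    Conn N c (fun f => x f * c)
      (v * c * star v + w * (R' ⊤ * (c * (1 - finPart R' W z))) * star w)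
      fun f => v * (x f * c) * star v + w * (x' f * (c * (1 - finPart R' W z))) * star w := by
  have hG := h'.finPart_isPr (W := W) hz
  have hGR : ∀ U, R' U * finPart R' W z = finPart R' W z * R' U := fun U =>
    h'.finPart_commute hz (h'.isPr U).mem (h'.commute U)
  have hA := h.cut hc.toIsPr (fun U => hc.commute_mem (h.isPr U).mem)
    fun f => hc.commute_mem (h.mem f)
  have hA' := h'.cut_cen hc hG.compl (fun U => by rw [mul_sub, sub_mul, hGR, mul_one, one_mul])
    fun f => by rw [mul_sub, sub_mul, hxz, mul_one, one_mul]
  have hAc : R ⊤ * c * c = R ⊤ * c := by rw [mul_assoc, hc.idem]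
  have hcG : c * (1 - finPart R' W z) * c = c * (1 - finPart R' W z) := by
    rw [hc.commute_mem (mul_mem hc.mem hG.compl.mem), ← mul_assoc, hc.idem]
  have hAc' : ∀ U, R' U * (c * (1 - finPart R' W z)) * c = R' U * (c * (1 - finPart R' W z)) :=
    fun U => by rw [mul_assoc, hcG]
  have hB := hA.via hv hAc
  have hB' := hA'.via hw (hAc' ⊤)
  have h1 : Conn N c (fun f => x f * c) (v * (R ⊤ * c) * star v) fun f => v * (x f * c) * star v := by
    refine Conn.of_via (v := star v) ?_ fun f => by rw [star_star]
    rw [hT, one_mul, hv.mul_init, hv.fin]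
    exact hv.symm
  have h2 := hB.conn_absorb hB' hW ?_ fun i => ?_
  · have := h1.trans h2
    rwa [hT, one_mul] at this
  · have := hv.star_mul_eq_zero hw hpq
    simp only [mul_assoc, mul_mul_of_eq this, zero_mul, mul_zero]
  · refine ⟨c * ((1 - z i) * R (W i)), (hhalv i).cut hc, ?_, ?_⟩
    · refine (Sub.of_eqv ⟨_, (hw.restrict (hA'.isPr (W i)) (hAc' (W i))).symm⟩).trans
        ((Sub.of_le (hA'.isPr (W i))
          (hc.pr_mul ((hz i).compl.pr_mul (h'.isPr (W i)))) ?_).trans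
          (Sub.of_eqv (((hRR (W i)).cut (hz i).compl).cut hc).symm))
      have hm : R' (W i) * (c * (1 - finPart R' W z)) = c * (R' (W i) * (1 - finPart R' W z)) := by
        rw [← mul_assoc, hc.commute_mem (h'.isPr _).mem, mul_assoc]
      rw [hm, hc.mul_mul_mul (mul_mem (h'.isPr _).mem hG.compl.mem), h'.mul_compl_finPart_le hz]
    · refine (Sub.of_le (hc.pr_mul ((hz i).compl.pr_mul (h.isPr (W i)))) (hA.isPr (W i)) ?_).trans
        (Sub.of_eqv ⟨_, hv.restrict (hA.isPr (W i)) (by rw [mul_assoc, hc.idem])⟩)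
      rw [hc.commute_mem (h.isPr _).mem, hc.mul_mul_mul (hhalv i).1.mem, mul_assoc,
        (h.isPr _).idem]

theorem conn_halv_swap (h : Sys N R x) (h' : Sys N R' x') (hW : Fine W δ)
    (hz : ∀ i, Cen N (z i)) (hfin : ∀ i, IsFin N (z i * R (W i)))
    (hRR : ∀ U, Eqv N (R U) (R' U)) (hc : Cen N c) (hv : Via N v c p) (hw : Via N w c q)
    (hpq : p * q = 0) (hT : R ⊤ = 1) (hT' : R' ⊤ = 1)
    (hxz : ∀ f, x f * finPart R W z = finPart R W z * x f)
    (hxz' : ∀ f, x' f * finPart R' W z = finPart R' W z * x' f) :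
    Conn N (v * c * star v + w * (R' ⊤ * (c * (1 - finPart R' W z))) * star w)
      (fun f => v * (x f * c) * star v + w * (x' f * (c * (1 - finPart R' W z))) * star w)
      (v * c * star v + w * (R ⊤ * (c * (1 - finPart R W z))) * star w)
      fun f => v * (x' f * c) * star v + w * (x f * (c * (1 - finPart R W z))) * star w := by
  have hG := h.finPart_isPr (W := W) hz
  have hG' := h'.finPart_isPr (W := W) hz
  have hGR : ∀ U, R U * finPart R W z = finPart R W z * R U := fun U =>
    h.finPart_commute hz (h.isPr U).mem (h.commute U)
  have hGR' : ∀ U, R' U * finPart R' W z = finPart R' W z * R' U := fun U =>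
    h'.finPart_commute hz (h'.isPr U).mem (h'.commute U)
  have hF := h.cut_cen hc hG hGR hxz
  have hF' := h'.cut_cen hc hG' hGR' hxz'
  have hE := h.cut_cen hc hG.compl (fun U => by rw [mul_sub, sub_mul, hGR, mul_one, one_mul])
    fun f => by rw [mul_sub, sub_mul, hxz, mul_one, one_mul]
  have hE' := h'.cut_cen hc hG'.compl (fun U => by rw [mul_sub, sub_mul, hGR', mul_one, one_mul])
    fun f => by rw [mul_sub, sub_mul, hxz', mul_one, one_mul]
  have le : ∀ {P T : H →L[ℂ] H}, P ∈ N → T * (c * P) * c = T * (c * P) := fun hP => by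
    rw [mul_assoc, hc.commute_mem (mul_mem hc.mem hP), ← mul_assoc c, hc.idem]
  have hvw := hv.star_mul_eq_zero hw hpq
  have hwv := hw.star_mul_eq_zero hv (orth_symm hv.right.sa hw.right.sa hpq)
  have hFv := hF.via hv (le hG.mem)
  have hEv := hE.via hv (le hG.compl.mem)
  have hEw' := hE'.via hw (le hG'.compl.mem)
  have hvFE : ∀ {P Q : H →L[ℂ] H}, P * Q = 0 → P ∈ N → Q ∈ N →
      v * (1 * (c * P)) * star v * (v * (1 * (c * Q)) * star v) = 0 := fun {P Q} h0 hP hQ => by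
    have : c * P * (c * (c * Q)) = 0 := by
      rw [← mul_assoc c c, hc.idem, hc.mul_mul_mul hP, h0, mul_zero]
    simp only [one_mul]
    rw [mul_assoc, mul_assoc v _ (star v), ← mul_assoc (star v), hv.init, ← mul_assoc c,
      mul_assoc v, ← mul_assoc (c * P), this, zero_mul, mul_zero]
  have c1 : Conn N (v * (R ⊤ * (c * finPart R W z)) * star v)
      (fun f => v * (x f * (c * finPart R W z)) * star v)
      (v * (R' ⊤ * (c * finPart R' W z)) * star v)
      fun f => v * (x' f * (c * finPart R' W z)) * star v := by
    refine hFv.conn_of_eqv (hF'.via hv (le hG'.mem)) hW fun U V => ?_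
    have key : ∀ {R : Opens Y → H →L[ℂ] H} {G : H →L[ℂ] H}, (∀ U, IsPr N (R U)) → IsPr N G →
        IsPr N ((R U - R (U ⊓ V)) * G) →
        Eqv N (c * ((R U - R (U ⊓ V)) * G)) (v * (R U * (c * G)) * star v -
          v * (R (U ⊓ V) * (c * G)) * star v) := by
      intro R G hR hG hRG
      have e1 : v * (R U * (c * G)) * star v - v * (R (U ⊓ V) * (c * G)) * star v
          = v * (c * ((R U - R (U ⊓ V)) * G)) * star v := by
        have : ∀ U, R U * (c * G) = c * (R U * G) := fun U => by
          rw [← mul_assoc, hc.commute_mem (hR U).mem, mul_assoc]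
        rw [this, this, ← sub_mul, ← mul_sub, ← mul_sub, ← sub_mul]
      rw [e1]
      exact ⟨_, hv.restrict (hc.pr_mul hRG)
        (by rw [hc.commute_mem (mul_mem hc.mem hRG.mem), ← mul_assoc, hc.idem])⟩
    have he := h.eqv_mul_finPart h' hz hfin hRR U V
    exact (key h.isPr hG he.left).symm.trans ((he.cut hc).trans (key h'.isPr hG' he.right))
  have c2 := hE.conn_via hv hw (le hG.compl.mem)
  have c3 := hE'.conn_via hw hv (le hG'.compl.mem)
  have hsplit : ∀ T G : H →L[ℂ] H, v * (T * (c * G)) * star v + v * (T * (c * (1 - G))) * star v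
      = v * (T * c) * star v := fun T G => by
    rw [← add_mul, ← mul_add, ← mul_add, ← mul_add, add_sub_cancel, mul_one]
  have hsplit' : ∀ G : H →L[ℂ] H, v * (1 * (c * G)) * star v + v * (1 * (c * (1 - G))) * star v
      = v * c * star v := fun G => by rw [hsplit, one_mul]
  have hGG : finPart R W z * (1 - finPart R W z) = 0 := by rw [mul_sub, mul_one, hG.idem, sub_self]
  have hGG' : finPart R' W z * (1 - finPart R' W z) = 0 := by
    rw [mul_sub, mul_one, hG'.idem, sub_self]
  have o1 : v * (R ⊤ * (c * finPart R W z)) * star v *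
      (v * (R ⊤ * (c * (1 - finPart R W z))) * star v) = 0 := by
    rw [hT]
    exact hvFE hGG hG.mem hG.compl.mem
  have o1' : v * (R' ⊤ * (c * finPart R' W z)) * star v *
      (v * (R' ⊤ * (c * (1 - finPart R' W z))) * star v) = 0 := by
    rw [hT']
    exact hvFE hGG' hG'.mem hG'.compl.mem
  have o2 : ∀ S T : H →L[ℂ] H, v * S * star v * (w * T * star w) = 0 := fun S T => by
    simp only [mul_assoc, mul_mul_of_eq hvw, zero_mul, mul_zero]
  have o2' : ∀ S T : H →L[ℂ] H, w * S * star w * (v * T * star v) = 0 := fun S T => by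
    simp only [mul_assoc, mul_mul_of_eq hwv, zero_mul, mul_zero]
  have c123 := hFv.conn_add_three hEv hEw' c1 c2 c3 o1 (o2 _ _) (o2 _ _) (o2 _ _) o1' (o2' _ _)
  convert c123 using 1
  · rw [hT, hsplit']
  · funext f
    rw [hsplit]
  · rw [add_right_comm, hT', hsplit']
  · funext f
    rw [add_right_comm, hsplit]

/-- Two systems with equivalent projections are connected. -/
theorem conn_of_eqv_top (h : Sys N R x) (h' : Sys N R' x') (hW : Fine W δ) (hT : R ⊤ = 1)
    (hT' : R' ⊤ = 1) (hRR : ∀ U, Eqv N (R U) (R' U)) : Conn N 1 x 1 x' := by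
  choose z hz hfin hhalv using fun i => exists_fin_halv (h.isPr (W i))
  have hfin' : ∀ i, IsFin N (z i * R' (W i)) := fun i => (hfin i).of_eqv ((hRR _).cut (hz i))
  have hhalv' : ∀ i, Halv N ((1 - z i) * R' (W i)) := fun i =>
    (hhalv i).of_eqv ((hRR _).cut (hz i).compl)
  have hx : ∀ f, x f * finPart R W z = finPart R W z * x f := fun f =>
    h.finPart_commute hz (h.mem f) (h.comm f)
  have hx' : ∀ f, x' f * finPart R' W z = finPart R' W z * x' f := fun f =>
    h'.finPart_commute hz (h'.mem f) (h'.comm f)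
  have hc : Cen N (1 - z 0) := (hz 0).compl
  have hc1 : Halv N (1 - z 0) := by
    have := hhalv 0
    rwa [hW.top, hT, mul_one] at this
  obtain ⟨_, p, q, hpq, -, ⟨v, hv⟩, w, hw⟩ := hc1
  have hRR' := fun U => (hRR U).symm
  have c1 := h.conn_halv_absorb h' hW hT hz hhalv hRR hc hv hw hpq hx'
  have c2 := h.conn_halv_swap h' hW hz hfin hRR hc hv hw hpq hT hT' hx hx'
  have c3 := h'.conn_halv_absorb h hW hT' hz hhalv' hRR' hc hv hw hpq hx
  have hcc : ∀ {R : Opens Y → H →L[ℂ] H} {x : C(Y, ℂ) → H →L[ℂ] H} {c : H →L[ℂ] H}, Cen N c →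
      Sys N R x → ∀ f, c * (x f * c) * c = x f * c := fun hc h f => by
    rw [← mul_assoc, ← hc.commute_mem (h.mem f), mul_assoc, mul_assoc, hc.idem, hc.idem]
  have cinf : Conn N (1 - z 0) (fun f => x f * (1 - z 0)) (1 - z 0) fun f => x' f * (1 - z 0) :=
    (c1.trans c2).trans (c3.symm (hcc hc h'))
  have hz0 : IsFin N (z 0) := by
    have := hfin 0
    rwa [hW.top, hT, mul_one] at this
  have hS : ∀ {R : Opens Y → H →L[ℂ] H} {x : C(Y, ℂ) → H →L[ℂ] H}, Sys N R x →
      Sys N (fun U => R U * z 0) fun f => x f * z 0 := fun h =>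
    h.cut (hz 0).toIsPr (fun U => (hz 0).commute_mem (h.isPr U).mem)
      fun f => (hz 0).commute_mem (h.mem f)
  have cfin : Conn N (z 0) (fun f => x f * z 0) (z 0) fun f => x' f * z 0 := by
    have := (hS h).conn_of_eqv (hS h') hW fun U V => ?_
    · rwa [hT, hT', one_mul] at this
    · have e : ∀ U, Eqv N (R U * z 0) (R' U * z 0) := fun U => by
        have := (hRR U).cut (hz 0)
        rwa [(hz 0).comm _ (h.isPr U).mem, (hz 0).comm _ (h'.isPr U).mem] at this
      exact (hz0.of_le ((hS h).isPr U) (by rw [mul_assoc, (hz 0).idem])).eqv_sub (e U) (e _)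
        ((hS h).mul_of_le inf_le_left) ((hS h').mul_of_le inf_le_left)
  have ho : z 0 * (1 - z 0) = 0 := by rw [mul_sub, mul_one, (hz 0).idem, sub_self]
  have := cfin.add cinf ho ho (hcc (hz 0) h) (hcc hc h)
  simpa only [← mul_add, add_sub_cancel, mul_one] using this

end Sys

end Combination

theorem exists_fine (Y : Type*) [TopologicalSpace Y] [MetrizableSpace Y] [CompactSpace Y] :
    ∃ (W : ℕ → Opens Y) (δ : ℕ → C(Y, ℂ) → ℝ), Fine W δ := by
  let := metrizableSpaceMetric Y
  have : SecondCountableTopology Y := inferInstance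
  obtain ⟨B, hB⟩ := ((countable_countableBasis Y).insert Set.univ).exists_eq_range
    (Set.insert_nonempty _ _)
  have hBo : ∀ n, IsOpen (B n) := fun n => by
    have hn : B n ∈ insert Set.univ (countableBasis Y) := hB ▸ Set.mem_range_self n
    rcases hn with hn | hn
    · exact hn ▸ isOpen_univ
    · exact isOpen_of_mem_countableBasis hn
  let W : ℕ → Opens Y := fun n => Nat.casesOn n ⊤ fun m => ⟨B m, hBo m⟩
  have hmin : ∀ k (y : Y), ∃ i < k + 1, y ∈ W i ∧
      ∀ j < k + 1, y ∈ W j → Metric.diam (W i).carrier ≤ Metric.diam (W j).carrier := by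
    classical
    intro k y
    obtain ⟨i, hi, hi'⟩ := ((Finset.range (k + 1)).filter fun j => y ∈ W j).exists_min_image
      (fun i => Metric.diam (W i).carrier) ⟨0, by simp [W]⟩
    simp only [Finset.mem_filter, Finset.mem_range] at hi hi'
    exact ⟨i, hi.1, hi.2, fun j hj hy => hi' j ⟨hj, hy⟩⟩
  choose i hik hyi hi using hmin
  let S : ℕ → C(Y, ℂ) → Set ℝ := fun k f =>
    {r | ∃ y, ∃ y' ∈ W (i k y), ∃ y'' ∈ W (i k y), r = ‖f y' - f y''‖}
  have hbdd : ∀ k f, BddAbove (S k f) := fun k f => by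
    refine ⟨‖f‖ + ‖f‖, ?_⟩
    rintro _ ⟨y, y', -, y'', -, rfl⟩
    exact (norm_sub_le _ _).trans (add_le_add (f.norm_coe_le_norm _) (f.norm_coe_le_norm _))
  refine ⟨W, fun k f => sSup (S k f), fun k y => ⟨i k y, hik k y, hyi k y, fun f y' hy' y'' hy'' =>
    le_csSup (hbdd k f) ⟨y, y', hy', y'', hy'', rfl⟩⟩, fun k f => ?_, fun f => ?_, rfl⟩
  · refine Real.sSup_nonneg ?_
    rintro _ ⟨y, y', -, y'', -, rfl⟩
    exact norm_nonneg _
  · rw [Metric.tendsto_atTop]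
    intro ε hε
    obtain ⟨d, hd, hf⟩ := Metric.uniformContinuous_iff.1
      (CompactSpace.uniformContinuous_of_continuous f.continuous) (ε / 2) (half_pos hε)
    have hcov : ∀ y : Y, ∃ n, y ∈ W n ∧ Metric.diam (W n).carrier ≤ d / 2 := by
      intro y
      obtain ⟨u, hu, hyu, hub⟩ := (isBasis_countableBasis Y).exists_subset_of_mem_open
        (Metric.mem_ball_self (x := y) (by positivity : 0 < d / 4)) Metric.isOpen_ball
      replace hu : u ∈ Set.range B := hB ▸ Set.mem_insert_of_mem _ hu
      obtain ⟨n, rfl⟩ := hu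
      refine ⟨n + 1, hyu, ?_⟩
      refine (Metric.diam_mono hub Metric.isBounded_ball).trans
        ((Metric.diam_ball (by positivity)).trans (by linarith))
    choose n hn hnd using hcov
    obtain ⟨T, hT⟩ := isCompact_univ.elim_finite_subcover (fun y : Y => (W (n y)).carrier)
      (fun y => (W (n y)).is_open') fun y _ => Set.mem_iUnion.2 ⟨y, hn y⟩
    refine ⟨T.sup n, fun k hk => ?_⟩
    rw [Real.dist_eq, sub_zero]
    refine lt_of_le_of_lt (b := ε / 2) ?_ (half_lt_self hε)
    have h0 : ∀ r ∈ S k f, r ≤ ε / 2 := by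
      rintro _ ⟨y, y', hy', y'', hy'', rfl⟩
      obtain ⟨t, ht, hyt⟩ := Set.mem_iUnion₂.1 (hT (Set.mem_univ y))
      have h1 := hi k y (n t) (Nat.lt_succ_of_le ((Finset.le_sup ht).trans hk)) hyt
      have h2 : dist y' y'' ≤ d / 2 :=
        (Metric.dist_le_diam_of_mem (Metric.isBounded_of_compactSpace) hy' hy'').trans
          (h1.trans (hnd t))
      have h3 := hf (lt_of_le_of_lt h2 (half_lt_self hd))
      rw [dist_eq_norm] at h3
      exact h3.le
    have h1 : 0 ≤ sSup (S k f) := Real.sSup_nonneg fun r hr => by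
      obtain ⟨y, y', -, y'', -, rfl⟩ := hr
      exact norm_nonneg _
    rw [abs_of_nonneg h1]
    exact Real.sSup_le h0 (by positivity)

section Representation

variable {H : Type*} [NormedAddCommGroup H] [InnerProductSpace ℂ H] [CompleteSpace H]
variable {N : VonNeumannAlgebra H} {Y : Type*} [TopologicalSpace Y]
variable {φ ψ : C(Y, ℂ) →⋆ₐ[ℂ] (H →L[ℂ] H)}

/-- The spectral projection of an open set. -/
noncomputable def specProj (φ : C(Y, ℂ) →⋆ₐ[ℂ] (H →L[ℂ] H)) (U : Opens Y) : H →L[ℂ] H :=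
  supProj fun g : ContinuousMap.idealOfSet ℂ (U : Set Y) => φ g

theorem specProj_mul {U : Opens Y} {g : C(Y, ℂ)} (hg : ∀ y ∉ U, g y = 0) :
    specProj φ U * φ g = φ g :=
  supProj_mul (fun g : ContinuousMap.idealOfSet ℂ (U : Set Y) => φ g)
    ⟨g, ContinuousMap.mem_idealOfSet.2 fun y hy => hg y hy⟩

theorem mul_specProj_eq_zero {U : Opens Y} {T : H →L[ℂ] H}
    (h : ∀ g : C(Y, ℂ), (∀ y ∉ U, g y = 0) → T * φ g = 0) : T * specProj φ U = 0 :=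
  mul_supProj_eq_zero fun g => h g fun _ hy => ContinuousMap.mem_idealOfSet.1 g.2 hy

theorem mul_specProj_congr {U : Opens Y} {S T : H →L[ℂ] H}
    (h : ∀ g : C(Y, ℂ), (∀ y ∉ U, g y = 0) → S * φ g = T * φ g) :
    S * specProj φ U = T * specProj φ U := by
  rw [← sub_eq_zero, ← sub_mul]
  exact mul_specProj_eq_zero fun g hg => by rw [sub_mul, h g hg, sub_self]

theorem map_mul_comm (f g : C(Y, ℂ)) : φ f * φ g = φ g * φ f := by
  rw [← map_mul, mul_comm, map_mul]

theorem map_mul_specProj_comm (f : C(Y, ℂ)) (U : Opens Y) :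
    φ f * specProj φ U = specProj φ U * φ f :=
  supProj_commute' (fun g => map_mul_comm f g) fun g => by rw [← map_star, map_mul_comm]

theorem isPr_specProj (hφ : ∀ f, φ f ∈ N) (U : Opens Y) : IsPr N (specProj φ U) :=
  IsPr.sup fun g => hφ g

theorem specProj_comm (hφ : ∀ f, φ f ∈ N) (U V : Opens Y) :
    specProj φ U * specProj φ V = specProj φ V * specProj φ U :=
  supProj_commute' (fun g => (map_mul_specProj_comm _ _).symm) fun g => by
    rw [(isPr_specProj hφ U).sa, map_mul_specProj_comm]

theorem mul_specProj_eq_zero_of_cover [CompactSpace Y] [T2Space Y] {ι : Type*} {P : H →L[ℂ] H} {V : ι → Opens Y}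
    {U : Opens Y} (hP : ∀ i, P * specProj φ (V i) = 0) (hU : ∀ y ∈ U, ∃ i, y ∈ V i) :
    P * specProj φ U = 0 := by
  let J : Ideal C(Y, ℂ) :=
    { carrier := {g | P * φ g = 0}
      add_mem' := fun {a b} ha hb => by
        simp only [Set.mem_ofPred_eq] at ha hb ⊢
        rw [map_add, mul_add, ha, hb, add_zero]
      zero_mem' := by simp
      smul_mem' := fun c a ha => by
        simp only [Set.mem_ofPred_eq, smul_eq_mul] at ha ⊢
        rw [map_mul, map_mul_comm, ← mul_assoc, ha, zero_mul] }
  have hφc : Continuous φ :=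
    AddMonoidHomClass.continuous_of_bound φ 1 fun f => by
      rw [one_mul]
      exact NonUnitalStarAlgHom.norm_apply_le φ f
  have hJ : IsClosed (J : Set C(Y, ℂ)) :=
    isClosed_eq (continuous_const.mul hφc) continuous_const
  have hJ' := ContinuousMap.idealOfSet_ofIdeal_isClosed hJ
  refine mul_specProj_eq_zero fun g hg => ?_
  have hgJ : g ∈ J := by
    rw [← hJ', ContinuousMap.mem_idealOfSet]
    intro y hy
    refine hg y fun hyU => hy ?_
    obtain ⟨i, hi⟩ := hU y hyU
    have hi' : y ∈ (V i : Set Y) := hi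
    rw [← ContinuousMap.setOfIdeal_ofSet_of_isOpen ℂ (V i).isOpen,
      ContinuousMap.mem_setOfIdeal] at hi'
    obtain ⟨a, ha, hay⟩ := hi'
    refine ContinuousMap.mem_setOfIdeal.2 ⟨a, ?_, hay⟩
    change P * φ a = 0
    rw [← specProj_mul (φ := φ) (U := V i) fun y hy => ContinuousMap.mem_idealOfSet.1 ha hy,
      ← mul_assoc, hP, zero_mul]
  exact hgJ

theorem map_mul_specProj_le [CompactSpace Y] {f : C(Y, ℂ)} {U : Opens Y} {ε : ℝ} (hφ : ∀ f, φ f ∈ N)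
    (hε : 0 ≤ ε) (hf : ∀ y ∈ U, ‖f y‖ ≤ ε) : ‖φ f * specProj φ U‖ ≤ ε := by
  obtain ⟨a, haε, haf⟩ : ∃ a : C(Y, ℂ), (∀ y, ‖a y‖ ≤ ε) ∧ ∀ y ∈ U, a y = f y := by
    rcases hε.eq_or_lt with rfl | hε
    · exact ⟨0, fun y => by simp, fun y hy => (norm_le_zero_iff.1 (hf y hy)).symm⟩
    · have hpos : ∀ y, 0 < max ε ‖f y‖ := fun y => lt_max_of_lt_left hε
      refine ⟨⟨fun y => ((ε / max ε ‖f y‖ : ℝ) : ℂ) * f y, ?_⟩, fun y => ?_, fun y hy => ?_⟩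
      · refine (Complex.continuous_ofReal.comp (continuous_const.div ?_ fun y => (hpos y).ne')).mul
          f.continuous
        exact continuous_const.max f.continuous.norm
      · simp only [ContinuousMap.coe_mk, norm_mul, Complex.norm_real, norm_div, Real.norm_eq_abs,
          abs_of_pos hε, abs_of_pos (hpos y)]
        rw [div_mul_eq_mul_div, div_le_iff₀ (hpos y)]
        exact mul_le_mul_of_nonneg_left (le_max_right _ _) hε.le
      · simp only [ContinuousMap.coe_mk]
        rw [max_eq_left (hf y hy), div_self hε.ne', Complex.ofReal_one, one_mul]
  have h1 : φ f * specProj φ U = φ a * specProj φ U := mul_specProj_congr fun g hg => by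
    rw [← map_mul, ← map_mul]
    congr 1
    ext y
    by_cases hy : y ∈ U
    · simp [haf y hy]
    · simp [hg y hy]
  rw [h1]
  refine (norm_mul_le _ _).trans ?_
  have h2 : ‖specProj φ U‖ ≤ 1 := (Via.refl (isPr_specProj hφ U)).norm_le_one
  have h3 : ‖φ a‖ ≤ ε :=
    (NonUnitalStarAlgHom.norm_apply_le φ a).trans ((ContinuousMap.norm_le _ hε).2 haε)
  calc ‖φ a‖ * ‖specProj φ U‖ ≤ ε * 1 := mul_le_mul h3 h2 (norm_nonneg _) hε
    _ = ε := mul_one ε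

theorem specProj_top : specProj φ ⊤ = 1 := by
  have := specProj_mul (φ := φ) (U := ⊤) (g := 1) fun y hy => (hy trivial).elim
  rwa [map_one, mul_one] at this

theorem sys_specProj [CompactSpace Y] [T2Space Y] (hφ : ∀ f, φ f ∈ N) : Sys N (specProj φ) φ where
  isPr := isPr_specProj hφ
  inf U V := by
    have hU := isPr_specProj hφ U
    have hV := isPr_specProj hφ V
    have h1 : specProj φ (U ⊓ V) * (specProj φ U * specProj φ V) = specProj φ (U ⊓ V) :=
      supProj_le (hU.mul hV (specProj_comm hφ U V)) fun g => by
        have hg : ∀ y ∉ U ⊓ V, (g : C(Y, ℂ)) y = 0 := fun y hy =>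
          ContinuousMap.mem_idealOfSet.1 g.2 hy
        rw [mul_assoc, specProj_mul fun y hy => hg y fun h => hy h.2,
          specProj_mul fun y hy => hg y fun h => hy h.1]
    have h2 : (specProj φ (U ⊓ V) * specProj φ U) * specProj φ V
        = specProj φ U * specProj φ V := mul_specProj_congr fun g hg => by
      rw [mul_assoc, ← map_mul_specProj_comm, ← mul_assoc]
      refine mul_specProj_congr fun g' hg' => ?_
      rw [mul_assoc, ← map_mul, specProj_mul]
      intro y hy
      by_cases hyU : y ∈ U
      · rw [ContinuousMap.mul_apply, hg y fun hyV => hy ⟨hyU, hyV⟩, zero_mul]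
      · rw [ContinuousMap.mul_apply, hg' y hyU, mul_zero]
    rw [← h1, ← mul_assoc, h2]
  sup U V := by
    have hU := isPr_specProj hφ U
    have hV := isPr_specProj hφ V
    have hUV := isPr_specProj hφ (U ⊔ V)
    have hc := specProj_comm hφ U V
    have hle : ∀ {A B : Opens Y}, A ≤ B → specProj φ B * specProj φ A = specProj φ A :=
      fun {A B} hAB => by
        rw [← one_mul (specProj φ A), ← mul_assoc, mul_one]
        refine mul_specProj_congr fun g hg => ?_
        rw [specProj_mul fun y hy => hg y fun h => hy (hAB h), one_mul]
    have h0 : (1 - specProj φ U) * (1 - specProj φ V) * specProj φ (U ⊔ V) = 0 := by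
      refine mul_specProj_eq_zero_of_cover (ι := Bool) (V := fun b => if b then U else V) ?_ ?_
      · rintro (_ | _)
        · simp only [Bool.false_eq_true, if_false]
          rw [mul_assoc, sub_mul 1 (specProj φ V), hV.idem, one_mul, sub_self, mul_zero]
        · simp only [if_true]
          simp only [mul_assoc, sub_mul, mul_sub, one_mul, mul_one, ← hc, hU.idem,
            mul_mul_of_eq hU.idem, sub_self]
      · rintro y (hy | hy)
        · exact ⟨true, by simpa using hy⟩
        · exact ⟨false, by simpa using hy⟩
    have h1 := hle (le_sup_left : U ≤ U ⊔ V)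
    have h2 := hle (le_sup_right : V ≤ U ⊔ V)
    have h3 := le_symm' hU.sa hUV.sa h1
    have h4 := le_symm' hV.sa hUV.sa h2
    simp only [sub_mul, mul_sub, one_mul, mul_one, mul_assoc, h3, h4] at h0
    rw [← sub_eq_zero, ← h0]
    abel
  bot := by
    rw [← one_mul (specProj φ ⊥)]
    refine mul_specProj_eq_zero fun g hg => ?_
    have : g = 0 := by
      ext y
      exact hg y id
    rw [this, map_zero, mul_zero]
  mem := hφ
  comm := map_mul_specProj_comm
  top f := by rw [specProj_top, mul_one]
  near f U c ε hε h := by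
    have : φ f - c • 1 = φ (f - c • 1) := by rw [map_sub, map_smul, map_one]
    rw [this]
    refine map_mul_specProj_le hφ hε fun y hy => ?_
    simpa using h y hy

end Representation

section Closeness

variable {H : Type*} [NormedAddCommGroup H] [InnerProductSpace ℂ H] [CompleteSpace H]
variable {N : VonNeumannAlgebra H} {e f a b t q : H →L[ℂ] H}

theorem IsPr.eq_zero_of_norm_lt_one (hq : IsPr N q) (h : ‖q‖ < 1) : q = 0 := by
  have h1 : ‖q‖ = ‖q‖ * ‖q‖ := by
    conv_lhs => rw [← hq.idem]
    nth_rw 1 [← hq.sa]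
    exact CStarRing.norm_star_mul_self
  have h2 : ‖q‖ = 0 := by
    by_contra h0
    exact h.ne (mul_left_cancel₀ h0 (by rw [← h1, mul_one]))
  exact norm_eq_zero.1 h2

/-- A projection on which an approximate intertwiner is bounded below is subequivalent to the
target. -/
theorem sub_of_close (he : IsPr N e) (hf : IsPr N f) (ht : t ∈ N) (hb : b ∈ N) (hae : a * e = e)
    (hfb : f * b = b) (h1 : ‖b * star t - star t * a‖ ≤ 1 / 2)
    (h2 : ‖t * star t - 1‖ ≤ 1 / 4) : Sub N e f := by
  set T := b * star t * e with hT
  have hTN : T ∈ N := mul_mem (mul_mem hb (star_mem ht)) he.mem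
  have hE : IsPr N (rangeProj (star T)) := IsPr.range (star_mem hTN)
  have hle : e * rangeProj (star T) = rangeProj (star T) := by
    conv_rhs => rw [← one_mul (rangeProj (star T))]
    refine mul_rangeProj_congr ?_
    rw [hT, star_mul, he.sa, ← mul_assoc, he.idem, one_mul]
  have hq := he.sub hE (le_symm' hE.sa he.sa hle)
  have hTe : T * e = T := by rw [hT, mul_assoc, he.idem]
  have hTq : T * (e - rangeProj (star T)) = 0 := by
    rw [mul_sub, hTe, mul_rangeProj_star, sub_self]
  have heq : e * (e - rangeProj (star T)) = e - rangeProj (star T) := by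
    rw [mul_sub, he.idem, hle]
  have hq0 : e - rangeProj (star T) = 0 := by
    refine hq.eq_zero_of_norm_lt_one ?_
    generalize e - rangeProj (star T) = q at hq hTq heq ⊢
    have hq1 : ‖q‖ ≤ 1 := (Via.refl hq).norm_le_one
    have hbq : b * star t * q = 0 := by rw [← heq, ← mul_assoc]; exact hTq
    have haq : a * q = q := by rw [← heq, ← mul_assoc, hae]
    have h3 : star t * q = -((b * star t - star t * a) * q) := by
      rw [sub_mul, hbq, mul_assoc, haq, zero_sub, neg_neg]
    have h4 : ‖star t * q‖ ≤ 1 / 2 := by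
      rw [h3, norm_neg]
      refine (norm_mul_le _ _).trans ?_
      nlinarith [norm_nonneg q, norm_nonneg (b * star t - star t * a)]
    have h5 : q = star (star t * q) * (star t * q) - q * ((t * star t - 1) * q) := by
      rw [star_mul, star_star, hq.sa, sub_mul, mul_sub, one_mul, hq.idem]
      simp only [mul_assoc]
      abel
    have h6 : ‖star (star t * q) * (star t * q)‖ ≤ 1 / 4 := by
      rw [CStarRing.norm_star_mul_self]
      nlinarith [norm_nonneg (star t * q)]
    have h7 : ‖q * ((t * star t - 1) * q)‖ ≤ 1 / 4 := by
      refine (norm_mul_le _ _).trans ?_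
      have h8 := norm_mul_le (t * star t - 1) q
      have h9 : ‖(t * star t - 1) * q‖ ≤ 1 / 4 :=
        h8.trans (by nlinarith [norm_nonneg q, norm_nonneg (t * star t - 1)])
      nlinarith [norm_nonneg q, norm_nonneg ((t * star t - 1) * q)]
    rw [h5]
    refine (norm_sub_le _ _).trans_lt ?_
    linarith
  have hee : rangeProj (star T) = e := (sub_eq_zero.1 hq0).symm
  have hle' : f * rangeProj T = rangeProj T := by
    conv_rhs => rw [← one_mul (rangeProj T)]
    refine mul_rangeProj_congr ?_
    rw [hT, ← mul_assoc, ← mul_assoc, hfb, one_mul]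
  have heqv := Eqv.range hTN
  rw [hee] at heqv
  exact ⟨_, heqv, le_symm' (IsPr.range hTN).sa hf.sa hle', hf⟩

/-- Existence of approximately unitary approximate intertwiners in `N`. -/
def Close (N : VonNeumannAlgebra H) {F : Type*} (x y : F → H →L[ℂ] H) : Prop :=
  ∀ f, ∀ ε > 0, ∃ t ∈ N, ‖x f * t - t * y f‖ ≤ ε ∧ ‖star t * t - 1‖ ≤ ε ∧ ‖t * star t - 1‖ ≤ ε

variable {Y : Type*} [TopologicalSpace Y] {φ ψ : C(Y, ℂ) →⋆ₐ[ℂ] (H →L[ℂ] H)}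

theorem Close.symm (h : Close N φ ψ) : Close N ψ φ := by
  intro f ε hε
  obtain ⟨t, ht, h1, h2, h3⟩ := h (star f) ε hε
  refine ⟨star t, star_mem ht, ?_, by rwa [star_star], by rwa [star_star]⟩
  rw [← norm_star, star_sub, star_mul, star_mul, star_star, ← map_star, ← map_star, norm_sub_rev]
  exact h1

theorem exists_exhaustion [MetrizableSpace Y] (U : Opens Y) :
    ∃ (V : ℕ → Opens Y) (h : ℕ → C(Y, ℂ)), V 0 = ⊥ ∧ (∀ n, V n ≤ V (n + 1)) ∧
      (∀ y ∈ U, ∃ n, y ∈ V n) ∧ (∀ n, ∀ y ∉ U, h n y = 0) ∧ ∀ n, ∀ y ∈ V n, h n y = 1 := by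
  let := metrizableSpaceMetric Y
  obtain ⟨d, hd, hd1, hdU, hd0⟩ : ∃ d : Y → ℝ, Continuous d ∧ (∀ y, d y ≤ 1) ∧
      (∀ y ∈ U, 0 < d y) ∧ ∀ y ∉ U, d y = 0 := by
    by_cases hU : (U : Set Y)ᶜ.Nonempty
    · refine ⟨fun y => min 1 (Metric.infDist y (U : Set Y)ᶜ),
        continuous_const.min (Metric.continuous_infDist_pt _), fun y => min_le_left _ _,
        fun y hy => lt_min one_pos ?_, fun y hy => ?_⟩
      · exact (U.isOpen.isClosed_compl.notMem_iff_infDist_pos hU).1 fun h => h hy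
      · simp only [Metric.infDist_zero_of_mem (show y ∈ (U : Set Y)ᶜ from hy)]
        exact min_eq_right zero_le_one
    · rw [Set.not_nonempty_iff_eq_empty, Set.compl_empty_iff] at hU
      exact ⟨fun _ => 1, continuous_const, fun _ => le_rfl, fun _ _ => one_pos, fun y hy =>
        (hy (show y ∈ (U : Set Y) from hU ▸ trivial)).elim⟩
  refine ⟨fun n => ⟨{y | 1 < (n + 1) * d y}, isOpen_lt continuous_const (continuous_const.mul hd)⟩,
    fun n => ⟨fun y => ((min 1 ((n + 1) * d y) : ℝ) : ℂ), Complex.continuous_ofReal.comp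
      (continuous_const.min (continuous_const.mul hd))⟩, ?_, fun n y hy => ?_, fun y hy => ?_,
    fun n y hy => ?_, fun n y hy => ?_⟩
  · ext y
    simpa using hd1 y
  · have hy' : 1 < (n + 1) * d y := hy
    change (1 : ℝ) < ((n + 1 : ℕ) + 1) * d y
    push_cast
    nlinarith [show (0 : ℝ) ≤ n from n.cast_nonneg]
  · obtain ⟨n, hn⟩ := exists_nat_gt (1 / d y)
    refine ⟨n, ?_⟩
    change 1 < (n + 1) * d y
    have := (div_lt_iff₀ (hdU y hy)).1 hn
    nlinarith [hdU y hy]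
  · simp [hd0 y hy]
  · have hy' : 1 < (n + 1) * d y := hy
    simp [min_eq_left hy'.le]

theorem Close.sub [CompactSpace Y] [MetrizableSpace Y] (h : Close N φ ψ) (hφ : ∀ f, φ f ∈ N)
    (hψ : ∀ f, ψ f ∈ N) (U : Opens Y) : Sub N (specProj φ U) (specProj ψ U) := by
  obtain ⟨V, k, hV0, hV, hVU, hk0, hk1⟩ := exists_exhaustion U
  have hS := sys_specProj hφ
  have hE : ∀ n, Sub N (specProj φ (V n)) (specProj ψ U) := fun n => by
    obtain ⟨t, ht, h1, -, h3⟩ := h (star (k n)) (1 / 4) (by norm_num)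
    refine sub_of_close (a := φ (k n)) (b := ψ (k n)) (isPr_specProj hφ _) (isPr_specProj hψ _) ht
      (hψ _) ?_ (specProj_mul (hk0 n)) ?_ h3
    · conv_rhs => rw [← one_mul (specProj φ (V n))]
      refine mul_specProj_congr fun g hg => ?_
      rw [one_mul, ← map_mul]
      congr 1
      ext y
      by_cases hy : y ∈ V n
      · simp [hk1 n y hy]
      · simp [hg y hy]
    · rw [← norm_star, star_sub, star_mul, star_mul, star_star, ← map_star, ← map_star,
        norm_sub_rev]
      exact h1.trans (by norm_num)
  have hsup := sub_supProj_of_mono (E := fun n => specProj φ (V n)) (by rw [hV0, hS.bot])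
    (fun n => hS.mul_of_le (hV n)) hE
  refine Sub.trans (Sub.of_le (isPr_specProj hφ U)
    (IsPr.sup fun n => (isPr_specProj hφ (V n)).mem) ?_) hsup
  have hP : IsPr N (supProj fun n => specProj φ (V n)) :=
    IsPr.sup fun n => (isPr_specProj hφ (V n)).mem
  have h0 : (1 - supProj fun n => specProj φ (V n)) * specProj φ U = 0 := by
    refine mul_specProj_eq_zero_of_cover (V := V) (fun n => ?_) hVU
    rw [sub_mul, one_mul, supProj_mul (fun n => specProj φ (V n)), sub_self]
  rw [sub_mul, one_mul, sub_eq_zero] at h0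
  exact le_symm' (isPr_specProj hφ U).sa hP.sa h0.symm

/-- Approximately equivalent representations of `C(Y)` are connected. -/
theorem Close.conn [CompactSpace Y] [MetrizableSpace Y] (h : Close N φ ψ) (hφ : ∀ f, φ f ∈ N)
    (hψ : ∀ f, ψ f ∈ N) : Conn N 1 φ 1 ψ := by
  obtain ⟨W, δ, hW⟩ := exists_fine Y
  exact (sys_specProj hφ).conn_of_eqv_top (sys_specProj hψ) hW specProj_top specProj_top
    fun U => (h.sub hφ hψ U).antisymm (h.symm.sub hψ hφ U)

end Closeness

section Units

variable {K : Type*} [Fintype K] {n : K → ℕ}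

/-- A system of matrix units of a finite-dimensional algebra `⊕ₖ M_{n k}`. -/
structure IsUnits {B : Type*} [Ring B] [StarRing B] (E : ∀ k, Fin (n k) → Fin (n k) → B) :
    Prop where
  mul_same : ∀ k i j l, E k i j * E k j l = E k i l
  orth : ∀ p q : Σ k, Fin (n k), p ≠ q → ∀ i j, E p.1 i p.2 * E q.1 q.2 j = 0
  star_eq : ∀ k i j, star (E k i j) = E k j i
  sum_eq : ∑ p : Σ k, Fin (n k), E p.1 p.2 p.2 = 1

theorem IsUnits.map {B C : Type*} [Ring B] [StarRing B] [Algebra ℂ B] [Ring C] [StarRing C]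
    [Algebra ℂ C] {E : ∀ k, Fin (n k) → Fin (n k) → B} (h : IsUnits E) (π : B →⋆ₐ[ℂ] C) :
    IsUnits fun k i j => π (E k i j) where
  mul_same k i j l := by rw [← map_mul, h.mul_same]
  orth p q hpq i j := by rw [← map_mul, h.orth p q hpq, map_zero]
  star_eq k i j := by rw [← map_star, h.star_eq]
  sum_eq := by rw [← map_sum, h.sum_eq, map_one]

/-- The zeroth index. -/
def zeroIdx {m : ℕ} (i : Fin m) : Fin m := ⟨0, i.pos⟩

/-- The average of `w` intertwining two systems of matrix units. -/
def avg {B : Type*} [Ring B] (P Q w : ∀ k, Fin (n k) → Fin (n k) → B) : B :=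
  ∑ p : Σ k, Fin (n k), P p.1 p.2 (zeroIdx p.2) *
    (w p.1 (zeroIdx p.2) (zeroIdx p.2) * Q p.1 (zeroIdx p.2) p.2)

theorem avg_mul {B : Type*} [Ring B] [StarRing B] {P Q w : ∀ k, Fin (n k) → Fin (n k) → B}
    (hP : IsUnits P) (hQ : IsUnits Q) (k : K) (i j : Fin (n k)) :
    avg P Q w * Q k i j = P k i j * avg P Q w := by
  classical
  rw [avg, Finset.sum_mul, Finset.mul_sum, Finset.sum_eq_single (⟨k, i⟩ : Σ k, Fin (n k)),
    Finset.sum_eq_single (⟨k, j⟩ : Σ k, Fin (n k))]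
  · rw [mul_assoc, mul_assoc, hQ.mul_same, ← mul_assoc (P k i j), hP.mul_same]
    rfl
  · intro p _ hp
    rw [← mul_assoc, hP.orth ⟨k, j⟩ p hp.symm, zero_mul]
  · simp
  · intro p _ hp
    rw [mul_assoc, mul_assoc, hQ.orth p ⟨k, i⟩ hp, mul_zero, mul_zero]
  · simp

variable {H : Type*} [NormedAddCommGroup H] [InnerProductSpace ℂ H] [CompleteSpace H]
variable {M : VonNeumannAlgebra H} {P Q : ∀ k, Fin (n k) → Fin (n k) → H →L[ℂ] H}

theorem IsUnits.isPr (hP : IsUnits P) (hPM : ∀ k i j, P k i j ∈ M) (k : K) (i : Fin (n k)) :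
    IsPr M (P k i i) :=
  ⟨hPM k i i, hP.mul_same k i i i, hP.star_eq k i i⟩

theorem IsUnits.via (hP : IsUnits P) (hPM : ∀ k i j, P k i j ∈ M) (k : K) (i j : Fin (n k)) :
    Via M (P k i j) (P k j j) (P k i i) :=
  ⟨hPM k i j, by rw [hP.star_eq, hP.mul_same], by rw [hP.star_eq, hP.mul_same], hP.isPr hPM k j⟩

theorem IsUnits.orth_diag (hP : IsUnits P) {p q : Σ k, Fin (n k)} (h : p ≠ q) :
    P p.1 p.2 p.2 * P q.1 q.2 q.2 = 0 :=
  hP.orth p q h _ _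

/-- Systems of matrix units with equivalent diagonals are unitarily equivalent. -/
theorem IsUnits.exists_intertwiner (hP : IsUnits P) (hQ : IsUnits Q) (hPM : ∀ k i j, P k i j ∈ M)
    (hQM : ∀ k i j, Q k i j ∈ M) (h : ∀ k i, Eqv M (Q k i i) (P k i i)) :
    ∃ s, Via M s 1 1 ∧ ∀ k i j, s * Q k i j = P k i j * s := by
  choose v hv using h
  refine ⟨avg P Q fun k i _ => v k i, ?_, avg_mul hP hQ⟩
  have h1 := Via.sum (N := M) Finset.univ
    (fun p _ => ((hQ.via hQM p.1 (zeroIdx p.2) p.2).trans (hv p.1 (zeroIdx p.2))).trans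
      (hP.via hPM p.1 p.2 (zeroIdx p.2))) (fun p _ q _ hpq => hQ.orth_diag hpq)
      (fun p _ q _ hpq => hP.orth_diag hpq)
  rwa [hP.sum_eq, hQ.sum_eq] at h1

theorem IsUnits.norm_le_one (hP : IsUnits P) (hPM : ∀ k i j, P k i j ∈ M) (k : K)
    (i j : Fin (n k)) : ‖P k i j‖ ≤ 1 :=
  (hP.via hPM k i j).norm_le_one

theorem IsUnits.norm_avg_sub_le (hP : IsUnits P) (hPM : ∀ k i j, P k i j ∈ M) {u : H →L[ℂ] H}
    {ε : ℝ} (hu : ∀ k i j, ‖P k i j * u - u * P k i j‖ ≤ ε) :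
    ‖avg P P (fun _ _ _ => u) - u‖ ≤ Fintype.card (Σ k, Fin (n k)) * ε := by
  have h1 : avg P P (fun _ _ _ => u) - u = ∑ p : Σ k, Fin (n k), P p.1 p.2 (zeroIdx p.2) *
      (u * P p.1 (zeroIdx p.2) p.2 - P p.1 (zeroIdx p.2) p.2 * u) := by
    have h2 : u = ∑ p : Σ k, Fin (n k), P p.1 p.2 (zeroIdx p.2) *
        (P p.1 (zeroIdx p.2) p.2 * u) := by
      conv_lhs => rw [← one_mul u, ← hP.sum_eq, Finset.sum_mul]
      refine Finset.sum_congr rfl fun p _ => ?_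
      rw [← mul_assoc, hP.mul_same]
    conv_lhs => rw [avg]; enter [2]; rw [h2]
    rw [← Finset.sum_sub_distrib]
    refine Finset.sum_congr rfl fun p _ => ?_
    rw [mul_sub]
  rw [h1]
  refine (norm_sum_le _ _).trans ((Finset.sum_le_sum (g := fun _ => ε) fun p _ => ?_).trans ?_)
  · refine (norm_mul_le _ _).trans ?_
    rw [norm_sub_rev]
    have := hP.norm_le_one hPM p.1 p.2 (zeroIdx p.2)
    have h3 := hu p.1 (zeroIdx p.2) p.2
    nlinarith [norm_nonneg (P p.1 p.2 (zeroIdx p.2)),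
      norm_nonneg (P p.1 (zeroIdx p.2) p.2 * u - u * P p.1 (zeroIdx p.2) p.2)]
  · rw [Finset.sum_const, Finset.card_univ, nsmul_eq_mul]

end Units

section Reduction

variable {H : Type*} [NormedAddCommGroup H] [InnerProductSpace ℂ H] [CompleteSpace H]

/-- The von Neumann algebra of the elements of `M` commuting with a set and its adjoints. -/
noncomputable def relCommutant (M : VonNeumannAlgebra H) (S : Set (H →L[ℂ] H)) :
    VonNeumannAlgebra H where
  toStarSubalgebra := StarSubalgebra.centralizer ℂ ((M.commutant : Set (H →L[ℂ] H)) ∪ S)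
  centralizer_centralizer' := Set.centralizer_centralizer_centralizer _

theorem mem_relCommutant {M : VonNeumannAlgebra H} {S : Set (H →L[ℂ] H)} {T : H →L[ℂ] H} :
    T ∈ relCommutant M S ↔ T ∈ M ∧ ∀ g ∈ S, g * T = T * g ∧ star g * T = T * star g := by
  have h : T ∈ relCommutant M S ↔
      T ∈ StarSubalgebra.centralizer ℂ ((M.commutant : Set (H →L[ℂ] H)) ∪ S) := Iff.rfl
  rw [h, StarSubalgebra.mem_centralizer_iff]
  constructor
  · intro hT
    exact ⟨mem_of_commute fun c hc => (hT c (Or.inl hc)).1, fun g hg => hT g (Or.inr hg)⟩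
  · rintro ⟨hT, hS⟩ g (hg | hg)
    · exact ⟨commute_of_mem hT hg, commute_of_mem hT (star_mem hg)⟩
    · exact hS g hg

/-- Conjugation by a unitary. -/
noncomputable def conjHom (s : H →L[ℂ] H) (h1 : star s * s = 1) (h2 : s * star s = 1) :
    (H →L[ℂ] H) →⋆ₐ[ℂ] (H →L[ℂ] H) where
  toFun x := star s * x * s
  map_one' := by rw [mul_one, h1]
  map_mul' x y := by
    simp only [mul_assoc]
    rw [← mul_assoc s (star s), h2, one_mul]
  map_zero' := by rw [mul_zero, zero_mul]
  map_add' x y := by rw [mul_add, add_mul]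
  commutes' r := by
    rw [Algebra.algebraMap_eq_smul_one, mul_smul_comm, smul_mul_assoc, mul_one, h1]
  map_star' x := by rw [star_mul, star_mul, star_star, mul_assoc]

/-- Two maps are approximately unitarily equivalent in `M`. -/
def ApproxEquiv {B : Type*} (M : VonNeumannAlgebra H) (π ρ : B → H →L[ℂ] H) : Prop :=
  ∀ (F : Finset B), ∀ ε > 0, ∃ u, Via M u 1 1 ∧ ∀ b ∈ F, ‖π b * u - u * ρ b‖ ≤ ε

variable {K : Type*} [Fintype K] {n : K → ℕ}
variable {B : Type*} [Ring B] [StarRing B] [Algebra ℂ B] {E : ∀ k, Fin (n k) → Fin (n k) → B}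
variable {M : VonNeumannAlgebra H} {π ρ : B →⋆ₐ[ℂ] (H →L[ℂ] H)}

theorem ApproxEquiv.eqv (h : ApproxEquiv M π ρ) (hπ : ∀ b, π b ∈ M) (hρ : ∀ b, ρ b ∈ M) {p : B}
    (hp : p * p = p) (hs : star p = p) : Eqv M (ρ p) (π p) := by
  have e1 : IsPr M (π p) := ⟨hπ p, by rw [← map_mul, hp], by rw [← map_star, hs]⟩
  have e2 : IsPr M (ρ p) := ⟨hρ p, by rw [← map_mul, hp], by rw [← map_star, hs]⟩
  obtain ⟨u, hu, h1⟩ := h {p} (1 / 2) (by norm_num)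
  have h1 := h1 p (Finset.mem_singleton_self p)
  refine Sub.antisymm ?_ ?_
  · refine sub_of_close e2 e1 (star_mem hu.mem) e1.mem e2.idem e1.idem ?_ ?_
    · rwa [star_star]
    · rw [star_star, hu.init, sub_self, norm_zero]
      norm_num
  · refine sub_of_close e1 e2 hu.mem e2.mem e1.idem e2.idem ?_ ?_
    · rw [← norm_star, star_sub, star_mul, star_mul, star_star, e1.sa, e2.sa, norm_sub_rev]
      exact h1
    · rw [hu.fin, sub_self, norm_zero]
      norm_num

theorem norm_star_mul_self_sub_one_le {u t : H →L[ℂ] H} {d : ℝ} (hu : star u * u = 1)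
    (hn : ‖u‖ ≤ 1) (hd : ‖t - u‖ ≤ d) : ‖star t * t - 1‖ ≤ 2 * d + d * d := by
  have h1 : star t * t - 1 =
      star u * (t - u) + star (t - u) * u + star (t - u) * (t - u) := by
    rw [← hu, star_sub]
    simp only [mul_sub, sub_mul]
    abel
  have h0 := norm_nonneg (t - u)
  have h2 : ‖star u * (t - u)‖ ≤ d := by
    refine (norm_mul_le _ _).trans ?_
    rw [norm_star]
    nlinarith [norm_nonneg u]
  have h3 : ‖star (t - u) * u‖ ≤ d := by
    refine (norm_mul_le _ _).trans ?_
    rw [norm_star]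
    nlinarith [norm_nonneg u]
  have h4 : ‖star (t - u) * (t - u)‖ ≤ d * d := by
    refine (norm_mul_le _ _).trans ?_
    rw [norm_star]
    nlinarith
  rw [h1]
  refine (norm_add₃_le).trans ?_
  linarith

variable {Y : Type*} [TopologicalSpace Y] {ι : C(Y, ℂ) →⋆ₐ[ℂ] B} {s : H →L[ℂ] H}

theorem star_intertwine (hE : IsUnits E) (hs : ∀ k i j, s * ρ (E k i j) = π (E k i j) * s) (k : K)
    (i j : Fin (n k)) : ρ (E k i j) * star s = star s * π (E k i j) := by
  have := congrArg star (hs k j i)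
  rwa [star_mul, star_mul, ← map_star, ← map_star, hE.star_eq] at this

theorem ApproxEquiv.close (h : ApproxEquiv M π ρ) (hE : IsUnits E)
    (hρ : ∀ b, ρ b ∈ M) (hsV : Via M s 1 1)
    (hs : ∀ k i j, s * ρ (E k i j) = π (E k i j) * s) :
    Close (relCommutant M {T | ∃ k i j, T = ρ (E k i j)})
      (((conjHom s hsV.init hsV.fin).comp π).comp ι) (ρ.comp ι) := by
  classical
  intro f ε hε
  set x := star s * π (ι f) * s with hx
  set y := ρ (ι f) with hy
  set K' : ℝ := (Fintype.card (Σ k, Fin (n k)) : ℝ) with hK'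
  have hK0 : 0 ≤ K' := Nat.cast_nonneg _
  set C := ‖x‖ + ‖y‖ with hC
  have hC0 : 0 ≤ C := by positivity
  set L := 1 + C * K' + 2 * K' + K' * K' with hL
  have hL0 : 0 < L := by positivity
  set η := min 1 (ε / L) with hη
  have hη0 : 0 < η := lt_min one_pos (by positivity)
  have hη1 : η ≤ 1 := min_le_left _ _
  have hηL : η * L ≤ ε := by
    have := min_le_right 1 (ε / L)
    rwa [le_div_iff₀ hL0] at this
  obtain ⟨u, hu, hb⟩ := h (insert (ι f)
    (Finset.univ.image fun q : Σ k, Fin (n k) × Fin (n k) => E q.1 q.2.1 q.2.2)) η hη0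
  have hV : Via M (star s * u) 1 1 := hu.trans hsV.symm
  set w := star s * u with hw
  have hsn : ‖star s‖ ≤ 1 := hsV.symm.norm_le_one
  have hQ := hE.map ρ
  have hcomm : ∀ k i j, ‖ρ (E k i j) * w - w * ρ (E k i j)‖ ≤ η := by
    intro k i j
    have h1 : ρ (E k i j) * w - w * ρ (E k i j) =
        star s * (π (E k i j) * u - u * ρ (E k i j)) := by
      rw [hw, ← mul_assoc, star_intertwine hE hs, mul_sub, mul_assoc, mul_assoc]
    have h2 := hb (E k i j) (Finset.mem_insert_of_mem
      (Finset.mem_image.2 ⟨⟨k, i, j⟩, Finset.mem_univ _, rfl⟩))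
    rw [h1]
    refine (norm_mul_le _ _).trans ?_
    nlinarith [norm_nonneg (π (E k i j) * u - u * ρ (E k i j))]
  have hd := hQ.norm_avg_sub_le (fun k i j => hρ _) hcomm
  set t := avg (fun k i j => ρ (E k i j)) (fun k i j => ρ (E k i j)) (fun _ _ _ => w) with ht
  have hd2 : 2 * (K' * η) + K' * η * (K' * η) ≤ ε := by
    have : η * η ≤ η := by nlinarith
    have h3 : K' * K' * (η * η) ≤ K' * K' * η := by gcongr
    have h4 : 0 ≤ C * K' * η := by positivity
    have h5 : η * L = η + C * K' * η + 2 * (K' * η) + K' * K' * η := by rw [hL]; ring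
    nlinarith
  refine ⟨t, ?_, ?_, ?_, ?_⟩
  · refine mem_relCommutant.2 ⟨?_, ?_⟩
    · exact sum_mem fun p _ => mul_mem (hρ _) (mul_mem hV.mem (hρ _))
    · rintro _ ⟨k, i, j, rfl⟩
      have h1 : ∀ k i j, t * ρ (E k i j) = ρ (E k i j) * t := avg_mul hQ hQ
      refine ⟨(h1 k i j).symm, ?_⟩
      rw [← map_star, hE.star_eq]
      exact (h1 k j i).symm
  · have h1 : x * t - t * y = star s * (π (ι f) * u - u * ρ (ι f)) +
        (x * (t - w) - (t - w) * y) := by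
      rw [mul_sub x, sub_mul t, hx, hw, mul_sub (star s)]
      simp only [mul_assoc, mul_mul_of_eq hsV.fin, one_mul]
      abel
    have h2 := hb (ι f) (Finset.mem_insert_self _ _)
    change ‖x * t - t * y‖ ≤ ε
    have h3 : ‖star s * (π (ι f) * u - u * ρ (ι f))‖ ≤ η := by
      refine (norm_mul_le _ _).trans ?_
      nlinarith [norm_nonneg (π (ι f) * u - u * ρ (ι f))]
    have h4 : ‖x * (t - w)‖ ≤ ‖x‖ * (K' * η) := (norm_mul_le _ _).trans (by gcongr)
    have h5 : ‖(t - w) * y‖ ≤ (K' * η) * ‖y‖ := (norm_mul_le _ _).trans (by gcongr)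
    have h6 : ‖x * t - t * y‖ ≤ η + (‖x‖ * (K' * η) + (K' * η) * ‖y‖) := by
      rw [h1]
      exact (norm_add_le _ _).trans (add_le_add h3 ((norm_sub_le _ _).trans (add_le_add h4 h5)))
    have h7 : η * L = η + (‖x‖ * (K' * η) + (K' * η) * ‖y‖) + η * (2 * K' + K' * K') := by
      rw [hL, hC]; ring
    have h8 : 0 ≤ η * (2 * K' + K' * K') := by positivity
    linarith
  · exact (norm_star_mul_self_sub_one_le hV.init hV.norm_le_one hd).trans hd2
  · have h1 := norm_star_mul_self_sub_one_le (u := star w) (t := star t) (d := K' * η)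
      (by rw [star_star, hV.fin]) hV.symm.norm_le_one (by rw [← star_sub, norm_star]; exact hd)
    rw [star_star] at h1
    exact h1.trans hd2

theorem ApproxEquiv.conn [CompactSpace Y] [MetrizableSpace Y] (h : ApproxEquiv M π ρ)
    (hE : IsUnits E) (hι : ∀ f k i j, ι f * E k i j = E k i j * ι f)
    (hspan : ∀ b, ∃ f : ∀ k, Fin (n k) → Fin (n k) → C(Y, ℂ),
      b = ∑ k, ∑ i, ∑ j, ι (f k i j) * E k i j)
    (hπ : ∀ b, π b ∈ M) (hρ : ∀ b, ρ b ∈ M) : Conn M 1 π 1 ρ := by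
  obtain ⟨s, hsV, hs⟩ := (hE.map π).exists_intertwiner (M := M) (hE.map ρ) (fun _ _ _ => hπ _)
    (fun _ _ _ => hρ _) fun k i => h.eqv hπ hρ (hE.mul_same k i i i) (hE.star_eq k i i)
  have hcl := h.close (ι := ι) hE hρ hsV hs
  have hsE := star_intertwine (n := n) hE hs
  obtain ⟨γ, hγc, hγV, hγ⟩ := hcl.conn (fun f => by
    refine mem_relCommutant.2 ⟨mul_mem (mul_mem hsV.symm.mem (hπ _)) hsV.mem, ?_⟩
    have h1 : ∀ k i j, ρ (E k i j) * (star s * π (ι f) * s) =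
        star s * π (ι f) * s * ρ (E k i j) := by
      intro k i j
      rw [← mul_assoc, ← mul_assoc, hsE, mul_assoc _ s, hs, mul_assoc (star s), ← map_mul, ← hι,
        map_mul]
      simp only [mul_assoc]
    rintro _ ⟨k, i, j, rfl⟩
    refine ⟨h1 k i j, ?_⟩
    rw [← map_star, hE.star_eq]
    exact h1 k j i) (fun f => by
    refine mem_relCommutant.2 ⟨hρ _, ?_⟩
    have h1 : ∀ k i j, ρ (E k i j) * ρ (ι f) = ρ (ι f) * ρ (E k i j) := by
      intro k i j
      rw [← map_mul, ← hι, map_mul]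
    rintro _ ⟨k, i, j, rfl⟩
    refine ⟨h1 k i j, ?_⟩
    rw [← map_star, hE.star_eq]
    exact h1 k j i)
  have hVM : ∀ t ∈ Set.Ico (0 : ℝ) 1, Via M (s * γ t) 1 1 := fun t ht =>
    Via.trans ⟨(mem_relCommutant.1 (hγV t ht).mem).1, (hγV t ht).init, (hγV t ht).fin, IsPr.one⟩ hsV
  refine ⟨fun t => s * γ t, continuousOn_const.mul hγc, hVM, fun b => ?_⟩
  obtain ⟨f, rfl⟩ := hspan b
  have h1 : ∀ f, Tendsto (fun t => star (s * γ t) * π (ι f) * (s * γ t)) (𝓝[Set.Ico 0 1] 1)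
      (𝓝 (ρ (ι f))) := fun f => by
    refine (hγ f).congr fun t => ?_
    change star (γ t) * (star s * π (ι f) * s) * γ t = _
    rw [star_mul]
    simp only [mul_assoc]
  have h2 : ∀ f k i j, Tendsto (fun t => star (s * γ t) * π (ι f * E k i j) * (s * γ t))
      (𝓝[Set.Ico 0 1] 1) (𝓝 (ρ (ι f * E k i j))) := fun f k i j => by
    rw [map_mul, map_mul]
    refine ((h1 f).mul_const (ρ (E k i j))).congr' ?_
    filter_upwards [self_mem_nhdsWithin] with t ht
    have h3 := ((mem_relCommutant.1 (hγV t ht).mem).2 _ ⟨k, i, j, rfl⟩).1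
    rw [mul_assoc _ (s * γ t), mul_assoc s, ← h3, ← mul_assoc s, hs]
    simp only [mul_assoc]
  simp only [map_sum, Finset.mul_sum, Finset.sum_mul]
  exact tendsto_finsetSum _ fun k _ => tendsto_finsetSum _ fun i _ =>
    tendsto_finsetSum _ fun j _ => h2 _ k i j

end Reduction

section Homogeneous

variable {t : ℕ} {n : Fin t → ℕ} {X : Fin t → Type*} [∀ k, TopologicalSpace (X k)]

/-- The matrix units of a homogeneous algebra. -/
noncomputable def homUnit (k : Fin t) (i j : Fin (n k)) :
    Π k : Fin t, Matrix (Fin (n k)) (Fin (n k)) C(X k, ℂ) :=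
  Pi.single k (Matrix.single i j 1)

theorem isUnits_homUnit : IsUnits (homUnit (n := n) (X := X)) where
  mul_same k i j l := by
    rw [homUnit, homUnit, homUnit, ← Pi.single_mul, Matrix.single_mul_single_same, one_mul]
  orth := by
    rintro ⟨k, i⟩ ⟨l, j⟩ hpq i' j'
    by_cases hkl : k = l
    · subst hkl
      have hij : i ≠ j := fun h => hpq (by rw [h])
      simp only [homUnit]
      rw [← Pi.single_mul, Matrix.single_mul_single_of_ne _ _ _ _ hij, Pi.single_zero]
    · ext1 m
      by_cases hm : m = k
      · subst hm
        simp [homUnit, Pi.single_eq_of_ne hkl]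
      · simp [homUnit, Pi.single_eq_of_ne hm]
  star_eq k i j := by
    rw [homUnit, homUnit, ← Pi.single_star, Matrix.star_eq_conjTranspose,
      Matrix.conjTranspose_single, star_one]
  sum_eq := by
    rw [Fintype.sum_sigma]
    simp only [homUnit]
    ext1 m
    rw [Finset.sum_apply, Finset.sum_eq_single m]
    · rw [Finset.sum_apply]
      simp only [Pi.single_eq_same]
      exact Matrix.sum_single_one
    · intro k _ hk
      rw [Finset.sum_apply]
      simp [Pi.single_eq_of_ne hk.symm]
    · simp

/-- The inclusion of the central functions in a homogeneous algebra. -/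
noncomputable def homCenter : C(Σ k, X k, ℂ) →⋆ₐ[ℂ] Π k : Fin t, Matrix (Fin (n k)) (Fin (n k)) C(X k, ℂ) where
  toFun f k := Matrix.diagonal fun _ => f.comp (ContinuousMap.sigmaMk k)
  map_one' := funext fun _ => Matrix.diagonal_one
  map_mul' f g := funext fun k => (Matrix.diagonal_mul_diagonal
    (fun _ : Fin (n k) => f.comp (ContinuousMap.sigmaMk k)) fun _ =>
      g.comp (ContinuousMap.sigmaMk k)).symm
  map_zero' := funext fun _ => Matrix.diagonal_zero
  map_add' f g := funext fun k => (Matrix.diagonal_add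
    (fun _ : Fin (n k) => f.comp (ContinuousMap.sigmaMk k)) fun _ =>
      g.comp (ContinuousMap.sigmaMk k)).symm
  commutes' _ := rfl
  map_star' f := funext fun k => (Matrix.diagonal_conjTranspose
    fun _ : Fin (n k) => f.comp (ContinuousMap.sigmaMk k)).symm

theorem homCenter_apply (f : C(Σ k, X k, ℂ)) (k : Fin t) : homCenter (n := n) f k =
    Matrix.diagonal fun _ => f.comp (ContinuousMap.sigmaMk k) := rfl

theorem homCenter_mul_homUnit (f : C(Σ k, X k, ℂ)) (k : Fin t) (i j : Fin (n k)) :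
    homCenter f * homUnit (X := X) k i j =
      Pi.single k (Matrix.single i j (f.comp (ContinuousMap.sigmaMk k))) := by
  ext1 m
  by_cases hm : m = k
  · subst hm
    rw [Pi.mul_apply, homCenter_apply, homUnit, Pi.single_eq_same, Pi.single_eq_same]
    ext1 i' j'
    rw [Matrix.diagonal_mul, Matrix.single_apply, Matrix.single_apply, mul_ite, mul_one, mul_zero]
  · simp [homUnit, Pi.single_eq_of_ne hm]

theorem homUnit_mul_homCenter (f : C(Σ k, X k, ℂ)) (k : Fin t) (i j : Fin (n k)) :
    homUnit (X := X) k i j * homCenter f =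
      Pi.single k (Matrix.single i j (f.comp (ContinuousMap.sigmaMk k))) := by
  ext1 m
  by_cases hm : m = k
  · subst hm
    rw [Pi.mul_apply, homCenter_apply, homUnit, Pi.single_eq_same, Pi.single_eq_same]
    ext1 i' j'
    rw [Matrix.mul_diagonal, Matrix.single_apply, Matrix.single_apply, ite_mul, one_mul, zero_mul]
  · simp [homUnit, Pi.single_eq_of_ne hm]

theorem hom_decomp (b : Π k : Fin t, Matrix (Fin (n k)) (Fin (n k)) C(X k, ℂ)) :
    ∃ f : ∀ k, Fin (n k) → Fin (n k) → C(Σ k, X k, ℂ),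
      b = ∑ k, ∑ i, ∑ j, homCenter (f k i j) * homUnit (X := X) k i j := by
  refine ⟨fun k i j => ContinuousMap.sigma (Pi.single k (b k i j)), ?_⟩
  have h1 : ∀ k i j, (ContinuousMap.sigma (Pi.single k (b k i j))).comp
      (ContinuousMap.sigmaMk k) = b k i j := by
    intro k i j
    ext x
    simp
  simp only [homCenter_mul_homUnit, h1]
  ext1 m
  rw [Finset.sum_apply, Finset.sum_eq_single m]
  · simp only [Finset.sum_apply, Pi.single_eq_same]
    exact Matrix.matrix_eq_sum_single _
  · intro k _ hk
    simp [Finset.sum_apply, Pi.single_eq_of_ne hk.symm]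
  · simp

variable {H : Type*} [NormedAddCommGroup H] [InnerProductSpace ℂ H] [CompleteSpace H]

theorem Conn.comp {N : VonNeumannAlgebra H} {F G : Type*} {e e' : H →L[ℂ] H}
    {x y : F → H →L[ℂ] H} (h : Conn N e x e' y) (g : G → F) : Conn N e (x ∘ g) e' (y ∘ g) :=
  let ⟨γ, h1, h2, h3⟩ := h
  ⟨γ, h1, h2, fun a => h3 (g a)⟩

theorem conn_of_homogeneous {t : ℕ} {n : Fin t → ℕ} {X : Fin t → Type*}
    [∀ k, MetricSpace (X k)] [∀ k, CompactSpace (X k)] {A : Type*} [Ring A] [StarRing A]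
    [Algebra ℂ A] (e : A ≃⋆ₐ[ℂ] (Π k : Fin t, Matrix (Fin (n k)) (Fin (n k)) C(X k, ℂ)))
    {M : VonNeumannAlgebra H} {π ρ : A →⋆ₐ[ℂ] (H →L[ℂ] H)} (hπ : ∀ a, π a ∈ M)
    (hρ : ∀ a, ρ a ∈ M) (h : ApproxEquiv M π ρ) : Conn M 1 π 1 ρ := by
  classical
  let e' : (Π k : Fin t, Matrix (Fin (n k)) (Fin (n k)) C(X k, ℂ)) →⋆ₐ[ℂ] A :=
    (e.symm : _ →⋆ₐ[ℂ] A)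
  have h' : ApproxEquiv M (π.comp e') (ρ.comp e') := by
    intro F ε hε
    obtain ⟨u, hu, hF⟩ := h (F.image e') ε hε
    exact ⟨u, hu, fun b hb => hF _ (Finset.mem_image_of_mem _ hb)⟩
  have h1 := (h'.conn (ι := homCenter) isUnits_homUnit
    (fun f k i j => by rw [homCenter_mul_homUnit, homUnit_mul_homCenter]) hom_decomp
    (fun _ => hπ _) (fun _ => hρ _)).comp e
  have h2 : ∀ a, e' (e a) = a := fun a => e.symm_apply_apply a
  have h3 : ⇑(π.comp e') ∘ ⇑e = π := funext fun a => congrArg π (h2 a)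
  have h4 : ⇑(ρ.comp e') ∘ ⇑e = ρ := funext fun a => congrArg ρ (h2 a)
  rwa [h3, h4] at h1

end Homogeneous

section Orbit

variable {H : Type*} [NormedAddCommGroup H] [InnerProductSpace ℂ H] [CompleteSpace H]
variable {A : Type*} [CStarAlgebra A] {M : VonNeumannAlgebra H} {π ρ : A →⋆ₐ[ℂ] (H →L[ℂ] H)}

theorem via_one_iff {u : H →L[ℂ] H} : Via M u 1 1 ↔ u ∈ M ∧ u ∈ unitary (H →L[ℂ] H) :=
  ⟨fun h => ⟨h.mem, Unitary.mem_iff.2 ⟨h.init, h.fin⟩⟩,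
    fun h => ⟨h.1, (Unitary.mem_iff.1 h.2).1, (Unitary.mem_iff.1 h.2).2, IsPr.one⟩⟩

theorem mem_orbit {u : H →L[ℂ] H} (hu : Via M u 1 1) :
    (fun a => star u * π a * u) ∈ unitaryOrbitVN M π :=
  ⟨u, (via_one_iff.1 hu).1, (via_one_iff.1 hu).2, rfl⟩

theorem self_mem_orbit : ⇑π ∈ unitaryOrbitVN M π := by
  have h := mem_orbit (π := π) (M := M) (Via.refl IsPr.one)
  simpa using h

theorem isClosed_coe (M : VonNeumannAlgebra H) : IsClosed (M : Set (H →L[ℂ] H)) := by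
  rw [← M.centralizer_centralizer]
  exact Set.isClosed_centralizer _

theorem exists_hom_of_mem_closure (hπ : ∀ a, π a ∈ M) {f : A → H →L[ℂ] H}
    (hf : f ∈ closure (unitaryOrbitVN M π)) :
    ∃ ρ : A →⋆ₐ[ℂ] (H →L[ℂ] H), ⇑ρ = f ∧ ∀ a, ρ a ∈ M := by
  have h1 : ∀ g ∈ unitaryOrbitVN M π, ∃ ρ : A →⋆ₐ[ℂ] (H →L[ℂ] H), ⇑ρ = g ∧ ∀ a, ρ a ∈ M := by
    rintro _ ⟨u, hu, hu', rfl⟩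
    have hV := via_one_iff.2 ⟨hu, hu'⟩
    exact ⟨(conjHom u hV.init hV.fin).comp π, rfl,
      fun a => mul_mem (mul_mem (star_mem hu) (hπ a)) hu⟩
  have h2 : ∀ p : (A → H →L[ℂ] H) → Prop, IsClosed {g | p g} →
      (∀ ρ : A →⋆ₐ[ℂ] (H →L[ℂ] H), (∀ a, ρ a ∈ M) → p ρ) → p f := by
    intro p hp h
    refine closure_minimal (fun g hg => ?_) hp hf
    obtain ⟨ρ, rfl, hρ⟩ := h1 g hg
    exact h ρ hρ
  have hM : ∀ a, f a ∈ M := fun a => h2 (fun g => g a ∈ M)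
    ((isClosed_coe M).preimage (continuous_apply a)) fun ρ hρ => hρ a
  have hmul : ∀ a b, f (a * b) = f a * f b := fun a b => h2 (fun g => g (a * b) = g a * g b)
    (isClosed_eq (by fun_prop) (by fun_prop)) fun ρ _ => map_mul ρ a b
  have hadd : ∀ a b, f (a + b) = f a + f b := fun a b => h2 (fun g => g (a + b) = g a + g b)
    (isClosed_eq (by fun_prop) (by fun_prop)) fun ρ _ => map_add ρ a b
  have hstar : ∀ a, f (star a) = star (f a) := fun a => h2 (fun g => g (star a) = star (g a))
    (isClosed_eq (by fun_prop) (by fun_prop)) fun ρ _ => map_star ρ a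
  have halg : ∀ r : ℂ, f (algebraMap ℂ A r) = algebraMap ℂ _ r := fun r =>
    h2 (fun g => g (algebraMap ℂ A r) = algebraMap ℂ _ r)
    (isClosed_eq (by fun_prop) (by fun_prop)) fun ρ _ => AlgHomClass.commutes ρ r
  exact ⟨{ toFun := f
           map_one' := by simpa using halg 1
           map_mul' := hmul
           map_zero' := by simpa using halg 0
           map_add' := hadd
           commutes' := halg
           map_star' := hstar }, rfl, hM⟩

theorem approxEquiv_of_mem_closure {f : A → H →L[ℂ] H}
    (hf : f ∈ closure (unitaryOrbitVN M π)) : ApproxEquiv M π f := by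
  intro F ε hε
  have hU : (F : Set A).pi (fun a => Metric.ball (f a) ε) ∈ 𝓝 f :=
    set_pi_mem_nhds F.finite_toSet fun a _ => Metric.ball_mem_nhds _ hε
  obtain ⟨_, hg, u, hu, hu', rfl⟩ := mem_closure_iff_nhds.1 hf _ hU
  have hV := via_one_iff.2 ⟨hu, hu'⟩
  refine ⟨u, hV, fun b hb => ?_⟩
  have h1 : dist (star u * π b * u) (f b) < ε := hg b hb
  have h2 : π b * u - u * f b = u * (star u * π b * u - f b) := by
    rw [mul_sub, ← mul_assoc, ← mul_assoc, hV.fin, one_mul]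
  rw [h2]
  refine (norm_mul_le _ _).trans ?_
  rw [dist_eq_norm] at h1
  nlinarith [hV.norm_le_one, norm_nonneg (star u * π b * u - f b)]

theorem Conn.strongInternalPath (h : Conn M 1 π 1 ρ) : StrongInternalPathVN M π ρ :=
  let ⟨γ, h1, h2, h3⟩ := h
  ⟨γ, h1, fun t ht => via_one_iff.1 (h2 t ht), h3⟩

theorem joinedIn_orbit {w : H →L[ℂ] H} (hw : Via M w 1 1) :
    JoinedIn (unitaryOrbitVN M π) π (fun a => star w * π a * w) := by
  have h := (exists_joinedIn_commutant hw.init hw.fin).map (f := fun v a => star v * π a * v)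
    (by fun_prop)
  have h1 : (fun a => star (1 : H →L[ℂ] H) * π a * 1) = π := by simp
  rw [h1] at h
  refine h.mono ?_
  rintro _ ⟨v, ⟨hv1, hv2, hv3⟩, rfl⟩
  refine mem_orbit ⟨mem_of_commute fun c hc => ?_, hv1, hv2, IsPr.one⟩
  exact hv3 c (commute_of_mem hw.mem hc) (commute_of_mem (star_mem hw.mem) hc)

theorem Conn.joinedIn (h : Conn M 1 π 1 ρ) : JoinedIn (closure (unitaryOrbitVN M π)) π ρ := by
  obtain ⟨γ, h1, h2, h3⟩ := h
  have h0 : (0 : ℝ) ∈ Set.Ico (0 : ℝ) 1 := ⟨le_rfl, one_pos⟩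
  refine ((joinedIn_orbit (h2 0 h0)).mono subset_closure).trans ?_
  let F : ℝ → A → H →L[ℂ] H := fun t a => star (γ t) * π a * γ t
  refine JoinedIn.ofLine (f := Function.update F 1 ρ) ?_ ?_ ?_ ?_
  · rw [unitInterval, continuousOn_update_iff, Set.Icc_sdiff_right]
    refine ⟨continuousOn_pi.2 fun a => ?_, fun _ => tendsto_pi_nhds.2 h3⟩
    exact ((continuous_star.comp_continuousOn h1).mul continuousOn_const).mul h1
  · rw [Function.update_of_ne zero_ne_one]
  · rw [Function.update_self]
  · rintro _ ⟨t, ht, rfl⟩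
    by_cases h : t = 1
    · subst h
      rw [Function.update_self]
      have := right_nhdsWithin_Ico_neBot (zero_lt_one' ℝ)
      refine mem_closure_of_tendsto (tendsto_pi_nhds.2 h3) ?_
      filter_upwards [self_mem_nhdsWithin] with t ht
      exact mem_orbit (h2 t ht)
    · rw [Function.update_of_ne h]
      exact subset_closure (mem_orbit (h2 t ⟨ht.1, lt_of_le_of_ne ht.2 h⟩))

end Orbit

end VNPath

theorem stmt16 (A : Type*) [CStarAlgebra A] [TopologicalSpace.SeparableSpace A]
    -- `A` is homogeneous: *-isomorphic to a finite direct sum `⊕ₖ M_{n k}(C(X k))`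
    (t : ℕ) (n : Fin t → ℕ) (X : Fin t → Type*)
    [∀ k, MetricSpace (X k)] [∀ k, CompactSpace (X k)]
    (e : A ≃⋆ₐ[ℂ] (Π k : Fin t, Matrix (Fin (n k)) (Fin (n k)) C(X k, ℂ)))
    (H : Type*) [NormedAddCommGroup H] [InnerProductSpace ℂ H] [CompleteSpace H]
    (M : VonNeumannAlgebra H) (π : A →⋆ₐ[ℂ] (H →L[ℂ] H)) (hπ : ∀ a, π a ∈ M) :
    IsPathConnected (closure (unitaryOrbitVN M π)) ∧
    ∀ ρ : A →⋆ₐ[ℂ] (H →L[ℂ] H), ⇑ρ ∈ closure (unitaryOrbitVN M π) →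
      StrongInternalPathVN M π ρ := by
  have key : ∀ ρ : A →⋆ₐ[ℂ] (H →L[ℂ] H), ⇑ρ ∈ closure (unitaryOrbitVN M π) →
      VNPath.Conn M 1 π 1 ρ := by
    intro ρ hρ
    obtain ⟨ρ', h1, h2⟩ := VNPath.exists_hom_of_mem_closure hπ hρ
    obtain rfl : ρ' = ρ := DFunLike.coe_injective h1
    exact VNPath.conn_of_homogeneous e hπ h2 (VNPath.approxEquiv_of_mem_closure hρ)
  refine ⟨⟨π, subset_closure VNPath.self_mem_orbit, fun {f} hf => ?_⟩,
    fun ρ hρ => (key ρ hρ).strongInternalPath⟩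
  obtain ⟨ρ, rfl, -⟩ := VNPath.exists_hom_of_mem_closure hπ hf
  exact (key ρ hf).joinedIn
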